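/- Let d = 3 and for each n let G_n = Z_n^3 be the 3-dimensional discrete torus. Let X_1, X_2 be independent lazy random walks on G_n each started from the uniform distribution, and let A_i be the painted set as defined. Then there exists a constant α_3 with 0 < α_3 < ∞ such that lim_{n→∞} Var(|A_i|)/n^4 = α_3/4. -/

import Mathlib

open MeasureTheory ProbabilityTheory Filter

attribute [local instance] Classical.propDecidable

noncomputable section

namespace RWPaint

variable {V : Type*} [Fintype V]

/-- The degree of a vertex. -/
def deg (G : SimpleGraph V) (x : V) : ℕ := (Finset.univ.filter fun y => G.Adj x y).card

/-- One-step transition kernel of the lazy random walk on a finite graph: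
holding probability `1/2`, otherwise a uniformly chosen neighbour. -/
def K (G : SimpleGraph V) (x y : V) : ℝ :=
  if x = y then (if deg G x = 0 then 1 else 1 / 2)
  else if G.Adj x y then 1 / (2 * (deg G x : ℝ)) else 0

/-- The `t`-step transition kernel. -/
def Kpow (G : SimpleGraph V) : ℕ → V → V → ℝ
  | 0 => fun x y => if x = y then 1 else 0
  | t + 1 => fun x y => ∑ z, Kpow G t x z * K G z y

/-- The uniform (stationary) probability of a single vertex. -/
def unif (V : Type*) [Fintype V] : ℝ := (Fintype.card V : ℝ)⁻¹

/-- The uniform mixing time. -/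
def Tmix (G : SimpleGraph V) : ℕ :=
  sInf {t : ℕ | ∀ x y : V, |Kpow G t x y / unif V - 1| ≤ 1 / 4}

/-- The Green's function `g(x,y) = ∑_{t=0}^{Tmix} p^t(x,y)`. -/
def green (G : SimpleGraph V) (x y : V) : ℝ :=
  ∑ t ∈ Finset.range (Tmix G + 1), Kpow G t x y

/-- The kernel killed on (entering) the set `S`. -/
def Kkill (G : SimpleGraph V) (S : Finset V) (x y : V) : ℝ :=
  if y ∈ S then 0 else K G x y

/-- Powers of the killed kernel. -/
def KkillPow (G : SimpleGraph V) (S : Finset V) : ℕ → V → V → ℝ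
  | 0 => fun x y => if x = y then 1 else 0
  | t + 1 => fun x y => ∑ z, KkillPow G S t x z * Kkill G S z y

/-- `P_x[τ(S) ≤ T]`, the probability that the lazy walk started at `x` visits `S`
by time `T`. -/
def hitBy (G : SimpleGraph V) (S : Finset V) (x : V) (T : ℕ) : ℝ :=
  if x ∈ S then 1 else 1 - ∑ z, KkillPow G S T x z

/-- `f_{n,c}(x,y) = P_x[τ(y) ≤ c T_mix]`. -/
def fnc (G : SimpleGraph V) (c : ℝ) (x y : V) : ℝ :=
  hitBy G {y} x ⌊c * (Tmix G : ℝ)⌋₊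

/-- `f̄_{n,c} = ∑_y f_{n,c}(x,y) π(y)` (averaged also over `x`; by vertex
transitivity this agrees with the value for any fixed `x`). -/
def fbar (G : SimpleGraph V) (c : ℝ) : ℝ :=
  (∑ x : V, ∑ y : V, fnc G c x y) / (Fintype.card V : ℝ) ^ 2

/-- `F_{n,c} = ∑_{x,y} (f_{n,c}(x,y) - f̄_{n,c})^2`. -/
def Fquad (G : SimpleGraph V) (c : ℝ) : ℝ :=
  ∑ x : V, ∑ y : V, (fnc G c x y - fbar G c) ^ 2

/-- `Γ_n = c₀ T_mix log |V|`. -/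
def gammaTime (G : SimpleGraph V) (c₀ : ℝ) : ℕ :=
  ⌊c₀ * (Tmix G : ℝ) * Real.log (Fintype.card V)⌋₊

/-- `P_x[X_t = z | τ(y) ≥ t]` as a combinatorial formula (meaningful for
`x ≠ y` and `t ≥ 1`). -/
def condAtProb (G : SimpleGraph V) (y x z : V) (t : ℕ) : ℝ :=
  (∑ w, KkillPow G {y} (t - 1) x w * K G w z) / (∑ w, KkillPow G {y} (t - 1) x w)

/-- `∑_{t=0}^{c T_mix} p^t(x,y)`. -/
def greenC (G : SimpleGraph V) (c : ℝ) (x y : V) : ℝ :=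
  ∑ t ∈ Finset.range (⌊c * (Tmix G : ℝ)⌋₊ + 1), Kpow G t x y

/-- A graph is vertex transitive if its automorphism group acts transitively. -/
def IsVertexTransitive (G : SimpleGraph V) : Prop :=
  ∀ x y : V, ∃ e : G ≃g G, e x = y

/-- The probability of a trajectory prefix for the lazy walk with initial
distribution `init`. -/
def walkP (G : SimpleGraph V) (init : V → ℝ) (n : ℕ) (v : ℕ → V) : ℝ :=
  init (v 0) * ∏ i ∈ Finset.range n, K G (v i) (v (i + 1))

/-- Point mass initial distribution. -/
def delta (x : V) : V → ℝ := fun y => if y = x then 1 else 0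

/-- Uniform initial distribution. -/
def uinit (V : Type*) [Fintype V] : V → ℝ := fun _ => (Fintype.card V : ℝ)⁻¹

/-- `X₁, X₂` are independent lazy random walks on `G` with initial
distributions `init₁, init₂`, defined on the probability space `(Ω, P)`:
all finite-dimensional distributions factorize as products of trajectory-prefix
probabilities. -/
structure IsWalkPair {Ω : Type*} [MeasurableSpace Ω] (G : SimpleGraph V) (P : Measure Ω)
    (X₁ X₂ : ℕ → Ω → V) (init₁ init₂ : V → ℝ) : Prop where
  meas₁ : ∀ (t : ℕ) (x : V), MeasurableSet {ω | X₁ t ω = x}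
  meas₂ : ∀ (t : ℕ) (x : V), MeasurableSet {ω | X₂ t ω = x}
  law : ∀ (n : ℕ) (v w : ℕ → V),
    (P {ω | (∀ i ≤ n, X₁ i ω = v i) ∧ ∀ i ≤ n, X₂ i ω = w i}).toReal
      = walkP G init₁ n v * walkP G init₂ n w

/-- `X₁, X₂` are independent stationary lazy random walks on `G`, together with
a family `ξ` of independent fair coins (one per vertex, used to break ties),
all defined on the probability space `(Ω, P)`. -/
structure IsPaintSetup {Ω : Type*} [MeasurableSpace Ω] (G : SimpleGraph V) (P : Measure Ω)
    (X₁ X₂ : ℕ → Ω → V) (ξ : V → Ω → Bool) : Prop where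
  meas₁ : ∀ (t : ℕ) (x : V), MeasurableSet {ω | X₁ t ω = x}
  meas₂ : ∀ (t : ℕ) (x : V), MeasurableSet {ω | X₂ t ω = x}
  measξ : ∀ x : V, MeasurableSet {ω | ξ x ω = true}
  law : ∀ (n : ℕ) (v w : ℕ → V) (b : V → Bool),
    (P {ω | ((∀ i ≤ n, X₁ i ω = v i) ∧ ∀ i ≤ n, X₂ i ω = w i) ∧ ∀ x, ξ x ω = b x}).toReal
      = walkP G (uinit V) n v * walkP G (uinit V) n w * (1 / 2) ^ Fintype.card V

/-- The hitting time `τ(x)` of a vertex `x` (with value `⊤` if `x` is never visited). -/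
def hitTime {Ω : Type*} (X : ℕ → Ω → V) (x : V) (ω : Ω) : ℕ∞ :=
  ⨅ (s : ℕ) (_ : X s ω = x), (s : ℕ∞)

/-- `τ(x,y) = τ(x) ⊓ τ(y)`. -/
def hitTime2 {Ω : Type*} (X : ℕ → Ω → V) (x y : V) (ω : Ω) : ℕ∞ :=
  min (hitTime X x ω) (hitTime X y ω)

/-- `|𝒜₁|`: the number of vertices first visited by `X₁` (ties broken by the coins `ξ`). -/
def paintedCount {Ω : Type*} (X₁ X₂ : ℕ → Ω → V) (ξ : V → Ω → Bool) (ω : Ω) : ℕ :=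
  Nat.card {x : V // hitTime X₁ x ω < hitTime X₂ x ω ∨
    (hitTime X₁ x ω = hitTime X₂ x ω ∧ ξ x ω = true)}

/-- The event `H(x,y) = {τ₁(x) < min(τ₁(y), τ₂(x), τ₂(y))}`. -/
def Hevent {Ω : Type*} (X₁ X₂ : ℕ → Ω → V) (x y : V) : Set Ω :=
  {ω | hitTime X₁ x ω < min (hitTime X₁ y ω) (min (hitTime X₂ x ω) (hitTime X₂ y ω))}

/-- `Y₂ = X₂(τ₁(x,y))`. -/
def Ytwo {Ω : Type*} (X₁ X₂ : ℕ → Ω → V) (x y : V) (ω : Ω) : V :=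
  X₂ (hitTime2 X₁ x y ω).toNat ω

/-- `π̃(z;x,y) = P[X₂(τ₁(x,y)) = z | H(x,y)]`. -/
def pitilde {Ω : Type*} [MeasurableSpace Ω] (P : Measure Ω) (X₁ X₂ : ℕ → Ω → V) (x y z : V) : ℝ :=
  (P (Hevent X₁ X₂ x y ∩ {ω | Ytwo X₁ X₂ x y ω = z})).toReal
    / (P (Hevent X₁ X₂ x y)).toReal

/-- The event `A(x,y) = {τ₁(x,y) ≥ τ₂(x,y) > τ₁(x,y) - Γ, τ₁(x) < τ₁(y)}`. -/
def Aevent {Ω : Type*} (X₁ X₂ : ℕ → Ω → V) (x y : V) (Γ : ℕ) : Set Ω :=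
  {ω | hitTime2 X₂ x y ω ≤ hitTime2 X₁ x y ω ∧
    hitTime2 X₁ x y ω - (Γ : ℕ∞) < hitTime2 X₂ x y ω ∧
    hitTime X₁ x ω < hitTime X₁ y ω}

/-- Conditional probability `P[A | B]`. -/
def condGiven {Ω : Type*} [MeasurableSpace Ω] (P : Measure Ω) (A B : Set Ω) : ℝ :=
  (P (A ∩ B)).toReal / (P B).toReal

/-- Assumption 1 of the paper. -/
structure Assumption1 (V : ℕ → Type*) [∀ n, Fintype (V n)]
    (G : ∀ n, SimpleGraph (V n)) : Prop where
  conn : ∀ n, (G n).Connected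
  vt : ∀ n, IsVertexTransitive (G n)
  card_top : Tendsto (fun n => Fintype.card (V n)) atTop atTop
  tmix_small : Tendsto (fun n =>
    (Tmix (G n) : ℝ) * (Real.log (Fintype.card (V n))) ^ 2 / (Fintype.card (V n) : ℝ))
    atTop (nhds 0)
  tmix_top : Tendsto (fun n => Tmix (G n)) atTop atTop
  green_sq_small : ∃ ε : ℕ → ℝ, Tendsto ε atTop (nhds 0) ∧
    ∀ n, ∀ x : V n, ∑ y ∈ Finset.univ.erase x, (green (G n) x y) ^ 2
      ≤ ε n * (Tmix (G n) : ℝ) / Real.log (Fintype.card (V n))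
  hit_miss : ∃ ρ : ℝ, ρ < 1 ∧ ∀ n, ∀ x y z : V n, x ≠ y → x ≠ z → y ≠ z →
    hitBy (G n) {y, z} x (Tmix (G n)) ≤ ρ

/-- The discrete torus `ℤ_n^d`. -/
def torus (d n : ℕ) : SimpleGraph (Fin d → ZMod n) where
  Adj x y := x ≠ y ∧ ∃ i, y - x = Pi.single i 1 ∨ x - y = Pi.single i 1
  symm := by
    refine ⟨?_⟩
    rintro x y ⟨hne, i, h | h⟩
    · exact ⟨hne.symm, i, Or.inr h⟩
    · exact ⟨hne.symm, i, Or.inl h⟩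
  loopless := ⟨fun x h => h.1 rfl⟩

/-- The hypercube `ℤ_2^n`. -/
def hypercube (n : ℕ) : SimpleGraph (Fin n → Bool) where
  Adj x y := x ≠ y ∧ ∃ i, ∀ j, j ≠ i → x j = y j
  symm := by
    refine ⟨?_⟩
    rintro x y ⟨hne, i, h⟩
    exact ⟨hne.symm, i, fun j hj => (h j hj).symm⟩
  loopless := ⟨fun x h => h.1 rfl⟩

/-- The Cayley graph of the symmetric group `S_n` generated by the transpositions. -/
def transpositionGraph (n : ℕ) : SimpleGraph (Equiv.Perm (Fin n)) where
  Adj σ τ := (σ * τ⁻¹).IsSwap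
  symm := by
    refine ⟨?_⟩
    rintro σ τ ⟨a, b, hab, h⟩
    exact ⟨a, b, hab, by rw [show τ * σ⁻¹ = (σ * τ⁻¹)⁻¹ by group, h, Equiv.swap_inv]⟩
  loopless := by
    refine ⟨?_⟩
    intro σ h
    obtain ⟨a, b, hab, h⟩ := h
    rw [mul_inv_cancel] at h
    exact hab (by simpa [Equiv.swap_apply_left] using Equiv.ext_iff.mp h a)

/-- One-step kernel of the lazy simple random walk on `ℤ^d`. -/
def KZ (d : ℕ) (x y : Fin d → ℤ) : ℝ :=
  if x = y then 1 / 2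
  else if ∃ i, y - x = Pi.single i 1 ∨ x - y = Pi.single i 1 then 1 / (4 * d) else 0

/-- `t`-step kernel of the lazy simple random walk on `ℤ^d`. -/
def KZpow (d : ℕ) : ℕ → (Fin d → ℤ) → (Fin d → ℤ) → ℝ
  | 0 => fun x y => if x = y then 1 else 0
  | t + 1 => fun x y => ∑' z, KZpow d t x z * KZ d z y

/-- The Green's function `G(x; ℤ^d) = ∑_{t=0}^∞ p^t(0,x)` of the lazy walk on `ℤ^d`. -/
def greenZ (d : ℕ) (x : Fin d → ℤ) : ℝ := ∑' t : ℕ, KZpow d t 0 x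

/-- `α_d` for `d ≥ 5`. -/
def alphaHigh (d : ℕ) : ℝ := (∑' y : Fin d → ℤ, (greenZ d y) ^ 2) / (greenZ d 0) ^ 2

/-- The normalization `h_d(n)`. -/
def hfun (d n : ℕ) : ℝ :=
  if d = 3 then (n : ℝ) ^ 4
  else if d = 4 then (n : ℝ) ^ 4 * Real.log n
  else (n : ℝ) ^ d

/-- Matrix powers of an abstract kernel. -/
def mpow (p : V → V → ℝ) : ℕ → V → V → ℝ
  | 0 => fun x y => if x = y then 1 else 0
  | t + 1 => fun x y => ∑ z, mpow p t x z * p z y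

/-- Total variation distance between two (probability) vectors. -/
def tvDist (μ ν : V → ℝ) : ℝ := (1 / 2) * ∑ x, |μ x - ν x|


/-- Spectral calculus kernel. -/
def op {V I : Type*} [Fintype V] [Fintype I] (μ : I → ℝ) (e : I → V → V → ℝ)
    (p : ℝ → ℝ) (x y : V) : ℝ :=
  (Fintype.card V : ℝ)⁻¹ * ∑ i, p (μ i) * e i x y

/-- Moments `N⁻¹ ∑ p(μ_i)`. -/
def mom (V : Type*) {I : Type*} [Fintype V] [Fintype I] (μ : I → ℝ) (p : ℝ → ℝ) : ℝ :=
  (Fintype.card V : ℝ)⁻¹ * ∑ i, p (μ i)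

structure SpecKer {V I : Type*} [Fintype V] [Fintype I] (M : Matrix V V ℝ) (μ : I → ℝ)
    (e : I → V → V → ℝ) : Prop where
  symm : ∀ x y, M x y = M y x
  nonneg : ∀ x y, 0 ≤ M x y
  row : ∀ x, ∑ y, M x y = 1
  mu0 : ∀ i, 0 ≤ μ i
  mu1 : ∀ i, μ i < 1
  e_le : ∀ i x y, |e i x y| ≤ 1
  e_diag : ∀ i x, e i x x = 1
  e_symm : ∀ i x y, e i x y = e i y x
  pow : ∀ t x y, (M ^ t) x y = (Fintype.card V : ℝ)⁻¹ + op μ e (fun u => u ^ t) x y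
  conv : ∀ (p q : ℝ → ℝ) x y, ∑ b, op μ e p x b * op μ e q b y = op μ e (fun u => p u * q u) x y
  sum0 : ∀ (p : ℝ → ℝ) x, ∑ y, op μ e p x y = 0

namespace SpecKer

variable {V I : Type*} [Fintype V] [Fintype I] {M : Matrix V V ℝ} {μ : I → ℝ}
    {e : I → V → V → ℝ}

lemma op_diag (h : SpecKer M μ e) (p : ℝ → ℝ) (x : V) : op μ e p x x = mom V μ p := by
  simp [op, mom, h.e_diag]

lemma op_symm (h : SpecKer M μ e) (p : ℝ → ℝ) (x y : V) : op μ e p x y = op μ e p y x := by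
  simp only [op, h.e_symm _ x y]

lemma abs_op_le (h : SpecKer M μ e) (p : ℝ → ℝ) (hp : ∀ i, 0 ≤ p (μ i)) (x y : V) :
    |op μ e p x y| ≤ mom V μ p := by
  unfold op mom
  rw [abs_mul, abs_of_nonneg (by positivity : (0:ℝ) ≤ (Fintype.card V : ℝ)⁻¹)]
  gcongr
  refine (Finset.abs_sum_le_sum_abs _ _).trans (Finset.sum_le_sum fun i _ => ?_)
  rw [abs_mul, abs_of_nonneg (hp i)]
  exact mul_le_of_le_one_right (hp i) (h.e_le i x y)

lemma sum_op_sq (h : SpecKer M μ e) (p : ℝ → ℝ) (x : V) :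
    ∑ b, (op μ e p x b) ^ 2 = mom V μ (fun u => p u ^ 2) := by
  rw [← h.op_diag _ x]
  simp only [pow_two]
  rw [← h.conv]
  exact Finset.sum_congr rfl fun b _ => by rw [h.op_symm p b x]

lemma mom_mono (p q : ℝ → ℝ) (hpq : ∀ i, p (μ i) ≤ q (μ i)) : mom V μ p ≤ mom V μ q := by
  unfold mom
  gcongr with i
  exact hpq i

lemma mom_nonneg (p : ℝ → ℝ) (hp : ∀ i, 0 ≤ p (μ i)) : 0 ≤ mom V μ p := by
  unfold mom
  exact mul_nonneg (by positivity) (Finset.sum_nonneg fun i _ => hp i)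

lemma pow_nonneg (h : SpecKer M μ e) (t : ℕ) : ∀ x y, 0 ≤ (M ^ t) x y := by
  induction t with
  | zero => intro x y; simp only [_root_.pow_zero, Matrix.one_apply]; split_ifs <;> norm_num
  | succ t ih =>
    intro x y
    rw [_root_.pow_succ, Matrix.mul_apply]
    exact Finset.sum_nonneg fun z _ => mul_nonneg (ih _ _) (h.nonneg _ _)

lemma pow_symm (h : SpecKer M μ e) (t : ℕ) (x y : V) : (M ^ t) x y = (M ^ t) y x := by
  rw [h.pow, h.pow, h.op_symm]

lemma pow_row (h : SpecKer M μ e) (t : ℕ) : ∀ x, ∑ y, (M ^ t) x y = 1 := by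
  induction t with
  | zero => intro x; simp [Matrix.one_apply]
  | succ t ih =>
    intro x
    simp only [_root_.pow_succ, Matrix.mul_apply]
    rw [Finset.sum_comm]
    simp only [← Finset.mul_sum, h.row, mul_one, ih]

/-- `s = 1/(1-u)` -/
lemma one_sub_pos (h : SpecKer M μ e) (i : I) : 0 < 1 - μ i := by linarith [h.mu1 i]

end SpecKer

/-- tail of the Green function. -/
def gt {V I : Type*} [Fintype V] [Fintype I] (μ : I → ℝ) (e : I → V → V → ℝ) (t : ℕ) :
    V → V → ℝ := op μ e (fun u => u ^ t * (1 - u)⁻¹)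

def Gt (V : Type*) {I : Type*} [Fintype V] [Fintype I] (μ : I → ℝ) (t : ℕ) : ℝ :=
  mom V μ (fun u => u ^ t * (1 - u)⁻¹)

def at' (V : Type*) {I : Type*} [Fintype V] [Fintype I] (μ : I → ℝ) (t : ℕ) : ℝ :=
  mom V μ (fun u => u ^ t)

def Am (V : Type*) {I : Type*} [Fintype V] [Fintype I] (μ : I → ℝ) (j : ℕ) : ℝ :=
  mom V μ (fun u => ((1 - u)⁻¹) ^ j)

/-- first hitting distribution of `y` from `w` -/
def ff {V : Type*} [Fintype V] (M : Matrix V V ℝ) (y : V) : ℕ → V → ℝ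
  | 0 => fun w => if w = y then 1 else 0
  | t + 1 => fun w => if w = y then 0 else ∑ z, M w z * ff M y t z

def FF {V : Type*} [Fintype V] (M : Matrix V V ℝ) (y : V) : ℕ → V → ℝ
  | 0 => fun w => if w = y then 0 else 1
  | t + 1 => fun w => if w = y then 0 else ∑ z, M w z * FF M y t z

namespace SpecKer

variable {V I : Type*} [Fintype V] [Fintype I] {M : Matrix V V ℝ} {μ : I → ℝ}
    {e : I → V → V → ℝ}

lemma ff_nonneg (h : SpecKer M μ e) (y : V) (t : ℕ) : ∀ w, 0 ≤ ff M y t w := by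
  induction t with
  | zero => intro w; simp only [ff]; split_ifs <;> norm_num
  | succ t ih =>
    intro w; simp only [ff]; split_ifs
    · exact le_rfl
    · exact Finset.sum_nonneg fun z _ => mul_nonneg (h.nonneg _ _) (ih _)

lemma FF_nonneg (h : SpecKer M μ e) (y : V) (t : ℕ) : ∀ w, 0 ≤ FF M y t w := by
  induction t with
  | zero => intro w; simp only [FF]; split_ifs <;> norm_num
  | succ t ih =>
    intro w; simp only [FF]; split_ifs
    · exact le_rfl
    · exact Finset.sum_nonneg fun z _ => mul_nonneg (h.nonneg _ _) (ih _)

lemma ff_zero_add (y w : V) : ff M y 0 w + FF M y 0 w = 1 := by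
  simp only [ff, FF]; split_ifs <;> norm_num

lemma ff_succ_eq (h : SpecKer M μ e) (y : V) (t : ℕ) :
    ∀ w, ff M y (t + 1) w = FF M y t w - FF M y (t + 1) w := by
  induction t with
  | zero =>
    intro w
    by_cases hw : w = y
    · simp [ff, FF, hw]
    · rw [ff, FF, FF]
      simp only [hw, if_false]
      rw [eq_sub_iff_add_eq, ← Finset.sum_add_distrib, ← h.row w]
      exact Finset.sum_congr rfl fun z _ => by rw [← mul_add, ff_zero_add, mul_one]
  | succ t ih =>
    intro w
    by_cases hw : w = y
    · simp [ff, FF, hw]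
    · rw [ff, FF, FF]
      simp only [hw, if_false]
      rw [← Finset.sum_sub_distrib]
      exact Finset.sum_congr rfl fun z _ => by rw [ih]; ring

lemma sum_ff (h : SpecKer M μ e) (y : V) (t : ℕ) (w : V) :
    ∑ s ∈ Finset.range (t + 1), ff M y s w = 1 - FF M y t w := by
  induction t with
  | zero => simp; linarith [ff_zero_add (M := M) y w]
  | succ t ih => rw [Finset.sum_range_succ, ih, h.ff_succ_eq]; ring

lemma FF_le_one (h : SpecKer M μ e) (y : V) (t : ℕ) (w : V) : FF M y t w ≤ 1 := by
  have := h.sum_ff y t w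
  have h2 : 0 ≤ ∑ s ∈ Finset.range (t + 1), ff M y s w :=
    Finset.sum_nonneg fun s _ => h.ff_nonneg y s w
  linarith

lemma sum_ff_le (h : SpecKer M μ e) (y : V) (t : ℕ) (w : V) :
    ∑ s ∈ Finset.range t, ff M y s w ≤ 1 := by
  rcases t with _ | t
  · simp
  · rw [h.sum_ff]; linarith [h.FF_nonneg y t w]

lemma renewal (h : SpecKer M μ e) (y : V) (t : ℕ) : ∀ w,
    (M ^ t) w y = ∑ s ∈ Finset.range (t + 1), ff M y s w * (M ^ (t - s)) y y := by
  induction t with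
  | zero => intro w; simp [ff, Matrix.one_apply]
  | succ t ih =>
    intro w
    rw [Finset.sum_range_succ']
    by_cases hw : w = y
    · subst hw; simp [ff]
    · simp only [ff, hw, if_false, zero_mul, add_zero, Nat.add_sub_add_right]
      rw [_root_.pow_succ', Matrix.mul_apply]
      simp only [ih, Finset.mul_sum, Finset.sum_mul]
      rw [Finset.sum_comm]
      exact Finset.sum_congr rfl fun s _ => Finset.sum_congr rfl fun z _ => by ring

lemma ff_le_pow (h : SpecKer M μ e) (y : V) (t : ℕ) (w : V) : ff M y t w ≤ (M ^ t) w y := by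
  rw [h.renewal y t w, Finset.sum_range_succ]
  have : 0 ≤ ∑ s ∈ Finset.range t, ff M y s w * (M ^ (t - s)) y y :=
    Finset.sum_nonneg fun s _ => mul_nonneg (h.ff_nonneg _ _ _) (h.pow_nonneg _ _ _)
  simp; linarith

lemma sum_ff_w (h : SpecKer M μ e) (y : V) (t : ℕ) : ∑ w, ff M y t w ≤ 1 := by
  rw [← h.pow_row t y]
  exact Finset.sum_le_sum fun w _ => (h.ff_le_pow y t w).trans (h.pow_symm t w y).le

lemma q_eq (h : SpecKer M μ e) (y : V) (t : ℕ) (w : V) :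
    op μ e (fun u => u ^ t) w y = ∑ s ∈ Finset.range (t + 1), ff M y s w * at' V μ (t - s)
      - (Fintype.card V : ℝ)⁻¹ * FF M y t w := by
  have h1 := h.renewal y t w
  simp only [h.pow, h.op_diag, mul_add, Finset.sum_add_distrib] at h1
  rw [← Finset.sum_mul, h.sum_ff] at h1
  unfold at'
  linarith

lemma gt_sub (h : SpecKer M μ e) (t : ℕ) (x y : V) :
    gt μ e t x y - gt μ e (t + 1) x y = op μ e (fun u => u ^ t) x y := by
  unfold gt op
  rw [← mul_sub, ← Finset.sum_sub_distrib]
  congr 1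
  refine Finset.sum_congr rfl fun i _ => ?_
  have := (h.one_sub_pos i).ne'
  field_simp
  ring

lemma Gt_sub (h : SpecKer M μ e) (t : ℕ) :
    Gt V μ t - Gt V μ (t + 1) = at' V μ t := by
  unfold Gt at' mom
  rw [← mul_sub, ← Finset.sum_sub_distrib]
  congr 1
  refine Finset.sum_congr rfl fun i _ => ?_
  have := (h.one_sub_pos i).ne'
  field_simp
  ring

lemma Gt_zero : Gt V μ 0 = Am V μ 1 := by simp [Gt, Am]

lemma gpos (h : SpecKer M μ e) (t j : ℕ) (i : I) : 0 ≤ (μ i) ^ t * ((1 - μ i)⁻¹) ^ j := by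
  have := h.mu0 i
  have := h.one_sub_pos i
  positivity

lemma Am_nonneg (h : SpecKer M μ e) (j : ℕ) : 0 ≤ Am V μ j :=
  mom_nonneg _ fun i => by simpa using h.gpos 0 j i

lemma Gt_nonneg (h : SpecKer M μ e) (t : ℕ) : 0 ≤ Gt V μ t :=
  mom_nonneg _ fun i => by simpa using h.gpos t 1 i

lemma at_nonneg (h : SpecKer M μ e) (t : ℕ) : 0 ≤ at' V μ t :=
  mom_nonneg _ fun i => by simpa using h.gpos t 0 i

lemma abs_gt_le (h : SpecKer M μ e) (t : ℕ) (x y : V) : |gt μ e t x y| ≤ Gt V μ t :=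
  h.abs_op_le _ (fun i => by simpa using h.gpos t 1 i) x y

lemma Gt_le (h : SpecKer M μ e) (t : ℕ) : Gt V μ t ≤ Am V μ 1 := by
  refine mom_mono _ _ fun i => ?_
  simp only [_root_.pow_one]
  refine mul_le_of_le_one_left (inv_nonneg.2 (h.one_sub_pos i).le) ?_
  exact pow_le_one₀ (h.mu0 i) (h.mu1 i).le

lemma sum_at_le (h : SpecKer M μ e) (L : ℕ) : ∑ t ∈ Finset.range L, at' V μ t ≤ Am V μ 1 := by
  have : ∑ t ∈ Finset.range L, at' V μ t = Gt V μ 0 - Gt V μ L := by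
    rw [← Finset.sum_range_sub' (fun t => Gt V μ t) L]
    exact Finset.sum_congr rfl fun t _ => (h.Gt_sub t).symm
  rw [this, Gt_zero]
  linarith [h.Gt_nonneg L]

/-- generic: convolution partial sums -/
lemma sum_conv_le (a b : ℕ → ℝ) (ha : ∀ t, 0 ≤ a t) (hb : ∀ t, 0 ≤ b t) (B : ℝ)
    (hB : ∀ L, ∑ t ∈ Finset.range L, b t ≤ B) (L : ℕ) :
    ∑ t ∈ Finset.range L, ∑ s ∈ Finset.range (t + 1), a s * b (t - s)
      ≤ (∑ s ∈ Finset.range L, a s) * B := by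
  rw [Finset.range_eq_Ico, Finset.sum_sigma' ]
  have : ∑ x ∈ (Finset.Ico 0 L).sigma fun t => Finset.range (t + 1), a x.2 * b (x.1 - x.2)
      = ∑ s ∈ Finset.range L, ∑ r ∈ Finset.range (L - s), a s * b r := by
    rw [Finset.sum_sigma']
    refine Finset.sum_bij' (fun x _ => ⟨x.2, x.1 - x.2⟩) (fun x _ => ⟨x.1 + x.2, x.1⟩) ?_ ?_ ?_ ?_ ?_
    · rintro ⟨t, s⟩ hx; simp at hx ⊢; omega
    · rintro ⟨t, s⟩ hx; simp at hx ⊢; omega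
    · rintro ⟨t, s⟩ hx; simp at hx ⊢; omega
    · rintro ⟨t, s⟩ hx; simp at hx ⊢
    · rintro ⟨t, s⟩ hx; rfl
  rw [this, Finset.sum_mul, ← Finset.range_eq_Ico]
  refine Finset.sum_le_sum fun s _ => ?_
  rw [← Finset.mul_sum]
  exact mul_le_mul_of_nonneg_left (hB _) (ha s)

lemma card_pos' (y : V) : (0:ℝ) < Fintype.card V := by
  have : Nonempty V := ⟨y⟩
  exact_mod_cast Fintype.card_pos

lemma sum_FF_le (h : SpecKer M μ e) (y : V) (w : V) (L : ℕ) :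
    ∑ t ∈ Finset.range L, FF M y t w ≤ (Fintype.card V : ℝ) * (2 * Am V μ 1) := by
  have hN := card_pos' y
  have h1 : ∀ t, (Fintype.card V : ℝ)⁻¹ * FF M y t w
      ≤ ∑ s ∈ Finset.range (t + 1), ff M y s w * at' V μ (t - s) + at' V μ t := by
    intro t
    have := h.q_eq y t w
    have h2 := h.abs_op_le (fun u => u ^ t) (fun i => by simpa using h.gpos t 0 i) w y
    have h3 := neg_le_of_abs_le h2
    unfold at' at *
    linarith
  have h2 := Finset.sum_le_sum (s := Finset.range L) fun t _ => h1 t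
  rw [← Finset.mul_sum, Finset.sum_add_distrib] at h2
  have h3 := sum_conv_le _ _ (fun t => h.ff_nonneg y t w) h.at_nonneg _ h.sum_at_le L
  have h4 := h.sum_at_le L
  have h5 := h.sum_ff_le y L w
  have h6 := mul_le_mul_of_nonneg_right h5 (h.Am_nonneg 1)
  have h7 : (Fintype.card V : ℝ)⁻¹ * ∑ t ∈ Finset.range L, FF M y t w ≤ 2 * Am V μ 1 := by
    linarith
  rwa [inv_mul_le_iff₀ hN] at h7

lemma FF_summable (h : SpecKer M μ e) (y : V) (w : V) : Summable fun t => FF M y t w :=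
  summable_of_sum_range_le (fun t => h.FF_nonneg y t w) (h.sum_FF_le y w)

lemma FF_tendsto (h : SpecKer M μ e) (y : V) (w : V) :
    Tendsto (fun t => FF M y t w) atTop (nhds 0) := (h.FF_summable y w).tendsto_atTop_zero

lemma ff_summable (h : SpecKer M μ e) (y : V) (w : V) : Summable fun t => ff M y t w :=
  summable_of_sum_range_le (fun t => h.ff_nonneg y t w) (fun L => h.sum_ff_le y L w)

end SpecKer

/-- difference of hitting -/
def dd {V : Type*} [Fintype V] (M : Matrix V V ℝ) (y : V) (r : ℕ) (a b : V) : ℝ :=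
  ff M y r a * FF M y r b - FF M y r a * ff M y r b

def DD {V : Type*} [Fintype V] (M : Matrix V V ℝ) (y : V) (a b : V) : ℝ :=
  ∑' r, dd M y r a b

def psi {V I : Type*} [Fintype V] [Fintype I] (M : Matrix V V ℝ) (μ : I → ℝ) (e : I → V → V → ℝ)
    (y : V) (t : ℕ) (b : V) : ℝ :=
  gt μ e t b y - ∑ s ∈ Finset.range (t + 1), ff M y s b * Gt V μ (t - s)

def TT {V I : Type*} [Fintype V] [Fintype I] (M : Matrix V V ℝ) (μ : I → ℝ) (e : I → V → V → ℝ)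
    (y : V) (m : ℕ) (a b : V) : ℝ :=
  ∑ t ∈ Finset.range (m + 1), ff M y t a * psi M μ e y t b

def EE {V I : Type*} [Fintype V] [Fintype I] (M : Matrix V V ℝ) (μ : I → ℝ) (e : I → V → V → ℝ)
    (y : V) (a b : V) : ℝ :=
  Am V μ 1 * DD M y a b - (gt μ e 0 a y - gt μ e 0 b y)

namespace SpecKer

variable {V I : Type*} [Fintype V] [Fintype I] {M : Matrix V V ℝ} {μ : I → ℝ}
    {e : I → V → V → ℝ}

lemma psi_sub (h : SpecKer M μ e) (y : V) (t : ℕ) (b : V) :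
    psi M μ e y t b - psi M μ e y (t + 1) b
      = Am V μ 1 * ff M y (t + 1) b - (Fintype.card V : ℝ)⁻¹ * FF M y t b := by
  unfold psi
  rw [Finset.sum_range_succ _ (t + 1)]
  have h1 := h.gt_sub t b y
  rw [h.q_eq] at h1
  have h2 : ∑ s ∈ Finset.range (t + 1), ff M y s b * Gt V μ (t - s)
      - ∑ s ∈ Finset.range (t + 1), ff M y s b * Gt V μ (t + 1 - s)
      = ∑ s ∈ Finset.range (t + 1), ff M y s b * at' V μ (t - s) := by
    rw [← Finset.sum_sub_distrib]
    refine Finset.sum_congr rfl fun s hs => ?_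
    have : s ≤ t := by simpa [Nat.lt_succ_iff] using hs
    rw [← h.Gt_sub (t - s), show t + 1 - s = t - s + 1 by omega]; ring
  rw [Nat.sub_self, Gt_zero]
  linarith

lemma TT_eq (h : SpecKer M μ e) (y : V) (m : ℕ) (a b : V) :
    TT M μ e y m a b - TT M μ e y m b a = gt μ e 0 b y - gt μ e 0 a y
      + Am V μ 1 * ∑ r ∈ Finset.range (m + 1), dd M y r a b
      - (FF M y m a * psi M μ e y m b - FF M y m b * psi M μ e y m a) := by
  induction m with
  | zero =>
    simp only [TT, dd, psi, Finset.range_one, Finset.sum_singleton, zero_add, Nat.sub_self, Gt_zero]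
    have h1 := ff_zero_add (M := M) y a
    have h2 := ff_zero_add (M := M) y b
    rw [← eq_sub_iff_add_eq] at h1 h2
    rw [h1, h2]
    ring
  | succ m ih =>
    have e1 : ∀ a b, TT M μ e y (m + 1) a b = TT M μ e y m a b
        + ff M y (m + 1) a * psi M μ e y (m + 1) b := by
      intro a b; unfold TT; rw [Finset.sum_range_succ]
    rw [e1, e1, Finset.sum_range_succ, dd]
    have h1 := h.psi_sub y m a
    have h2 := h.psi_sub y m b
    have h3 := h.ff_succ_eq y m a
    have h4 := h.ff_succ_eq y m b
    have h1' : psi M μ e y m a = psi M μ e y (m+1) a + (Am V μ 1 * ff M y (m + 1) a - (Fintype.card V : ℝ)⁻¹ * FF M y m a) := by linarith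
    have h2' : psi M μ e y m b = psi M μ e y (m+1) b + (Am V μ 1 * ff M y (m + 1) b - (Fintype.card V : ℝ)⁻¹ * FF M y m b) := by linarith
    rw [h1', h2'] at ih
    have h3' : FF M y (m+1) a = FF M y m a - ff M y (m+1) a := by linarith
    have h4' : FF M y (m+1) b = FF M y m b - ff M y (m+1) b := by linarith
    rw [h3', h4']
    linear_combination ih

lemma abs_psi_le (h : SpecKer M μ e) (y : V) (t : ℕ) (b : V) :
    |psi M μ e y t b| ≤ 2 * Am V μ 1 := by
  unfold psi
  have h1 := (h.abs_gt_le t b y).trans (h.Gt_le t)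
  have h2 : 0 ≤ ∑ s ∈ Finset.range (t + 1), ff M y s b * Gt V μ (t - s) :=
    Finset.sum_nonneg fun s _ => mul_nonneg (h.ff_nonneg _ _ _) (h.Gt_nonneg _)
  have h3 : ∑ s ∈ Finset.range (t + 1), ff M y s b * Gt V μ (t - s) ≤ Am V μ 1 := by
    calc _ ≤ ∑ s ∈ Finset.range (t + 1), ff M y s b * Am V μ 1 :=
          Finset.sum_le_sum fun s _ => mul_le_mul_of_nonneg_left (h.Gt_le _) (h.ff_nonneg _ _ _)
      _ ≤ 1 * Am V μ 1 := by
          rw [← Finset.sum_mul]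
          exact mul_le_mul_of_nonneg_right (h.sum_ff_le _ _ _) (h.Am_nonneg 1)
      _ = _ := one_mul _
  rw [abs_le] at *
  constructor <;> linarith

lemma sum_absdd (h : SpecKer M μ e) (y : V) (m : ℕ) (a b : V) :
    ∑ r ∈ Finset.range (m + 1), (ff M y r a * FF M y r b + FF M y r a * ff M y r b)
      ≤ 1 - FF M y m a * FF M y m b := by
  induction m with
  | zero =>
    simp only [zero_add, Finset.range_one, Finset.sum_singleton]
    have h1 := ff_zero_add (M := M) y a
    have h2 := ff_zero_add (M := M) y b
    have h3 := mul_nonneg (h.ff_nonneg y 0 a) (h.ff_nonneg y 0 b)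
    rw [← eq_sub_iff_add_eq] at h1 h2
    rw [h1, h2] at *
    nlinarith
  | succ m ih =>
    rw [Finset.sum_range_succ]
    have h3 := h.ff_succ_eq y m a
    have h4 := h.ff_succ_eq y m b
    have h3' : FF M y m a = FF M y (m+1) a + ff M y (m+1) a := by linarith
    have h4' : FF M y m b = FF M y (m+1) b + ff M y (m+1) b := by linarith
    rw [h3', h4'] at ih
    have h5 := mul_nonneg (h.ff_nonneg y (m+1) a) (h.ff_nonneg y (m+1) b)
    nlinarith

lemma abs_dd_le (h : SpecKer M μ e) (y : V) (r : ℕ) (a b : V) :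
    |dd M y r a b| ≤ ff M y r a * FF M y r b + FF M y r a * ff M y r b := by
  have h1 := mul_nonneg (h.ff_nonneg y r a) (h.FF_nonneg y r b)
  have h2 := mul_nonneg (h.FF_nonneg y r a) (h.ff_nonneg y r b)
  unfold dd
  rw [abs_le]; constructor <;> linarith

lemma sum_abs_dd_le (h : SpecKer M μ e) (y : V) (m : ℕ) (a b : V) :
    ∑ r ∈ Finset.range m, |dd M y r a b| ≤ 1 := by
  rcases m with _ | m
  · simp
  · refine (Finset.sum_le_sum fun r _ => h.abs_dd_le y r a b).trans ((h.sum_absdd y m a b).trans ?_)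
    linarith [mul_nonneg (h.FF_nonneg y m a) (h.FF_nonneg y m b)]

lemma summable_abs_dd (h : SpecKer M μ e) (y : V) (a b : V) : Summable fun r => |dd M y r a b| :=
  summable_of_sum_range_le (fun t => abs_nonneg _) (fun L => h.sum_abs_dd_le y L a b)

lemma summable_dd (h : SpecKer M μ e) (y : V) (a b : V) : Summable fun r => dd M y r a b :=
  (h.summable_abs_dd y a b).of_abs

lemma abs_DD_le (h : SpecKer M μ e) (y : V) (a b : V) : |DD M y a b| ≤ 1 := by
  have h1 := norm_tsum_le_tsum_norm (f := fun r => dd M y r a b) (h.summable_abs_dd y a b)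
  refine h1.trans ?_
  exact Real.tsum_le_of_sum_range_le (fun t => abs_nonneg _) (fun L => h.sum_abs_dd_le y L a b)

lemma DD_antisymm (y a b : V) : DD M y a b = - DD M y b a := by
  unfold DD
  rw [← tsum_neg]
  exact tsum_congr fun r => by unfold dd; ring

lemma EE_tendsto (h : SpecKer M μ e) (y a b : V) :
    Tendsto (fun m => TT M μ e y m a b - TT M μ e y m b a) atTop (nhds (EE M μ e y a b)) := by
  simp only [h.TT_eq]
  have h1 := ((h.summable_dd y a b).hasSum.tendsto_sum_nat.comp (tendsto_add_atTop_nat 1))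
  have hb : ∀ a b, Tendsto (fun m => FF M y m a * psi M μ e y m b) atTop (nhds 0) := by
    intro a b
    have := (h.FF_tendsto y a).mul_const (2 * Am V μ 1)
    rw [zero_mul] at this
    refine squeeze_zero_norm (fun m => ?_) this
    rw [norm_mul, Real.norm_of_nonneg (h.FF_nonneg _ _ _)]
    exact mul_le_mul_of_nonneg_left (h.abs_psi_le _ _ _) (h.FF_nonneg _ _ _)
  have h2 := ((h1.const_mul (Am V μ 1)).const_add (gt μ e 0 b y - gt μ e 0 a y)).sub
    ((hb a b).sub (hb b a))
  refine h2.congr' ?_ |>.trans ?_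
  · exact Filter.Eventually.of_forall fun m => rfl
  · rw [sub_zero, sub_zero]
    unfold EE DD
    apply le_of_eq; congr 1; ring

/-- weighted Jensen -/
lemma sq_sum_le {ι : Type*} (s : Finset ι) (w f : ι → ℝ) (hw : ∀ i ∈ s, 0 ≤ w i)
    (h1 : ∑ i ∈ s, w i ≤ 1) : (∑ i ∈ s, w i * f i) ^ 2 ≤ ∑ i ∈ s, w i * f i ^ 2 := by
  have h := Finset.sum_mul_sq_le_sq_mul_sq s (fun i => √(w i)) (fun i => √(w i) * f i)
  have e1 : ∑ i ∈ s, √(w i) * (√(w i) * f i) = ∑ i ∈ s, w i * f i :=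
    Finset.sum_congr rfl fun i hi => by rw [← mul_assoc, Real.mul_self_sqrt (hw i hi)]
  have e2 : ∑ i ∈ s, √(w i) ^ 2 = ∑ i ∈ s, w i :=
    Finset.sum_congr rfl fun i hi => by rw [Real.sq_sqrt (hw i hi)]
  have e3 : ∑ i ∈ s, (√(w i) * f i) ^ 2 = ∑ i ∈ s, w i * f i ^ 2 :=
    Finset.sum_congr rfl fun i hi => by rw [mul_pow, Real.sq_sqrt (hw i hi)]
  rw [e1, e2, e3] at h
  refine h.trans (mul_le_of_le_one_left (Finset.sum_nonneg fun i hi => ?_) h1)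
  exact mul_nonneg (hw i hi) (sq_nonneg _)

lemma sum_mom {ι : Type*} (s : Finset ι) (p : ι → ℝ → ℝ) :
    ∑ t ∈ s, mom V μ (p t) = mom V μ (fun u => ∑ t ∈ s, p t u) := by
  unfold mom
  rw [← Finset.mul_sum, Finset.sum_comm]

lemma geom_le (h : SpecKer M μ e) (i : I) (L : ℕ) :
    ∑ t ∈ Finset.range L, (μ i) ^ t ≤ (1 - μ i)⁻¹ := by
  rw [← tsum_geometric_of_lt_one (h.mu0 i) (h.mu1 i)]
  exact (summable_geometric_of_lt_one (h.mu0 i) (h.mu1 i)).sum_le_tsum _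
    fun t _ => by have := h.mu0 i; positivity

lemma sum_gt_sq (h : SpecKer M μ e) (y : V) (L : ℕ) :
    ∑ t ∈ Finset.range L, ∑ b, gt μ e t b y ^ 2 ≤ Am V μ 3 := by
  have : ∀ t, ∑ b, gt μ e t b y ^ 2 = mom V μ (fun u => (u ^ t * (1 - u)⁻¹) ^ 2) := by
    intro t
    rw [← h.sum_op_sq _ y]
    exact Finset.sum_congr rfl fun b _ => by rw [gt, h.op_symm]
  simp only [this]
  rw [sum_mom]
  refine mom_mono _ _ fun i => ?_
  have h0 := h.mu0 i
  have h1 := h.one_sub_pos i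
  calc _ ≤ ∑ t ∈ Finset.range L, (μ i) ^ t * ((1 - μ i)⁻¹) ^ 2 := by
        refine Finset.sum_le_sum fun t _ => ?_
        rw [mul_pow]
        refine mul_le_mul_of_nonneg_right ?_ (by positivity)
        rw [pow_two]
        refine mul_le_of_le_one_left (by positivity) (pow_le_one₀ h0 (h.mu1 i).le)
    _ = (∑ t ∈ Finset.range L, (μ i) ^ t) * ((1 - μ i)⁻¹) ^ 2 := by rw [Finset.sum_mul]
    _ ≤ (1 - μ i)⁻¹ * ((1 - μ i)⁻¹) ^ 2 :=
        mul_le_mul_of_nonneg_right (h.geom_le i L) (by positivity)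
    _ = _ := by ring

lemma sum_TT_sq (h : SpecKer M μ e) (y : V) (Φ : ℝ)
    (hΦ : ∀ L, ∑ r ∈ Finset.range L, Gt V μ r ^ 2 ≤ Φ) (m : ℕ) :
    ∑ a, ∑ b, TT M μ e y m a b ^ 2 ≤ 2 * (Am V μ 3 + Fintype.card V * Φ) := by
  have hΦ0 : 0 ≤ Φ := by simpa using hΦ 0
  have hY : ∑ a, ∑ b, (∑ t ∈ Finset.range (m + 1), ff M y t a * gt μ e t b y) ^ 2 ≤ Am V μ 3 := by
    calc _ ≤ ∑ a, ∑ b, ∑ t ∈ Finset.range (m + 1), ff M y t a * gt μ e t b y ^ 2 :=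
          Finset.sum_le_sum fun a _ => Finset.sum_le_sum fun b _ =>
            sq_sum_le _ _ _ (fun t _ => h.ff_nonneg y t a) (h.sum_ff_le y _ a)
      _ = ∑ t ∈ Finset.range (m + 1), (∑ a, ff M y t a) * ∑ b, gt μ e t b y ^ 2 := by
          simp only [Finset.sum_mul_sum]
          rw [Finset.sum_comm' (t' := Finset.univ) (s' := fun _ => Finset.univ) (by simp)]
          rw [Finset.sum_comm]
          rw [Finset.sum_comm (s := Finset.range (m+1))]
          refine Finset.sum_congr rfl fun a _ => ?_
          rw [Finset.sum_comm]
      _ ≤ ∑ t ∈ Finset.range (m + 1), ∑ b, gt μ e t b y ^ 2 :=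
          Finset.sum_le_sum fun t _ => mul_le_of_le_one_left
            (Finset.sum_nonneg fun _ _ => sq_nonneg _) (h.sum_ff_w y t)
      _ ≤ _ := h.sum_gt_sq y _
  have hW : ∑ a, ∑ b, (∑ t ∈ Finset.range (m + 1), ff M y t a *
      ∑ s ∈ Finset.range (t + 1), ff M y s b * Gt V μ (t - s)) ^ 2 ≤ Fintype.card V * Φ := by
    calc _ ≤ ∑ a, ∑ b, ∑ t ∈ Finset.range (m + 1), ff M y t a *
          (∑ s ∈ Finset.range (t + 1), ff M y s b * Gt V μ (t - s)) ^ 2 :=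
          Finset.sum_le_sum fun a _ => Finset.sum_le_sum fun b _ =>
            sq_sum_le _ _ _ (fun t _ => h.ff_nonneg y t a) (h.sum_ff_le y _ a)
      _ ≤ ∑ a, ∑ b, ∑ t ∈ Finset.range (m + 1), ff M y t a *
          (∑ s ∈ Finset.range (t + 1), ff M y s b * Gt V μ (t - s) ^ 2) :=
          Finset.sum_le_sum fun a _ => Finset.sum_le_sum fun b _ =>
            Finset.sum_le_sum fun t _ => mul_le_mul_of_nonneg_left
             (sq_sum_le _ _ _ (fun t _ => h.ff_nonneg y t b) (h.sum_ff_le y _ b)) (h.ff_nonneg _ _ _)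
      _ = ∑ b, ∑ t ∈ Finset.range (m + 1), (∑ a, ff M y t a) *
          (∑ s ∈ Finset.range (t + 1), ff M y s b * Gt V μ (t - s) ^ 2) := by
          rw [Finset.sum_comm]
          refine Finset.sum_congr rfl fun b _ => ?_
          rw [Finset.sum_comm]
          simp only [Finset.sum_mul]
      _ ≤ ∑ b, ∑ t ∈ Finset.range (m + 1),
          (∑ s ∈ Finset.range (t + 1), ff M y s b * Gt V μ (t - s) ^ 2) :=
          Finset.sum_le_sum fun b _ => Finset.sum_le_sum fun t _ => mul_le_of_le_one_left
            (Finset.sum_nonneg fun _ _ => mul_nonneg (h.ff_nonneg _ _ _) (sq_nonneg _)) (h.sum_ff_w y t)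
      _ ≤ ∑ b : V, Φ := by
          refine Finset.sum_le_sum fun b _ => ?_
          refine (sum_conv_le (fun s => ff M y s b) (fun r => Gt V μ r ^ 2)
            (fun t => h.ff_nonneg y t b) (fun _ => sq_nonneg _) Φ hΦ (m + 1)).trans ?_
          exact mul_le_of_le_one_left hΦ0 (h.sum_ff_le y _ b)
      _ = _ := by simp
  have hT : ∀ a b, TT M μ e y m a b ^ 2 ≤
      2 * (∑ t ∈ Finset.range (m + 1), ff M y t a * gt μ e t b y) ^ 2 +
      2 * (∑ t ∈ Finset.range (m + 1), ff M y t a *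
      ∑ s ∈ Finset.range (t + 1), ff M y s b * Gt V μ (t - s)) ^ 2 := by
    intro a b
    unfold TT psi
    simp only [mul_sub, Finset.sum_sub_distrib]
    nlinarith [sq_nonneg ((∑ t ∈ Finset.range (m + 1), ff M y t a * gt μ e t b y) +
      (∑ t ∈ Finset.range (m + 1), ff M y t a *
      ∑ s ∈ Finset.range (t + 1), ff M y s b * Gt V μ (t - s)))]
  calc _ ≤ _ := Finset.sum_le_sum fun a _ => Finset.sum_le_sum fun b _ => hT a b
    _ ≤ _ := by
      simp only [Finset.sum_add_distrib, ← Finset.mul_sum]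
      linarith

lemma sum_EE_sq (h : SpecKer M μ e) (y : V) (Φ : ℝ)
    (hΦ : ∀ L, ∑ r ∈ Finset.range L, Gt V μ r ^ 2 ≤ Φ) :
    ∑ a, ∑ b, EE M μ e y a b ^ 2 ≤ 8 * (Am V μ 3 + Fintype.card V * Φ) := by
  have h1 : Tendsto (fun m => ∑ a, ∑ b, (TT M μ e y m a b - TT M μ e y m b a) ^ 2) atTop
      (nhds (∑ a, ∑ b, EE M μ e y a b ^ 2)) :=
    tendsto_finsetSum _ fun a _ => tendsto_finsetSum _ fun b _ => (h.EE_tendsto y a b).pow 2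
  refine le_of_tendsto' h1 fun m => ?_
  have h2 := h.sum_TT_sq y Φ hΦ m
  have h3 : ∑ a, ∑ b, TT M μ e y m b a ^ 2 = ∑ a, ∑ b, TT M μ e y m a b ^ 2 := Finset.sum_comm
  calc _ ≤ ∑ a, ∑ b, (2 * TT M μ e y m a b ^ 2 + 2 * TT M μ e y m b a ^ 2) :=
        Finset.sum_le_sum fun a _ => Finset.sum_le_sum fun b _ => by
          nlinarith [sq_nonneg (TT M μ e y m a b + TT M μ e y m b a)]
    _ ≤ _ := by
      simp only [Finset.sum_add_distrib, ← Finset.mul_sum]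
      linarith

end SpecKer

/-- survival weights off `{x,y}` -/
def vv {V : Type*} [Fintype V] (M : Matrix V V ℝ) (x y : V) : ℕ → V → ℝ
  | 0 => fun _ => 1
  | t + 1 => fun w => ∑ z, M w z * (if z = x ∨ z = y then 0 else vv M x y t z)

def v0 {V : Type*} [Fintype V] (M : Matrix V V ℝ) (x y : V) (t : ℕ) (z : V) : ℝ :=
  if z = x ∨ z = y then 0 else vv M x y t z

def UU {V : Type*} [Fintype V] (M : Matrix V V ℝ) (x y : V) (t : ℕ) : ℝ := ∑ z, v0 M x y t z

def cc (β : ℕ → ℝ) (r : ℕ) : ℝ := ∑' s, β s * β (s + r)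

def pp (β : ℕ → ℝ) (u : ℝ) : ℝ := ∑' r, cc β r * u ^ r

/-- the J functional -/
def JJ {V : Type*} [Fintype V] (M : Matrix V V ℝ) (x y : V) : ℝ :=
  ((Fintype.card V : ℝ)⁻¹) ^ 2 * ∑' s, vv M x y s x * ∑ z, v0 M x y s z * DD M y x z

section generic
variable {β : ℕ → ℝ}

lemma summable_pair (h0 : ∀ s, 0 ≤ β s) (hs : Summable β) :
    Summable fun p : ℕ × ℕ => β p.1 * β (p.1 + p.2) := by
  have h1 : Summable fun p : ℕ × ℕ => β p.1 * β p.2 :=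
    hs.mul_of_nonneg hs h0 h0
  exact h1.comp_injective (i := fun p : ℕ × ℕ => (p.1, p.1 + p.2)) (by
    rintro ⟨a, b⟩ ⟨c, d⟩ h; simp at h ⊢; omega)

lemma cc_summable (h0 : ∀ s, 0 ≤ β s) (hs : Summable β) (r : ℕ) :
    Summable fun s => β s * β (s + r) :=
  (summable_pair h0 hs).comp_injective (i := fun s => (s, r)) (fun a b h => by simpa using h)

lemma cc_nonneg (h0 : ∀ s, 0 ≤ β s) (r : ℕ) : 0 ≤ cc β r :=
  tsum_nonneg fun s => mul_nonneg (h0 _) (h0 _)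

lemma conv_tsum (h0 : ∀ s, 0 ≤ β s) (hs : Summable β) (R : ℕ → ℝ) (C : ℝ) (hR : ∀ r, |R r| ≤ C) :
    ∑' s, β s * ∑ s' ∈ Finset.range (s + 1), β s' * R (s - s') = ∑' r, cc β r * R r := by
  have hF : Summable fun p : ℕ × ℕ => β p.1 * β (p.1 + p.2) * R p.2 := by
    refine Summable.of_norm_bounded ((summable_pair h0 hs).mul_right C) fun p => ?_
    rw [norm_mul, Real.norm_of_nonneg (mul_nonneg (h0 _) (h0 _))]
    exact mul_le_mul_of_nonneg_left (hR _) (mul_nonneg (h0 _) (h0 _))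
  have h1 : ∑' p : ℕ × ℕ, β p.1 * β (p.1 + p.2) * R p.2 = ∑' r, cc β r * R r := by
    rw [← (Equiv.prodComm ℕ ℕ).tsum_eq, Summable.tsum_prod]
    · refine tsum_congr fun r => ?_
      simp only [Equiv.prodComm_apply, Prod.swap]
      rw [tsum_mul_right]; rfl
    · exact (Equiv.prodComm ℕ ℕ).summable_iff.2 hF
  rw [← h1, ← Finset.HasAntidiagonal.sigmaAntidiagonalEquivProd.tsum_eq, Summable.tsum_sigma']
  · refine tsum_congr fun s => ?_
    rw [tsum_fintype]
    simp only [Finset.HasAntidiagonal.sigmaAntidiagonalEquivProd_apply]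
    rw [Finset.sum_coe_sort (Finset.HasAntidiagonal.antidiagonal s)
      (fun p : ℕ × ℕ => β p.1 * β (p.1 + p.2) * R p.2),
      Finset.Nat.sum_antidiagonal_eq_sum_range_succ_mk, Finset.mul_sum]
    refine Finset.sum_congr rfl fun k hk => ?_
    have : k ≤ s := by simpa [Nat.lt_succ_iff] using hk
    simp only
    rw [show k + (s - k) = s by omega]; ring
  · intro s; exact (hasSum_fintype _).summable
  · exact Finset.HasAntidiagonal.sigmaAntidiagonalEquivProd.summable_iff.2 hF

lemma cc_le (h0 : ∀ s, 0 ≤ β s) (hs : Summable β) (ha : Antitone β) (r : ℕ) :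
    cc β r ≤ cc β 0 := by
  refine Summable.tsum_le_tsum (fun s => ?_) (cc_summable h0 hs r) (cc_summable h0 hs 0)
  exact mul_le_mul_of_nonneg_left (ha (by omega)) (h0 _)

lemma cc_sub_le (h0 : ∀ s, 0 ≤ β s) (hs : Summable β) (ha : Antitone β) (h1 : ∀ s, β s ≤ 1) (r : ℕ) :
    cc β 0 - cc β r ≤ r := by
  unfold cc
  rw [← Summable.tsum_sub (cc_summable h0 hs 0) (cc_summable h0 hs r)]
  have hs' : Summable fun s => β (s + r) := (summable_nat_add_iff r).2 hs
  calc _ ≤ ∑' s, (β s - β (s + r)) := by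
        refine Summable.tsum_le_tsum (fun s => ?_)
          ((cc_summable h0 hs 0).sub (cc_summable h0 hs r)) (hs.sub hs')
        have : β (s + r) ≤ β s := ha (by omega)
        have h2 := h1 s
        have h3 := h0 s
        simp only [add_zero]
        nlinarith
    _ = ∑ s ∈ Finset.range r, β s := by
        rw [Summable.tsum_sub hs hs', ← hs.sum_add_tsum_nat_add r]; ring
    _ ≤ ∑ s ∈ Finset.range r, 1 := Finset.sum_le_sum fun s _ => h1 s
    _ = r := by simp

lemma cc_zero_le (h0 : ∀ s, 0 ≤ β s) (hs : Summable β) (h1 : ∀ s, β s ≤ 1) :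
    cc β 0 ≤ ∑' s, β s :=
  Summable.tsum_le_tsum (fun s => mul_le_of_le_one_right (h0 s) (h1 _)) (cc_summable h0 hs 0) hs

variable {u : ℝ}

lemma pp_summable (h0 : ∀ s, 0 ≤ β s) (hs : Summable β) (ha : Antitone β)
    (hu0 : 0 ≤ u) (hu1 : u < 1) : Summable fun r => cc β r * u ^ r := by
  refine Summable.of_nonneg_of_le (fun r => mul_nonneg (cc_nonneg h0 r) (by positivity))
    (fun r => mul_le_mul_of_nonneg_right (cc_le h0 hs ha r) (by positivity))
    ((summable_geometric_of_lt_one hu0 hu1).mul_left _)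

lemma pp_nonneg (h0 : ∀ s, 0 ≤ β s) (hu0 : 0 ≤ u) : 0 ≤ pp β u :=
  tsum_nonneg fun r => mul_nonneg (cc_nonneg h0 r) (by positivity)

lemma pp_le (h0 : ∀ s, 0 ≤ β s) (hs : Summable β) (ha : Antitone β)
    (hu0 : 0 ≤ u) (hu1 : u < 1) : pp β u ≤ cc β 0 * (1 - u)⁻¹ := by
  rw [← tsum_geometric_of_lt_one hu0 hu1, ← tsum_mul_left]
  exact Summable.tsum_le_tsum (fun r => mul_le_mul_of_nonneg_right (cc_le h0 hs ha r) (by positivity))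
    (pp_summable h0 hs ha hu0 hu1) ((summable_geometric_of_lt_one hu0 hu1).mul_left _)

lemma pp_ge (h0 : ∀ s, 0 ≤ β s) (hs : Summable β) (ha : Antitone β) (h1 : ∀ s, β s ≤ 1)
    (hu0 : 0 ≤ u) (hu1 : u < 1) : cc β 0 * (1 - u)⁻¹ - pp β u ≤ ((1 - u)⁻¹) ^ 2 := by
  have hg := (summable_geometric_of_lt_one hu0 hu1).mul_left (cc β 0)
  have hn : ‖u‖ < 1 := by rwa [Real.norm_of_nonneg hu0]
  have h2 := hasSum_coe_mul_geometric_of_norm_lt_one hn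
  have : cc β 0 * (1 - u)⁻¹ - pp β u ≤ u / (1 - u) ^ 2 := by
    rw [← tsum_geometric_of_lt_one hu0 hu1, ← tsum_mul_left, ← h2.tsum_eq, pp,
      ← Summable.tsum_sub hg (pp_summable h0 hs ha hu0 hu1)]
    refine Summable.tsum_le_tsum (fun r => ?_) (hg.sub (pp_summable h0 hs ha hu0 hu1)) h2.summable
    rw [← sub_mul]
    exact mul_le_mul_of_nonneg_right (cc_sub_le h0 hs ha h1 r) (by positivity)
  refine this.trans ?_
  rw [inv_pow, div_eq_mul_inv]
  exact mul_le_of_le_one_left (by positivity) hu1.le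

end generic

namespace SpecKer

variable {V I : Type*} [Fintype V] [Fintype I] {M : Matrix V V ℝ} {μ : I → ℝ}
    {e : I → V → V → ℝ}

lemma vv_nonneg (h : SpecKer M μ e) (x y : V) (t : ℕ) : ∀ w, 0 ≤ vv M x y t w := by
  induction t with
  | zero => intro w; simp [vv]
  | succ t ih =>
    intro w; simp only [vv]
    refine Finset.sum_nonneg fun z _ => mul_nonneg (h.nonneg _ _) ?_
    split_ifs
    · exact le_rfl
    · exact ih z

lemma vv_anti (h : SpecKer M μ e) (x y : V) (t : ℕ) : ∀ w, vv M x y (t + 1) w ≤ vv M x y t w := by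
  induction t with
  | zero =>
    intro w; simp only [vv]
    refine le_trans (Finset.sum_le_sum fun z _ => mul_le_of_le_one_right (h.nonneg _ _) ?_) (h.row w).le
    split_ifs <;> norm_num
  | succ t ih =>
    intro w; rw [vv, vv]
    refine Finset.sum_le_sum fun z _ => mul_le_mul_of_nonneg_left ?_ (h.nonneg _ _)
    split_ifs
    · exact le_rfl
    · exact ih z

lemma vv_antitone (h : SpecKer M μ e) (x y : V) (w : V) : Antitone fun t => vv M x y t w :=
  antitone_nat_of_succ_le fun t => h.vv_anti x y t w

lemma vv_le_one (h : SpecKer M μ e) (x y : V) (t : ℕ) (w : V) : vv M x y t w ≤ 1 := by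
  have := h.vv_antitone x y w (Nat.zero_le t)
  simpa [vv] using this

lemma v0_nonneg (h : SpecKer M μ e) (x y : V) (t : ℕ) (w : V) : 0 ≤ v0 M x y t w := by
  unfold v0; split_ifs
  · exact le_rfl
  · exact h.vv_nonneg x y t w

lemma v0_eq (x y : V) (hxy : x ≠ y) (t : ℕ) (u : V) :
    v0 M x y t u = vv M x y t u - vv M x y t x * (if x = u then 1 else 0)
      - vv M x y t y * (if y = u then 1 else 0) := by
  unfold v0
  by_cases h1 : u = x
  · subst h1; simp [hxy.symm]
  · by_cases h2 : u = y
    · subst h2; simp [hxy]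
    · simp [h1, h2, Ne.symm h1, Ne.symm h2]

lemma vv_id (h : SpecKer M μ e) (x y : V) (hxy : x ≠ y) (t : ℕ) : ∀ u,
    v0 M x y t u = 1 - ∑ s ∈ Finset.range (t + 1),
      (vv M x y s x * (M ^ (t - s)) x u + vv M x y s y * (M ^ (t - s)) y u) := by
  induction t with
  | zero =>
    intro u
    rw [v0_eq x y hxy]
    simp [vv, Matrix.one_apply]; ring
  | succ t ih =>
    intro u
    rw [v0_eq x y hxy, Finset.sum_range_succ]
    have h1 : vv M x y (t + 1) u = 1 - ∑ s ∈ Finset.range (t + 1),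
        (vv M x y s x * (M ^ (t + 1 - s)) x u + vv M x y s y * (M ^ (t + 1 - s)) y u) := by
      have : vv M x y (t + 1) u = ∑ z, M u z * v0 M x y t z := rfl
      rw [this]
      simp only [ih, mul_sub, mul_one, Finset.sum_sub_distrib, h.row]
      congr 1
      simp only [Finset.mul_sum]
      rw [Finset.sum_comm]
      refine Finset.sum_congr rfl fun s hs => ?_
      have : s ≤ t := by simpa [Nat.lt_succ_iff] using hs
      rw [show t + 1 - s = (t - s) + 1 by omega, _root_.pow_succ, Matrix.mul_apply, Matrix.mul_apply,
        Finset.mul_sum, Finset.mul_sum, ← Finset.sum_add_distrib]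
      refine Finset.sum_congr rfl fun z _ => ?_
      rw [h.symm u z]; ring
    rw [h1]
    simp [Matrix.one_apply]; ring

lemma vv_symm (h : SpecKer M μ e) (x y : V) (hxy : x ≠ y) (t : ℕ) :
    vv M x y t y = vv M x y t x := by
  induction t using Nat.strong_induction_on with
  | _ t ih =>
    have h1 := h.vv_id x y hxy t x
    have h2 := h.vv_id x y hxy t y
    simp only [v0, true_or, or_true, if_true] at h1 h2
    rw [Finset.sum_range_succ] at h1 h2
    simp [Matrix.one_apply, hxy, hxy.symm] at h1 h2
    have h3 : ∑ s ∈ Finset.range t,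
      (vv M x y s x * (M ^ (t - s)) x x + vv M x y s y * (M ^ (t - s)) y x)
      = ∑ s ∈ Finset.range t,
      (vv M x y s x * (M ^ (t - s)) x y + vv M x y s y * (M ^ (t - s)) y y) := by
      refine Finset.sum_congr rfl fun s hs => ?_
      rw [ih s (by simpa using hs), h.pow_symm _ y x]
      simp only [h.pow, h.op_diag]
      ring
    linarith

lemma UU_eq (h : SpecKer M μ e) (x y : V) (hxy : x ≠ y) (t : ℕ) :
    UU M x y t = Fintype.card V - 2 * ∑ s ∈ Finset.range (t + 1), vv M x y s x := by
  unfold UU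
  simp only [h.vv_id x y hxy, Finset.sum_sub_distrib]
  rw [Finset.sum_comm]
  simp only [Finset.sum_add_distrib, ← Finset.mul_sum, h.pow_row, mul_one, h.vv_symm x y hxy]
  simp; ring

lemma v0_eq2 (h : SpecKer M μ e) (x y : V) (hxy : x ≠ y) (t : ℕ) (u : V) :
    v0 M x y t u = UU M x y t * (Fintype.card V : ℝ)⁻¹ - ∑ s ∈ Finset.range (t + 1), vv M x y s x *
      (op μ e (fun u => u ^ (t - s)) x u + op μ e (fun u => u ^ (t - s)) y u) := by
  have hN := card_pos' x
  rw [h.UU_eq x y hxy, h.vv_id x y hxy]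
  simp only [h.vv_symm x y hxy, h.pow]
  have : ∑ s ∈ Finset.range (t + 1), (vv M x y s x * ((Fintype.card V : ℝ)⁻¹ + op μ e (fun u => u ^ (t - s)) x u)
      + vv M x y s x * ((Fintype.card V : ℝ)⁻¹ + op μ e (fun u => u ^ (t - s)) y u))
      = 2 * (∑ s ∈ Finset.range (t + 1), vv M x y s x) * (Fintype.card V : ℝ)⁻¹ +
       ∑ s ∈ Finset.range (t + 1), vv M x y s x *
      (op μ e (fun u => u ^ (t - s)) x u + op μ e (fun u => u ^ (t - s)) y u) := by
    rw [mul_assoc, Finset.sum_mul, Finset.mul_sum, ← Finset.sum_add_distrib]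
    exact Finset.sum_congr rfl fun s _ => by ring
  rw [this]
  field_simp
  ring

def kk {V I : Type*} [Fintype V] [Fintype I] (μ : I → ℝ) (e : I → V → V → ℝ) (x y : V) (r : ℕ) : ℝ :=
  at' V μ r + op μ e (fun u => u ^ r) x y

lemma UU_kk (h : SpecKer M μ e) (x y : V) (hxy : x ≠ y) (t : ℕ) :
    UU M x y t * (Fintype.card V : ℝ)⁻¹ =
      ∑ s ∈ Finset.range (t + 1), vv M x y s x * kk μ e x y (t - s) := by
  have h1 := h.v0_eq2 x y hxy t x
  simp only [v0, true_or, if_true] at h1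
  rw [eq_comm, sub_eq_zero] at h1
  rw [h1]
  exact Finset.sum_congr rfl fun s _ => by rw [kk, h.op_diag, h.op_symm _ y x, at']

lemma abs_q_le (h : SpecKer M μ e) (r : ℕ) (x y : V) : |op μ e (fun u => u ^ r) x y| ≤ at' V μ r :=
  h.abs_op_le _ (fun i => by simpa using h.gpos r 0 i) x y

lemma at_le (h : SpecKer M μ e) (r : ℕ) : at' V μ r ≤ Am V μ 1 := by
  have h1 := h.Gt_sub r
  linarith [h.Gt_nonneg (r+1), h.Gt_le r]

lemma kk_nonneg (h : SpecKer M μ e) (x y : V) (r : ℕ) : 0 ≤ kk μ e x y r := by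
  have := neg_le_of_abs_le (h.abs_q_le r x y)
  unfold kk; linarith

lemma kk_le (h : SpecKer M μ e) (x y : V) (r : ℕ) : kk μ e x y r ≤ 2 * at' V μ r := by
  have := le_of_abs_le (h.abs_q_le r x y)
  unfold kk; linarith

lemma UU_nonneg (h : SpecKer M μ e) (x y : V) (t : ℕ) : 0 ≤ UU M x y t :=
  Finset.sum_nonneg fun z _ => h.v0_nonneg x y t z

lemma bb_summable (h : SpecKer M μ e) (x y : V) (hxy : x ≠ y) : Summable fun s => vv M x y s x := by
  refine summable_of_sum_range_le (c := (Fintype.card V : ℝ)) (fun t => h.vv_nonneg x y t x) fun L => ?_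
  have h1 := h.UU_eq x y hxy L
  have h2 := h.UU_nonneg x y L
  rw [Finset.sum_range_succ] at h1
  have h3 : 0 ≤ ∑ s ∈ Finset.range L, vv M x y s x := Finset.sum_nonneg fun s _ => h.vv_nonneg x y s x
  have h4 := h.vv_nonneg x y L x
  linarith

lemma UU_tendsto (h : SpecKer M μ e) (x y : V) (hxy : x ≠ y) :
    Tendsto (fun t => UU M x y t) atTop (nhds 0) := by
  have hN := card_pos' x
  have : Summable fun t => UU M x y t * (Fintype.card V : ℝ)⁻¹ := by
    refine summable_of_sum_range_le (c := (∑' s, vv M x y s x) * (2 * Am V μ 1))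
      (fun t => mul_nonneg (h.UU_nonneg x y t) (by positivity)) fun L => ?_
    simp only [h.UU_kk x y hxy]
    refine (sum_conv_le _ _ (fun t => h.vv_nonneg x y t x) (h.kk_nonneg x y) (2 * Am V μ 1) ?_ L).trans ?_
    · intro L
      refine (Finset.sum_le_sum fun r _ => h.kk_le x y r).trans ?_
      rw [← Finset.mul_sum]
      linarith [h.sum_at_le L]
    · refine mul_le_mul_of_nonneg_right ?_ (by have := h.Am_nonneg 1; positivity)
      exact (h.bb_summable x y hxy).sum_le_tsum _ fun s _ => h.vv_nonneg x y s x
  have := this.tendsto_atTop_zero.mul_const (Fintype.card V : ℝ)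
  simpa [mul_assoc, inv_mul_cancel₀ hN.ne'] using this

lemma bb_tsum (h : SpecKer M μ e) (x y : V) (hxy : x ≠ y) :
    ∑' s, vv M x y s x = (Fintype.card V : ℝ) / 2 := by
  have h1 := (h.bb_summable x y hxy).hasSum.tendsto_sum_nat.comp (tendsto_add_atTop_nat 1)
  have h2 : Tendsto (fun t => ((Fintype.card V : ℝ) - UU M x y t) / 2) atTop
    (nhds (((Fintype.card V : ℝ) - 0) / 2)) := ((h.UU_tendsto x y hxy).const_sub _).div_const 2
  rw [sub_zero] at h2
  refine tendsto_nhds_unique h1 (h2.congr fun t => ?_)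
  rw [h.UU_eq x y hxy]; simp

lemma kappa_eq (h : SpecKer M μ e) (x y : V) (hxy : x ≠ y) :
    ∑' s, vv M x y s x * (UU M x y s * (Fintype.card V : ℝ)⁻¹) =
      (Fintype.card V : ℝ) / 4 - cc (fun s => vv M x y s x) 0 * (Fintype.card V : ℝ)⁻¹ := by
  have hN := card_pos' x
  set β := fun s => vv M x y s x with hβ
  have hs := h.bb_summable x y hxy
  have h0 : ∀ s, 0 ≤ β s := fun s => h.vv_nonneg x y s x
  have hcs := cc_summable h0 hs 0
  have hpart : ∀ L, ∑ s ∈ Finset.range (L + 1), β s * UU M x y s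
      = ((Fintype.card V : ℝ) ^ 2 - UU M x y L ^ 2) / 4 - ∑ s ∈ Finset.range (L + 1), β s * β (s + 0) := by
    intro L
    have hU := h.UU_eq x y hxy
    induction L with
    | zero =>
      have := hU 0
      simp at this ⊢
      rw [this, hβ]; ring
    | succ L ih =>
      rw [Finset.sum_range_succ, ih, Finset.sum_range_succ _ (L+1)]
      have e1 : UU M x y L = UU M x y (L + 1) + 2 * β (L + 1) := by
        rw [hU, hU, Finset.sum_range_succ _ (L+1)]; ring
      rw [e1, add_zero]; ring
  have h1 := hcs.hasSum.tendsto_sum_nat.comp (tendsto_add_atTop_nat 1)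
  have h2 := (((h.UU_tendsto x y hxy).pow 2).const_sub ((Fintype.card V : ℝ) ^ 2)).div_const 4
  have h3 := h2.sub h1
  have hsum : Summable fun s => β s * UU M x y s := by
    refine Summable.of_nonneg_of_le (fun s => mul_nonneg (h0 s) (h.UU_nonneg x y s))
      (fun s => mul_le_mul_of_nonneg_left (?_ : UU M x y s ≤ Fintype.card V) (h0 s)) (hs.mul_right _)
    rw [h.UU_eq x y hxy]
    have : 0 ≤ ∑ s ∈ Finset.range (s + 1), vv M x y s x := Finset.sum_nonneg fun s _ => h0 s
    linarith
  have h4 := hsum.hasSum.tendsto_sum_nat.comp (tendsto_add_atTop_nat 1)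
  have h5 := tendsto_nhds_unique h4 (h3.congr fun L => (hpart L).symm)
  have : ∀ s, vv M x y s x * (UU M x y s * (Fintype.card V : ℝ)⁻¹)
    = (β s * UU M x y s) * (Fintype.card V : ℝ)⁻¹ := fun s => by rw [hβ]; ring
  simp only [this]
  rw [tsum_mul_right, h5]
  unfold cc
  field_simp
  ring

lemma hasSum_op (h : SpecKer M μ e) (c : ℕ → ℝ) (p : ℝ → ℝ)
    (hp : ∀ i, HasSum (fun r => c r * μ i ^ r) (p (μ i))) (z w : V) :
    HasSum (fun r => c r * op μ e (fun u => u ^ r) z w) (op μ e p z w) := by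
  unfold op
  have : ∀ r, c r * ((Fintype.card V : ℝ)⁻¹ * ∑ i, μ i ^ r * e i z w)
    = (Fintype.card V : ℝ)⁻¹ * ∑ i, (c r * μ i ^ r) * e i z w := by
    intro r; rw [mul_left_comm, Finset.mul_sum]; congr 1
    exact Finset.sum_congr rfl fun i _ => by ring
  simp only [this]
  exact (hasSum_sum fun i _ => (hp i).mul_right _).mul_left _

lemma pp_hasSum (h : SpecKer M μ e) (x y : V) (hxy : x ≠ y) (i : I) :
    HasSum (fun r => cc (fun s => vv M x y s x) r * μ i ^ r) (pp (fun s => vv M x y s x) (μ i)) :=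
  (pp_summable (fun s => h.vv_nonneg x y s x) (h.bb_summable x y hxy) (h.vv_antitone x y x)
    (h.mu0 i) (h.mu1 i)).hasSum

lemma kappa_op (h : SpecKer M μ e) (x y : V) (hxy : x ≠ y) :
    mom V μ (pp (fun s => vv M x y s x)) + op μ e (pp (fun s => vv M x y s x)) x y =
      (Fintype.card V : ℝ) / 4 - cc (fun s => vv M x y s x) 0 * (Fintype.card V : ℝ)⁻¹ := by
  rw [← h.kappa_eq x y hxy]
  simp only [h.UU_kk x y hxy]
  rw [conv_tsum (fun s => h.vv_nonneg x y s x) (h.bb_summable x y hxy) _ (2 * Am V μ 1)]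
  · have h1 := h.hasSum_op _ _ (h.pp_hasSum x y hxy) x x
    have h2 := h.hasSum_op _ _ (h.pp_hasSum x y hxy) x y
    have h3 := (h1.add h2).tsum_eq
    rw [← h.op_diag _ x, ← h3]
    refine tsum_congr fun r => ?_
    rw [kk, at', ← h.op_diag _ x]; ring
  · intro r
    rw [abs_of_nonneg (h.kk_nonneg x y r)]
    exact (h.kk_le x y r).trans (by linarith [h.at_le r])

lemma JJ_eq (h : SpecKer M μ e) (x y : V) (hxy : x ≠ y) :
    (Fintype.card V : ℝ) ^ 2 * JJ M x y =
      ((Fintype.card V : ℝ) / 4 - cc (fun s => vv M x y s x) 0 * (Fintype.card V : ℝ)⁻¹)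
        * (∑ w, DD M y x w)
      - ∑ w, (op μ e (pp (fun s => vv M x y s x)) x w + op μ e (pp (fun s => vv M x y s x)) y w)
          * DD M y x w := by
  have hN := card_pos' x
  unfold JJ
  rw [← mul_assoc, ← mul_pow, mul_inv_cancel₀ hN.ne', one_pow, one_mul]
  set R : ℕ → ℝ := fun r => ∑ w, (kk μ e x y r - (op μ e (fun u => u ^ r) x w
    + op μ e (fun u => u ^ r) y w)) * DD M y x w with hR
  have h1 : ∀ s, ∑ z, v0 M x y s z * DD M y x z
      = ∑ s' ∈ Finset.range (s + 1), vv M x y s' x * R (s - s') := by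
    intro s
    simp only [h.v0_eq2 x y hxy, h.UU_kk x y hxy, ← Finset.sum_sub_distrib]
    simp only [hR, Finset.sum_mul, Finset.mul_sum]
    rw [Finset.sum_comm]
    exact Finset.sum_congr rfl fun s' _ => Finset.sum_congr rfl fun w _ => by ring
  simp only [h1]
  rw [conv_tsum (fun s => h.vv_nonneg x y s x) (h.bb_summable x y hxy) R
    (∑ w : V, (2 * Am V μ 1 + (Am V μ 1 + Am V μ 1)) * 1)]
  · rw [← h.kappa_op x y hxy, Finset.mul_sum, ← Finset.sum_sub_distrib]
    have hw : ∀ w, HasSum (fun r => cc (fun s => vv M x y s x) r *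
       ((kk μ e x y r - (op μ e (fun u => u ^ r) x w
        + op μ e (fun u => u ^ r) y w)) * DD M y x w))
       ((mom V μ (pp fun s => vv M x y s x) + op μ e (pp fun s => vv M x y s x) x y) * DD M y x w -
      (op μ e (pp fun s => vv M x y s x) x w + op μ e (pp fun s => vv M x y s x) y w) * DD M y x w) := by
      intro w
      have hop := h.hasSum_op _ _ (h.pp_hasSum x y hxy)
      have := (((hop x x).add (hop x y)).sub ((hop x w).add (hop y w))).mul_right (DD M y x w)
      rw [← h.op_diag _ x, ← sub_mul]
      refine this.congr_fun ?_
      intro r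
      rw [kk, at', ← h.op_diag _ x]; ring
    rw [← (hasSum_sum fun w _ => hw w).tsum_eq]
    exact tsum_congr fun r => by rw [hR, Finset.mul_sum]
  · intro r
    rw [hR]
    refine (Finset.abs_sum_le_sum_abs _ _).trans (Finset.sum_le_sum fun w _ => ?_)
    rw [abs_mul]
    refine mul_le_mul ?_ (h.abs_DD_le _ _ _) (abs_nonneg _) (by have := h.Am_nonneg 1; positivity)
    refine (abs_sub _ _).trans (add_le_add ?_ ((abs_add_le _ _).trans (add_le_add ?_ ?_)))
    · rw [abs_of_nonneg (h.kk_nonneg x y r)]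
      exact (h.kk_le x y r).trans (by linarith [h.at_le r])
    · exact (h.abs_q_le _ _ _).trans (h.at_le r)
    · exact (h.abs_q_le _ _ _).trans (h.at_le r)

end SpecKer

namespace SpecKer

variable {V I : Type*} [Fintype V] [Fintype I] {M : Matrix V V ℝ} {μ : I → ℝ}
    {e : I → V → V → ℝ}

lemma op_sub_smul (c : ℝ) (p q : ℝ → ℝ) (x y : V) :
    op μ e p x y - c * op μ e q x y = op μ e (fun u => p u - c * q u) x y := by
  unfold op
  rw [mul_left_comm, ← mul_sub, Finset.mul_sum, ← Finset.sum_sub_distrib]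
  congr 1
  exact Finset.sum_congr rfl fun i _ => by ring

lemma abs_op_le' (h : SpecKer M μ e) (p q : ℝ → ℝ) (hp : ∀ i, |p (μ i)| ≤ q (μ i)) (x y : V) :
    |op μ e p x y| ≤ mom V μ q := by
  unfold op mom
  rw [abs_mul, abs_of_nonneg (by positivity : (0:ℝ) ≤ (Fintype.card V : ℝ)⁻¹)]
  gcongr
  refine (Finset.abs_sum_le_sum_abs _ _).trans (Finset.sum_le_sum fun i _ => ?_)
  rw [abs_mul]
  exact (mul_le_of_le_one_right (abs_nonneg _) (h.e_le i x y)).trans (hp i)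

lemma cs_op (h : SpecKer M μ e) (p : ℝ → ℝ) (c : ℝ) (hc : 0 ≤ c)
    (hp : ∀ i, |p (μ i)| ≤ c * (1 - μ i)⁻¹) (x : V) (f : V → ℝ) :
    |∑ w, op μ e p x w * f w| ≤ c * √(Am V μ 2) * √(∑ w, f w ^ 2) := by
  have h1 := Finset.sum_mul_sq_le_sq_mul_sq Finset.univ (fun w => op μ e p x w) f
  rw [h.sum_op_sq] at h1
  have h2 : mom V μ (fun u => p u ^ 2) ≤ c ^ 2 * Am V μ 2 := by
    unfold Am mom
    rw [mul_left_comm (c ^ 2), Finset.mul_sum Finset.univ _ (c ^ 2)]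
    refine mul_le_mul_of_nonneg_left (Finset.sum_le_sum fun i _ => ?_) (by positivity)
    simp only
    rw [← mul_pow, ← sq_abs (p (μ i))]
    exact pow_le_pow_left₀ (abs_nonneg _) (hp i) 2
  have h3 : 0 ≤ ∑ w, f w ^ 2 := Finset.sum_nonneg fun _ _ => sq_nonneg _
  rw [← Real.sqrt_sq hc, ← Real.sqrt_mul (sq_nonneg c), ← Real.sqrt_mul' _ h3]
  apply Real.abs_le_sqrt
  exact h1.trans (mul_le_mul_of_nonneg_right h2 h3)

lemma pair_bound (h : SpecKer M μ e) (x y : V) (hxy : x ≠ y) :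
    |Am V μ 1 ^ 2 * ((Fintype.card V : ℝ) ^ 2 * JJ M x y)
      - (Fintype.card V : ℝ) / 4 * Am V μ 1 ^ 2 * (∑ w, DD M y x w)
      - (Fintype.card V : ℝ) / 4 * (Am V μ 2 + op μ e (fun u => ((1 - u)⁻¹) ^ 2) x y)|
    ≤ Am V μ 1 ^ 2 * (Fintype.card V : ℝ) / 2 + 2 * Am V μ 1 * Am V μ 3
      + 2 * Am V μ 2 * (1 / 2 + (Fintype.card V : ℝ) / 2 * |gt μ e 0 x y| + 2 * Am V μ 2)
      + Am V μ 1 * (Fintype.card V : ℝ) * √(Am V μ 2) * √(∑ w, EE M μ e y x w ^ 2) := by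
  have hN := card_pos' x
  set N : ℝ := (Fintype.card V : ℝ) with hNdef
  set β := fun s => vv M x y s x with hβ
  have h0 : ∀ s, 0 ≤ β s := fun s => h.vv_nonneg x y s x
  have hs : Summable β := h.bb_summable x y hxy
  have ha : Antitone β := h.vv_antitone x y x
  have h1 : ∀ s, β s ≤ 1 := fun s => h.vv_le_one x y s x
  set c0 := cc β 0 with hc0
  have hc0n : 0 ≤ c0 := cc_nonneg h0 0
  have hc0l : c0 ≤ N / 2 := by
    rw [← h.bb_tsum x y hxy]; exact cc_zero_le h0 hs h1
  have hA1 := h.Am_nonneg 1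
  have hA2 := h.Am_nonneg 2
  have hA3 := h.Am_nonneg 3
  set p := pp β with hp
  have hppos : ∀ i, 0 ≤ p (μ i) := fun i => pp_nonneg h0 (h.mu0 i)
  have hple : ∀ i, p (μ i) ≤ c0 * (1 - μ i)⁻¹ := fun i => pp_le h0 hs ha (h.mu0 i) (h.mu1 i)
  have hpge : ∀ i, c0 * (1 - μ i)⁻¹ - p (μ i) ≤ ((1 - μ i)⁻¹) ^ 2 :=
    fun i => pp_ge h0 hs ha h1 (h.mu0 i) (h.mu1 i)
  have hJ := h.JJ_eq x y hxy
  have hk := h.kappa_op x y hxy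
  rw [← hβ, ← hp, ← hc0, ← hNdef] at hJ hk
  set d := ∑ w, DD M y x w with hd
  set ps : ℝ → ℝ := fun u => p u * (u ^ 0 * (1 - u)⁻¹) with hps
  set B := Am V μ 2 + op μ e (fun u => ((1 - u)⁻¹) ^ 2) x y with hB
  set X := op μ e ps y y + op μ e ps x y with hX
  set Q := ∑ w, op μ e p x w * EE M μ e y x w + ∑ w, op μ e p y w * EE M μ e y x w with hQ
  have hmain : Am V μ 1 * ∑ w, (op μ e p x w + op μ e p y w) * DD M y x w = - X + Q := by
    have e1 : ∀ w, Am V μ 1 * ((op μ e p x w + op μ e p y w) * DD M y x w)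
      = gt μ e 0 x y * op μ e p x w + gt μ e 0 x y * op μ e p y w
       - (op μ e p x w * gt μ e 0 w y + op μ e p y w * gt μ e 0 w y)
       + (op μ e p x w * EE M μ e y x w + op μ e p y w * EE M μ e y x w) := by
      intro w; unfold EE; ring
    rw [Finset.mul_sum]
    simp only [e1, Finset.sum_add_distrib, Finset.sum_sub_distrib, ← Finset.mul_sum, h.sum0]
    have e2 : ∀ z, ∑ w, op μ e p z w * gt μ e 0 w y = op μ e ps z y := fun z => h.conv _ _ z y
    rw [e2, e2]; rw [hX]; ring
  -- spectral approximations
  have happ : ∀ i, |ps (μ i) - c0 * ((1 - μ i)⁻¹) ^ 2| ≤ ((1 - μ i)⁻¹) ^ 3 := by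
    intro i
    have hpos : 0 ≤ (1 - μ i)⁻¹ := inv_nonneg.2 (h.one_sub_pos i).le
    have : ps (μ i) - c0 * ((1 - μ i)⁻¹) ^ 2 = - ((c0 * (1 - μ i)⁻¹ - p (μ i)) * (1 - μ i)⁻¹) := by
      rw [hps]; simp only [_root_.pow_zero, one_mul]; ring
    rw [this, abs_neg, abs_mul, abs_of_nonneg (by linarith [hple i]), abs_of_nonneg hpos,
      _root_.pow_succ _ 2]
    exact mul_le_mul_of_nonneg_right (hpge i) hpos
  have hX2 : |X - c0 * B| ≤ 2 * Am V μ 3 := by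
    have e1 := h.abs_op_le' (fun u => ps u - c0 * ((1 - u)⁻¹) ^ 2) (fun u => ((1 - u)⁻¹) ^ 3) happ y y
    have e2 := h.abs_op_le' (fun u => ps u - c0 * ((1 - u)⁻¹) ^ 2) (fun u => ((1 - u)⁻¹) ^ 3) happ x y
    rw [← op_sub_smul] at e1 e2
    rw [h.op_diag (fun u => ((1 - u)⁻¹) ^ 2)] at e1
    have : X - c0 * B = (op μ e ps y y - c0 * Am V μ 2) +
      (op μ e ps x y - c0 * op μ e (fun u => ((1 - u)⁻¹) ^ 2) x y) := by rw [hX, hB]; ring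
    rw [this]
    refine (abs_add_le _ _).trans ?_
    change _ ≤ Am V μ 3 at e1
    change _ ≤ Am V μ 3 at e2
    unfold Am at *
    linarith
  have happ2 : ∀ i, |p (μ i) - c0 * ((μ i) ^ 0 * (1 - μ i)⁻¹)| ≤ ((1 - μ i)⁻¹) ^ 2 := by
    intro i
    rw [abs_sub_comm, _root_.pow_zero, one_mul, abs_of_nonneg (by linarith [hple i])]
    exact hpge i
  have hk2 : |c0 * Am V μ 1 - N / 4| ≤ 1 / 2 + N / 2 * |gt μ e 0 x y| + 2 * Am V μ 2 := by
    have e1 := h.abs_op_le' (fun u => p u - c0 * (u ^ 0 * (1 - u)⁻¹)) (fun u => ((1 - u)⁻¹) ^ 2) happ2 x x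
    have e2 := h.abs_op_le' (fun u => p u - c0 * (u ^ 0 * (1 - u)⁻¹)) (fun u => ((1 - u)⁻¹) ^ 2) happ2 x y
    rw [← op_sub_smul] at e1 e2
    rw [h.op_diag, h.op_diag] at e1
    change |mom V μ p - c0 * Gt V μ 0| ≤ Am V μ 2 at e1
    change |op μ e p x y - c0 * gt μ e 0 x y| ≤ Am V μ 2 at e2
    rw [Gt_zero] at e1
    have e3 : c0 * N⁻¹ ≤ 1 / 2 := by
      rw [← div_eq_mul_inv, div_le_iff₀ hN]; linarith
    have e4 : 0 ≤ c0 * N⁻¹ := by positivity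
    have e5 : |c0 * gt μ e 0 x y| ≤ N / 2 * |gt μ e 0 x y| := by
      rw [abs_mul, abs_of_nonneg hc0n]
      exact mul_le_mul_of_nonneg_right hc0l (abs_nonneg _)
    rw [abs_le] at *
    constructor <;> linarith [e1.1, e1.2, e2.1, e2.2, e5.1, e5.2]
  have hB2 : |B| ≤ 2 * Am V μ 2 := by
    have := h.abs_op_le' (fun u => ((1 - u)⁻¹) ^ 2) (fun u => ((1 - u)⁻¹) ^ 2) (fun i => le_of_eq (abs_of_nonneg (sq_nonneg _))) x y
    change _ ≤ Am V μ 2 at this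
    rw [hB]
    refine (abs_add_le _ _).trans ?_
    rw [abs_of_nonneg hA2]
    linarith
  have hQ2 : |Q| ≤ N * √(Am V μ 2) * √(∑ w, EE M μ e y x w ^ 2) := by
    have hpa : ∀ i, |p (μ i)| ≤ (N / 2) * (1 - μ i)⁻¹ := fun i => by
      rw [abs_of_nonneg (hppos i)]
      exact (hple i).trans (mul_le_mul_of_nonneg_right hc0l (inv_nonneg.2 (h.one_sub_pos i).le))
    have e1 := h.cs_op p (N / 2) (by positivity) hpa x (fun w => EE M μ e y x w)
    have e2 := h.cs_op p (N / 2) (by positivity) hpa y (fun w => EE M μ e y x w)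
    refine (abs_add_le _ _).trans ?_
    linarith
  have hd2 : |d| ≤ N := by
    refine (Finset.abs_sum_le_sum_abs _ _).trans ((Finset.sum_le_sum fun w _ => h.abs_DD_le y x w).trans ?_)
    simp [hNdef]
  have hfin : Am V μ 1 ^ 2 * (N ^ 2 * JJ M x y) - N / 4 * Am V μ 1 ^ 2 * d - N / 4 * B
     = - (Am V μ 1 ^ 2 * (c0 * N⁻¹ * d)) + Am V μ 1 * (X - c0 * B) + (c0 * Am V μ 1 - N / 4) * B
       - Am V μ 1 * Q := by
    rw [hJ]
    linear_combination (- Am V μ 1) * hmain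
  rw [hfin]
  have t1 : |Am V μ 1 ^ 2 * (c0 * N⁻¹ * d)| ≤ Am V μ 1 ^ 2 * N / 2 := by
    rw [abs_mul, abs_of_nonneg (sq_nonneg _), abs_mul, abs_of_nonneg (by positivity : 0 ≤ c0 * N⁻¹)]
    have e3 : c0 * N⁻¹ ≤ 1 / 2 := by
      rw [← div_eq_mul_inv, div_le_iff₀ hN]; linarith
    have := mul_le_mul e3 hd2 (abs_nonneg _) (by norm_num)
    have := mul_le_mul_of_nonneg_left this (sq_nonneg (Am V μ 1))
    linarith
  have t2 : |Am V μ 1 * (X - c0 * B)| ≤ 2 * Am V μ 1 * Am V μ 3 := by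
    rw [abs_mul, abs_of_nonneg hA1]
    have := mul_le_mul_of_nonneg_left hX2 hA1
    linarith
  have t3 : |(c0 * Am V μ 1 - N / 4) * B| ≤ 2 * Am V μ 2 * (1 / 2 + N / 2 * |gt μ e 0 x y| + 2 * Am V μ 2) := by
    rw [abs_mul, mul_comm (2 * Am V μ 2)]
    exact mul_le_mul hk2 hB2 (abs_nonneg _) (by positivity)
  have t4 : |Am V μ 1 * Q| ≤ Am V μ 1 * N * √(Am V μ 2) * √(∑ w, EE M μ e y x w ^ 2) := by
    rw [abs_mul, abs_of_nonneg hA1]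
    have := mul_le_mul_of_nonneg_left hQ2 hA1
    linarith
  rw [abs_le] at *
  constructor <;> linarith [t1.1, t1.2, t2.1, t2.2, t3.1, t3.2, t4.1, t4.2]

lemma sum_pair_bound (h : SpecKer M μ e) (y : V) (Φ : ℝ)
    (hΦ : ∀ L, ∑ r ∈ Finset.range L, Gt V μ r ^ 2 ≤ Φ) :
    |Am V μ 1 ^ 2 * ((Fintype.card V : ℝ) ^ 2 * ∑ x ∈ Finset.univ.erase y, JJ M x y)
      - (Fintype.card V : ℝ) / 4 * (((Fintype.card V : ℝ) - 2) * Am V μ 2)|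
    ≤ Am V μ 1 ^ 2 * (Fintype.card V : ℝ) ^ 2 + 2 * (Fintype.card V : ℝ) * Am V μ 1 * Am V μ 3
      + 2 * Am V μ 2 * ((Fintype.card V : ℝ) / 2 + (Fintype.card V : ℝ) / 2
          * √((Fintype.card V : ℝ) * Am V μ 2) + 2 * (Fintype.card V : ℝ) * Am V μ 2)
      + Am V μ 1 * (Fintype.card V : ℝ) * √(Am V μ 2) * √((Fintype.card V : ℝ) *
        (8 * (Am V μ 3 + Fintype.card V * Φ))) := by
  have hN := card_pos' y
  have hA1 := h.Am_nonneg 1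
  have hA2 := h.Am_nonneg 2
  have hA3 := h.Am_nonneg 3
  set N : ℝ := (Fintype.card V : ℝ) with hNdef
  set S := Finset.univ.erase y with hS
  have hcs : ∀ f : V → ℝ, (∀ w, 0 ≤ f w) → ∑ x ∈ S, f x ≤ √(N * ∑ x, f x ^ 2) := by
    intro f hf
    apply Real.le_sqrt_of_sq_le
    have h1 := Finset.sum_mul_sq_le_sq_mul_sq Finset.univ (fun _ : V => (1:ℝ)) f
    simp only [one_mul, one_pow, Finset.sum_const, Finset.card_univ, nsmul_eq_mul, mul_one] at h1
    refine le_trans (pow_le_pow_left₀ (Finset.sum_nonneg fun x _ => hf x) ?_ 2) h1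
    exact Finset.sum_le_sum_of_subset_of_nonneg (Finset.subset_univ _) fun x _ _ => hf x
  have hd : ∑ x, ∑ w, DD M y x w = 0 := by
    have : ∑ x, ∑ w, DD M y x w = - ∑ x, ∑ w, DD M y x w := by
      conv_lhs => rw [Finset.sum_comm]
      simp only [← Finset.sum_neg_distrib]
      exact Finset.sum_congr rfl fun x _ => Finset.sum_congr rfl fun w _ => DD_antisymm _ _ _
    linarith
  have hd2 : |∑ w, DD M y y w| ≤ N := by
    refine (Finset.abs_sum_le_sum_abs _ _).trans ((Finset.sum_le_sum fun w _ => h.abs_DD_le y y w).trans ?_)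
    simp [hNdef]
  have er : ∀ f : V → ℝ, ∑ x ∈ S, f x = ∑ x, f x - f y := fun f => by
    rw [hS, Finset.sum_erase_eq_sub (Finset.mem_univ y)]
  have hcard : (S.card : ℝ) = N - 1 := by
    have := er (fun _ => 1); simpa using this
  have hcardle : (S.card : ℝ) ≤ N := by linarith
  have hB : ∑ x ∈ S, (Am V μ 2 + op μ e (fun u => ((1 - u)⁻¹) ^ 2) x y) = (N - 2) * Am V μ 2 := by
    rw [er, Finset.sum_add_distrib, h.op_diag]
    have : ∑ x, op μ e (fun u => ((1 - u)⁻¹) ^ 2) x y = 0 := by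
      rw [← h.sum0 (fun u => ((1 - u)⁻¹) ^ 2) y]
      exact Finset.sum_congr rfl fun x _ => h.op_symm _ _ _
    rw [this]
    change _ - (Am V μ 2 + Am V μ 2) = _
    simp; ring
  have hg : ∑ x ∈ S, |gt μ e 0 x y| ≤ √(N * Am V μ 2) := by
    refine (hcs _ fun w => abs_nonneg _).trans (le_of_eq ?_)
    congr 2
    simp only [sq_abs]
    have := h.sum_op_sq (fun u => u ^ 0 * (1 - u)⁻¹) y
    rw [Am]
    simp only [_root_.pow_zero, one_mul] at this
    rw [← this]
    exact Finset.sum_congr rfl fun x _ => by rw [h.op_symm]; simp [gt]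
  have hE : ∑ x ∈ S, √(∑ w, EE M μ e y x w ^ 2) ≤ √(N * (8 * (Am V μ 3 + N * Φ))) := by
    refine (hcs _ fun w => Real.sqrt_nonneg _).trans (Real.sqrt_le_sqrt ?_)
    refine mul_le_mul_of_nonneg_left ?_ hN.le
    refine le_trans (le_of_eq ?_) (h.sum_EE_sq y Φ hΦ)
    exact Finset.sum_congr rfl fun x _ => Real.sq_sqrt (Finset.sum_nonneg fun _ _ => sq_nonneg _)
  have hsum := Finset.sum_le_sum (s := S) fun x hx => h.pair_bound x y (Finset.ne_of_mem_erase hx)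
  have habs := (Finset.abs_sum_le_sum_abs (fun x => Am V μ 1 ^ 2 * (N ^ 2 * JJ M x y)
      - N / 4 * Am V μ 1 ^ 2 * (∑ w, DD M y x w)
      - N / 4 * (Am V μ 2 + op μ e (fun u => ((1 - u)⁻¹) ^ 2) x y)) S).trans hsum
  simp only [Finset.sum_sub_distrib, Finset.sum_add_distrib, ← Finset.mul_sum, Finset.sum_const,
    nsmul_eq_mul] at habs
  rw [er (fun x => ∑ w, DD M y x w), hd] at habs
  simp only [Finset.sum_add_distrib, Finset.sum_const, nsmul_eq_mul] at hB
  rw [hB] at habs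
  have t1 : |N / 4 * Am V μ 1 ^ 2 * (∑ w, DD M y y w)| ≤ N / 4 * Am V μ 1 ^ 2 * N := by
    rw [abs_mul, abs_of_nonneg (by positivity)]
    exact mul_le_mul_of_nonneg_left hd2 (by positivity)
  have t2 : (S.card : ℝ) * (Am V μ 1 ^ 2 * N / 2) ≤ N * (Am V μ 1 ^ 2 * N / 2) :=
    mul_le_mul_of_nonneg_right hcardle (by positivity)
  have t3 : (S.card : ℝ) * (2 * Am V μ 1 * Am V μ 3) ≤ N * (2 * Am V μ 1 * Am V μ 3) :=
    mul_le_mul_of_nonneg_right hcardle (by positivity)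
  have t4 : (S.card : ℝ) * (1 / 2) + N / 2 * ∑ x ∈ S, |gt μ e 0 x y| + S.card * (2 * Am V μ 2)
     ≤ N / 2 + N / 2 * √(N * Am V μ 2) + 2 * N * Am V μ 2 := by
    have e1 := mul_le_mul_of_nonneg_left hg (by positivity : 0 ≤ N / 2)
    have e2 := mul_le_mul_of_nonneg_right hcardle (by positivity : 0 ≤ 2 * Am V μ 2)
    linarith
  have t4' := mul_le_mul_of_nonneg_left t4 (by positivity : 0 ≤ 2 * Am V μ 2)
  have t5 := mul_le_mul_of_nonneg_left hE (by positivity : 0 ≤ Am V μ 1 * N * √(Am V μ 2))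
  have t6 : 0 ≤ N ^ 2 * Am V μ 1 ^ 2 := by positivity
  rw [abs_le] at *
  obtain ⟨t1a, t1b⟩ := t1
  obtain ⟨ha, hb⟩ := habs
  ring_nf at t1a t1b t2 t3 t4' t5 t6 ha hb ⊢
  constructor <;> linarith

end SpecKer

def bq {V : Type*} [Fintype V] (M : Matrix V V ℝ) : ℕ → (ℕ → V → Prop) → V → ℝ
  | 0, Q, w => if Q 0 w then 1 else 0
  | m + 1, Q, w => if Q 0 w then ∑ z, M w z * bq M m (fun i => Q (i + 1)) z else 0

def pr {V : Type*} [Fintype V] (M : Matrix V V ℝ) (m : ℕ) (Q : ℕ → V → Prop) : ℝ :=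
  (Fintype.card V : ℝ)⁻¹ * ∑ w, bq M m Q w

def KM {V : Type*} [Fintype V] (G : SimpleGraph V) : Matrix V V ℝ := Matrix.of (K G)

section rect
variable {V : Type*} [Fintype V]

lemma sum_path (M : Matrix V V ℝ) (m : ℕ) : ∀ (Q : ℕ → V → Prop) (c : V → ℝ),
    ∑ v : Fin (m + 1) → V, (if ∀ i : Fin (m + 1), Q i (v i) then
      c (v 0) * ∏ i : Fin m, M (v i.castSucc) (v i.succ) else 0) = ∑ w, c w * bq M m Q w := by
  induction m with
  | zero =>
    intro Q c
    rw [← (Equiv.funUnique (Fin 1) V).symm.sum_comp]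
    refine Finset.sum_congr rfl fun w _ => ?_
    simp [bq]
  | succ m ih =>
    intro Q c
    rw [← (Fin.consEquiv (fun _ : Fin (m + 2) => V)).sum_comp, Fintype.sum_prod_type]
    refine Finset.sum_congr rfl fun w _ => ?_
    simp only [Fin.consEquiv, Equiv.coe_fn_mk, Fin.forall_fin_succ (n := m + 1), Fin.cons_zero, Fin.cons_succ]
    rw [bq]
    by_cases hQ : Q 0 w
    · simp only [hQ, if_true]
      rw [← ih (fun i => Q (i + 1)) (fun z => M w z), Finset.mul_sum]
      refine Finset.sum_congr rfl fun v _ => ?_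
      simp only [Fin.val_zero, hQ, true_and, Fin.val_succ]
      split_ifs
      · rw [Fin.prod_univ_succ]
        simp only [Fin.castSucc_zero, Fin.cons_zero, Fin.cons_succ, ← Fin.succ_castSucc]
      · simp
    · simp [hQ]

variable {Ω : Type*} [MeasurableSpace Ω] {G : SimpleGraph V} {P : Measure Ω}
    {X₁ X₂ : ℕ → Ω → V} {ξ : V → Ω → Bool}

lemma rect [IsProbabilityMeasure P] (h : IsPaintSetup G P X₁ X₂ ξ) (m : ℕ) (Q Q' : ℕ → V → Prop) :
    P.real {ω | (∀ i ≤ m, Q i (X₁ i ω)) ∧ ∀ i ≤ m, Q' i (X₂ i ω)} = pr (KM G) m Q * pr (KM G) m Q' := by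
  set Ψ : Ω → (Fin (m + 1) → V) × (Fin (m + 1) → V) × (V → Bool) :=
    fun ω => (fun i => X₁ i ω, fun i => X₂ i ω, fun x => ξ x ω) with hΨ
  set S : Finset ((Fin (m + 1) → V) × (Fin (m + 1) → V) × (V → Bool)) :=
    Finset.univ.filter fun p => (∀ i : Fin (m + 1), Q i (p.1 i)) ∧ ∀ i : Fin (m + 1), Q' i (p.2.1 i) with hS
  have hset : {ω | (∀ i ≤ m, Q i (X₁ i ω)) ∧ ∀ i ≤ m, Q' i (X₂ i ω)} = Ψ ⁻¹' S := by
    ext ω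
    simp only [hΨ, hS, Set.mem_ofPred_eq, Set.mem_preimage, Finset.coe_filter, Finset.mem_univ, true_and,
      Fin.forall_iff, Nat.lt_succ_iff]
  let ext : (Fin (m + 1) → V) → ℕ → V := fun v i => v ⟨min i m, by omega⟩
  have hpre : ∀ v w b, Ψ ⁻¹' {(v, w, b)} =
      {ω | ((∀ i ≤ m, X₁ i ω = ext v i) ∧ ∀ i ≤ m, X₂ i ω = ext w i) ∧ ∀ x, ξ x ω = b x} := by
    intro v w b
    have e : ∀ (X : ℕ → Ω → V) (v : Fin (m + 1) → V) ω, ((fun i : Fin (m + 1) => X i ω) = v)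
        ↔ ∀ i ≤ m, X i ω = ext v i := by
      intro X v ω
      rw [funext_iff]
      simp only [Fin.forall_iff, Nat.lt_succ_iff]
      refine forall_congr' fun i => forall_congr' fun hi => ?_
      simp [ext, hi]
    ext ω
    simp only [hΨ, Set.mem_preimage, Set.mem_singleton_iff, Prod.mk.injEq, Set.mem_ofPred_eq, e, and_assoc]
    rw [funext_iff]
  have hmeas : ∀ p, MeasurableSet (Ψ ⁻¹' {p}) := by
    rintro ⟨v, w, b⟩
    rw [hpre]
    have hb : ∀ x, MeasurableSet {ω | ξ x ω = b x} := by
      intro x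
      cases hbx : b x with
      | true => exact h.measξ x
      | false =>
        have : {ω | ξ x ω = false} = {ω | ξ x ω = true}ᶜ := by ext ω; simp
        rw [this]; exact (h.measξ x).compl
    have e : {ω | ((∀ i ≤ m, X₁ i ω = ext v i) ∧ ∀ i ≤ m, X₂ i ω = ext w i) ∧ ∀ x, ξ x ω = b x}
      = ((⋂ i, ⋂ (_ : i ≤ m), {ω | X₁ i ω = ext v i}) ∩ (⋂ i, ⋂ (_ : i ≤ m), {ω | X₂ i ω = ext w i}))
        ∩ ⋂ x, {ω | ξ x ω = b x} := by
      ext ω; simp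
    rw [e]
    refine ((MeasurableSet.iInter fun i => MeasurableSet.iInter fun _ => h.meas₁ i _).inter
      (MeasurableSet.iInter fun i => MeasurableSet.iInter fun _ => h.meas₂ i _)).inter
      (MeasurableSet.iInter hb)
  have hsum : P.real (Ψ ⁻¹' S) = ∑ p ∈ S, P.real (Ψ ⁻¹' {p}) := by
    unfold Measure.real
    rw [← sum_measure_preimage_singleton S fun p _ => hmeas p, ENNReal.toReal_sum]
    intro p _; exact measure_ne_top _ _
  have hwalk : ∀ v : Fin (m + 1) → V, walkP G (uinit V) m (ext v)
      = (Fintype.card V : ℝ)⁻¹ * ∏ i : Fin m, KM G (v i.castSucc) (v i.succ) := by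
    intro v
    unfold walkP
    rw [Finset.prod_range]
    congr 1
    refine Finset.prod_congr rfl fun i _ => ?_
    have h1 : min (i : ℕ) m = i := by have := i.2; omega
    have h2 : min ((i : ℕ) + 1) m = i + 1 := by have := i.2; omega
    have h3 : ext v i = v i.castSucc := by simp only [ext]; congr 1; ext; exact h1
    have h4 : ext v (i + 1) = v i.succ := by simp only [ext]; congr 1; ext; exact h2
    rw [h3, h4]; rfl
  rw [hset, hsum, hS, Finset.sum_filter, Fintype.sum_prod_type]
  have hz : ∀ Q : ℕ → V → Prop, pr (KM G) m Q = ∑ v : Fin (m + 1) → V, if ∀ i : Fin (m + 1), Q i (v i) then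
     (Fintype.card V : ℝ)⁻¹ * ∏ i : Fin m, KM G (v i.castSucc) (v i.succ) else 0 := by
    intro Q
    rw [sum_path (KM G) m Q (fun _ => (Fintype.card V : ℝ)⁻¹), pr, Finset.mul_sum]
  rw [hz, hz, Finset.sum_mul_sum]
  refine Finset.sum_congr rfl fun v _ => ?_
  rw [Fintype.sum_prod_type]
  refine Finset.sum_congr rfl fun w _ => ?_
  simp only [hpre]
  have hl : ∀ b : V → Bool, P.real {ω | ((∀ i ≤ m, X₁ i ω = ext v i) ∧ ∀ i ≤ m, X₂ i ω = ext w i) ∧ ∀ x, ξ x ω = b x}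
     = walkP G (uinit V) m (ext v) * walkP G (uinit V) m (ext w) * (1 / 2) ^ Fintype.card V := fun b => h.law m (ext v) (ext w) b
  simp only [hl, hwalk]
  by_cases h1 : ∀ i : Fin (m + 1), Q i (v i)
  · by_cases h2 : ∀ i : Fin (m + 1), Q' i (w i)
    · simp only [h1, h2, implies_true, and_self, if_true, Finset.sum_const, Finset.card_univ, nsmul_eq_mul]
      simp
      rw [mul_comm, mul_assoc, inv_mul_cancel₀ (by positivity), mul_one]
    · simp [h2]
  · simp [h1]

end rect

namespace SpecKer

variable {V I : Type*} [Fintype V] [Fintype I] {M : Matrix V V ℝ} {μ : I → ℝ}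
    {e : I → V → V → ℝ}

lemma bq_congr (m : ℕ) : ∀ (Q Q' : ℕ → V → Prop), (∀ i ≤ m, ∀ v, Q i v ↔ Q' i v) → ∀ w,
    bq M m Q w = bq M m Q' w := by
  induction m with
  | zero => intro Q Q' hQ w; simp only [bq, hQ 0 le_rfl w]
  | succ m ih =>
    intro Q Q' hQ w
    simp only [bq, hQ 0 (Nat.zero_le _) w]
    rw [funext (ih (fun i => Q (i+1)) (fun i => Q' (i+1)) fun i hi v => hQ (i+1) (by omega) v)]

lemma bq_ff (y : V) (r : ℕ) : ∀ w, bq M r (fun i v => if i < r then v ≠ y else v = y) w = ff M y r w := by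
  induction r with
  | zero => intro w; simp [bq, ff]
  | succ r ih =>
    intro w
    rw [bq, ff]
    simp only [Nat.zero_lt_succ, if_true, Nat.add_lt_add_iff_right, ih]
    by_cases hw : w = y <;> simp [hw]

lemma bq_FF (y : V) (r : ℕ) : ∀ w, bq M r (fun _ v => v ≠ y) w = FF M y r w := by
  induction r with
  | zero => intro w; simp [bq, FF]
  | succ r ih =>
    intro w
    rw [bq, FF]
    simp only [ih]
    by_cases hw : w = y <;> simp [hw]

lemma bq_phase (h : SpecKer M μ e) (x y : V) (χ : ℕ → V → Prop) (r s : ℕ) : ∀ k,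
    ∑ w, vv M x y k w * bq M (s + r) (fun i v => if i < s then v ≠ x ∧ v ≠ y else χ (i - s) v) w
      = ∑ z, vv M x y (k + s) z * bq M r χ z := by
  induction s with
  | zero => intro k; simp
  | succ s ih =>
    intro k
    rw [show k + (s + 1) = (k + 1) + s by ring, ← ih (k + 1)]
    rw [show s + 1 + r = (s + r) + 1 by ring]
    simp only [bq, Nat.zero_lt_succ, if_true, Nat.add_lt_add_iff_right, Nat.add_sub_add_right]
    simp only [vv, Finset.sum_mul]
    rw [Finset.sum_comm]
    refine Finset.sum_congr rfl fun z _ => ?_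
    by_cases hz : z = x ∨ z = y
    · have : ¬ (z ≠ x ∧ z ≠ y) := by tauto
      simp [hz, this]
    · have : z ≠ x ∧ z ≠ y := by tauto
      simp only [if_neg hz, if_pos this, Finset.mul_sum]
      exact Finset.sum_congr rfl fun w _ => by rw [h.symm w z]; ring

lemma pr_phase (h : SpecKer M μ e) (x y : V) (χ Q : ℕ → V → Prop) (r s : ℕ)
    (hQ : ∀ i ≤ s + r, ∀ v, Q i v ↔ if i < s then v ≠ x ∧ v ≠ y else χ (i - s) v) :
    pr M (s + r) Q = (Fintype.card V : ℝ)⁻¹ * ∑ z, vv M x y s z * bq M r χ z := by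
  have := h.bq_phase x y χ r s 0
  rw [zero_add] at this
  rw [← this, pr]
  simp only [vv, one_mul]
  congr 1
  exact Finset.sum_congr rfl fun w _ => bq_congr _ _ _ hQ w

end SpecKer

def qh {V : Type*} (x : V) (s i : ℕ) (v : V) : Prop := if i < s then v ≠ x else v = x
def qm {V : Type*} (x : V) (_ : ℕ) (v : V) : Prop := v ≠ x
def cmb {V : Type*} (s : ℕ) (A B : ℕ → V → Prop) (i : ℕ) (v : V) : Prop := (i ≤ s → A i v) ∧ B i v
def WW {V Ω : Type*} (X₁ X₂ : ℕ → Ω → V) (m : ℕ) (Q Q' : ℕ → V → Prop) : Set Ω :=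
  {ω | (∀ i ≤ m, Q i (X₁ i ω)) ∧ ∀ i ≤ m, Q' i (X₂ i ω)}
def ee {V Ω : Type*} (X₁ X₂ : ℕ → Ω → V) (x : V) (s : ℕ) (ω : Ω) : ℝ :=
  (WW X₁ X₂ s (qh x s) (qm x)).indicator 1 ω - (WW X₁ X₂ s (qm x) (qh x s)).indicator 1 ω

lemma WW_inter {V Ω : Type*} (X₁ X₂ : ℕ → Ω → V) (s s' : ℕ) (hs : s ≤ s') (A B A' B' : ℕ → V → Prop) :
    WW X₁ X₂ s A B ∩ WW X₁ X₂ s' A' B' = WW X₁ X₂ s' (cmb s A A') (cmb s B B') := by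
  ext ω
  simp only [WW, Set.mem_inter_iff, Set.mem_ofPred_eq, cmb]
  constructor
  · rintro ⟨⟨a, b⟩, c, d⟩
    exact ⟨fun i hi => ⟨fun h => a i h, c i hi⟩, fun i hi => ⟨fun h => b i h, d i hi⟩⟩
  · rintro ⟨a, b⟩
    exact ⟨⟨fun i hi => (a i (hi.trans hs)).1 hi, fun i hi => (b i (hi.trans hs)).1 hi⟩,
      fun i hi => (a i hi).2, fun i hi => (b i hi).2⟩

section prob
variable {V : Type*} [Fintype V] {Ω : Type*} [MeasurableSpace Ω] {G : SimpleGraph V} {P : Measure Ω}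
    {X₁ X₂ : ℕ → Ω → V} {ξ : V → Ω → Bool}

lemma WW_meas (h : IsPaintSetup G P X₁ X₂ ξ) (m : ℕ) (Q Q' : ℕ → V → Prop) :
    MeasurableSet (WW X₁ X₂ m Q Q') := by
  have key : ∀ (X : ℕ → Ω → V) (_ : ∀ t x, MeasurableSet {ω | X t ω = x}) (q : V → Prop) i,
      MeasurableSet {ω | q (X i ω)} := by
    intro X hX q i
    have : {ω | q (X i ω)} = ⋃ v ∈ {v | q v}, {ω | X i ω = v} := by
      ext ω; simp
    rw [this]
    exact MeasurableSet.biUnion (Set.to_countable _) fun v _ => hX i v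
  have : WW X₁ X₂ m Q Q' = (⋂ i, ⋂ (_ : i ≤ m), {ω | Q i (X₁ i ω)}) ∩
      (⋂ i, ⋂ (_ : i ≤ m), {ω | Q' i (X₂ i ω)}) := by
    ext ω; simp [WW]
  rw [this]
  exact (MeasurableSet.iInter fun i => MeasurableSet.iInter fun _ => key _ h.meas₁ _ _).inter
    (MeasurableSet.iInter fun i => MeasurableSet.iInter fun _ => key _ h.meas₂ _ _)

lemma ee_meas (h : IsPaintSetup G P X₁ X₂ ξ) (x : V) (s : ℕ) : Measurable (ee X₁ X₂ x s) :=
  (measurable_one.indicator (WW_meas h _ _ _)).sub (measurable_one.indicator (WW_meas h _ _ _))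

lemma int_ind_mul [IsProbabilityMeasure P] (A B : Set Ω) (hA : MeasurableSet A) (hB : MeasurableSet B) :
    Integrable (fun ω => A.indicator (1 : Ω → ℝ) ω * B.indicator 1 ω) P ∧
    ∫ ω, A.indicator (1 : Ω → ℝ) ω * B.indicator 1 ω ∂P = P.real (A ∩ B) := by
  have : (fun ω => A.indicator (1 : Ω → ℝ) ω * B.indicator 1 ω) = (A ∩ B).indicator 1 := by
    rw [Set.inter_indicator_one]; rfl
  rw [this]
  refine ⟨(integrable_const (1:ℝ)).indicator (hA.inter hB), ?_⟩
  rw [integral_indicator_one (hA.inter hB)]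

lemma int_ee [IsProbabilityMeasure P] (h : IsPaintSetup G P X₁ X₂ ξ) (x : V) (s : ℕ) :
    Integrable (ee X₁ X₂ x s) P ∧ ∫ ω, ee X₁ X₂ x s ω ∂P = 0 := by
  have i1 : ∀ Q Q' : ℕ → V → Prop, Integrable ((WW X₁ X₂ s Q Q').indicator (1 : Ω → ℝ)) P :=
    fun Q Q' => (integrable_const (1:ℝ)).indicator (WW_meas h _ _ _)
  have e : ee X₁ X₂ x s = fun ω => (WW X₁ X₂ s (qh x s) (qm x)).indicator 1 ω -
    (WW X₁ X₂ s (qm x) (qh x s)).indicator 1 ω := rfl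
  rw [e]
  refine ⟨(i1 _ _).sub (i1 _ _), ?_⟩
  rw [integral_sub (i1 _ _) (i1 _ _), integral_indicator_one (WW_meas h _ _ _),
    integral_indicator_one (WW_meas h _ _ _), WW, WW, rect h, rect h]
  ring

lemma integral_sub4 {f1 f2 f3 f4 : Ω → ℝ} (h1 : Integrable f1 P) (h2 : Integrable f2 P)
    (h3 : Integrable f3 P) (h4 : Integrable f4 P) :
    ∫ ω, (f1 ω - f2 ω - (f3 ω - f4 ω)) ∂P = ∫ ω, f1 ω ∂P - ∫ ω, f2 ω ∂P - (∫ ω, f3 ω ∂P - ∫ ω, f4 ω ∂P) := by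
  rw [← integral_sub h1 h2, ← integral_sub h3 h4]
  exact integral_sub (h1.sub h2) (h3.sub h4)

lemma int_ee_mul [IsProbabilityMeasure P] (h : IsPaintSetup G P X₁ X₂ ξ) (x y : V) (s r : ℕ) :
    Integrable (fun ω => ee X₁ X₂ x s ω * ee X₁ X₂ y (s + r) ω) P ∧
    ∫ ω, ee X₁ X₂ x s ω * ee X₁ X₂ y (s + r) ω ∂P =
    2 * (pr (KM G) (s + r) (cmb s (qh x s) (qh y (s + r))) * pr (KM G) (s + r) (cmb s (qm x) (qm y))
      - pr (KM G) (s + r) (cmb s (qh x s) (qm y)) * pr (KM G) (s + r) (cmb s (qm x) (qh y (s + r)))) := by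
  have hm := fun m (Q Q' : ℕ → V → Prop) => WW_meas h m Q Q'
  have hi := fun A B A' B' => int_ind_mul (P := P) (WW X₁ X₂ s A B) (WW X₁ X₂ (s + r) A' B') (hm _ _ _) (hm _ _ _)
  have he : (fun ω => ee X₁ X₂ x s ω * ee X₁ X₂ y (s + r) ω) = fun ω =>
     ((WW X₁ X₂ s (qh x s) (qm x)).indicator 1 ω * (WW X₁ X₂ (s+r) (qh y (s+r)) (qm y)).indicator 1 ω
     - (WW X₁ X₂ s (qh x s) (qm x)).indicator 1 ω * (WW X₁ X₂ (s+r) (qm y) (qh y (s+r))).indicator 1 ω)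
     - ((WW X₁ X₂ s (qm x) (qh x s)).indicator 1 ω * (WW X₁ X₂ (s+r) (qh y (s+r)) (qm y)).indicator 1 ω
     - (WW X₁ X₂ s (qm x) (qh x s)).indicator 1 ω * (WW X₁ X₂ (s+r) (qm y) (qh y (s+r))).indicator 1 ω) := by
    funext ω; simp only [ee]; ring
  rw [he]
  refine ⟨((hi _ _ _ _).1.sub (hi _ _ _ _).1).sub ((hi _ _ _ _).1.sub (hi _ _ _ _).1), ?_⟩
  rw [integral_sub4 (hi _ _ _ _).1 (hi _ _ _ _).1 (hi _ _ _ _).1 (hi _ _ _ _).1]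
  simp only [(hi _ _ _ _).2, WW_inter X₁ X₂ s (s + r) (Nat.le_add_right s r)]
  simp only [WW, rect h]
  ring

end prob

namespace SpecKer

variable {V I : Type*} [Fintype V] [Fintype I] {M : Matrix V V ℝ} {μ : I → ℝ}
    {e : I → V → V → ℝ}

lemma bq_first (M : Matrix V V ℝ) (m : ℕ) (a : V → Prop) (Q : ℕ → V → Prop) (w : V) :
    bq M m (fun i v => (i = 0 → a v) ∧ Q i v) w = if a w then bq M m Q w else 0 := by
  cases m with
  | zero => by_cases h : a w <;> simp [bq, h]
  | succ m => by_cases h : a w <;> simp [bq, h]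

lemma pr_cmb (h : SpecKer M μ e) (x y : V) (s r : ℕ) (A B C : ℕ → V → Prop) (a : V → Prop)
    (hA : ∀ i < s, ∀ v, A i v ↔ v ≠ x) (ha : ∀ v, A s v ↔ a v)
    (hB : ∀ i < s, ∀ v, B i v ↔ v ≠ y) (hC : ∀ i v, B (s + i) v ↔ C i v) :
    pr M (s + r) (cmb s A B) = (Fintype.card V : ℝ)⁻¹ *
      ∑ z, vv M x y s z * (if a z then bq M r C z else 0) := by
  rw [h.pr_phase x y (fun i v => (i = 0 → a v) ∧ C i v) _ r s]
  · simp only [bq_first]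
  · intro i _ v
    by_cases his : i < s
    · simp [cmb, his, hA i his v, hB i his v, his.le]
    · obtain ⟨j, rfl⟩ := Nat.exists_eq_add_of_le (not_lt.1 his)
      simp only [cmb, his, if_false, Nat.add_sub_cancel_left, hC]
      constructor
      · rintro ⟨h1, h2⟩
        refine ⟨?_, h2⟩
        rintro rfl
        exact (ha v).1 (h1 le_rfl)
      · rintro ⟨h1, h2⟩
        refine ⟨fun hj => ?_, h2⟩
        have : j = 0 := by omega
        subst this
        exact (ha v).2 (h1 rfl)

lemma pair_formula (h : SpecKer M μ e) (x y : V) (s r : ℕ) :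
    2 * (pr M (s + r) (cmb s (qh x s) (qh y (s + r))) * pr M (s + r) (cmb s (qm x) (qm y))
      - pr M (s + r) (cmb s (qh x s) (qm y)) * pr M (s + r) (cmb s (qm x) (qh y (s + r))))
    = 2 * ((Fintype.card V : ℝ)⁻¹) ^ 2 * (vv M x y s x *
        ∑ z, if z ≠ x then vv M x y s z * dd M y r x z else 0) := by
  have hh1 : ∀ i < s, ∀ v, qh x s i v ↔ v ≠ x := fun i hi v => by simp [qh, hi]
  have hh2 : ∀ v, qh x s s v ↔ v = x := fun v => by simp [qh]
  have hm1 : ∀ i < s, ∀ v, qm x i v ↔ v ≠ x := fun i hi v => by simp [qm]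
  have hm2 : ∀ v, qm x s v ↔ v ≠ x := fun v => by simp [qm]
  have kh1 : ∀ i < s, ∀ v, qh y (s + r) i v ↔ v ≠ y := fun i hi v => by
    have : i < s + r := by omega
    simp [qh, this]
  have kh2 : ∀ i v, qh y (s + r) (s + i) v ↔ (if i < r then v ≠ y else v = y) := fun i v => by
    simp [qh]
  have km1 : ∀ i < s, ∀ v, qm y i v ↔ v ≠ y := fun i hi v => by simp [qm]
  have km2 : ∀ i v, qm y (s + i) v ↔ v ≠ y := fun i v => by simp [qm]
  rw [h.pr_cmb x y s r _ _ _ _ hh1 hh2 kh1 kh2, h.pr_cmb x y s r _ _ _ _ hm1 hm2 km1 km2,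
    h.pr_cmb x y s r _ _ _ _ hh1 hh2 km1 km2, h.pr_cmb x y s r _ _ _ _ hm1 hm2 kh1 kh2]
  simp only [bq_ff, bq_FF, mul_ite, mul_zero, Finset.sum_ite_eq', Finset.mem_univ, if_true]
  have : ∀ f : V → ℝ, ∑ z, (if z ≠ x then vv M x y s z * f z else 0) =
    ∑ z ∈ Finset.univ.filter (fun z => z ≠ x), vv M x y s z * f z := fun f => by rw [Finset.sum_filter]
  have s1 : ∀ f g : V → ℝ, ∀ c : ℝ,  c * ∑ z, (if z ≠ x then vv M x y s z * f z else 0) =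
     ∑ z, (if z ≠ x then vv M x y s z * (c * f z) else 0) := fun f g c => by
    rw [Finset.mul_sum]; refine Finset.sum_congr rfl fun z _ => ?_
    split_ifs <;> ring
  have s2 : ∑ z, (if z ≠ x then vv M x y s z * dd M y r x z else 0) =
      ff M y r x * ∑ z, (if z ≠ x then vv M x y s z * FF M y r z else 0)
      - FF M y r x * ∑ z, (if z ≠ x then vv M x y s z * ff M y r z else 0) := by
    rw [Finset.mul_sum, Finset.mul_sum, ← Finset.sum_sub_distrib]
    refine Finset.sum_congr rfl fun z _ => ?_
    split_ifs
    · simp only [dd]; ring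
    · ring
  rw [s2]
  ring

end SpecKer

lemma tri_sum (g : ℕ → ℕ → ℝ) (L : ℕ) :
    ∑ s ∈ Finset.range (L + 1), ∑ r ∈ Finset.range (L + 1 - s), g s (s + r)
     = ∑ s ∈ Finset.range L, ∑ r ∈ Finset.range (L - s), g s (s + r) + ∑ s ∈ Finset.range (L + 1), g s L := by
  rw [Finset.sum_range_succ, Finset.sum_range_succ (fun s => g s L), ← add_assoc, ← Finset.sum_add_distrib]
  congr 1
  · refine Finset.sum_congr rfl fun s hs => ?_
    have hs := Finset.mem_range.1 hs
    rw [show L + 1 - s = (L - s) + 1 by omega, Finset.sum_range_succ, show s + (L - s) = L by omega]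
  · simp

lemma sq_sum_split (f : ℕ → ℕ → ℝ) (L : ℕ) :
    ∑ s ∈ Finset.range L, ∑ t ∈ Finset.range L, f s t =
      ∑ s ∈ Finset.range L, ∑ r ∈ Finset.range (L - s), f s (s + r) +
      ∑ s ∈ Finset.range L, ∑ r ∈ Finset.range (L - s), f (s + r) s - ∑ s ∈ Finset.range L, f s s := by
  induction L with
  | zero => simp
  | succ L ih =>
    rw [tri_sum f, tri_sum (fun a b => f b a), Finset.sum_range_succ (fun s => f s s)]
    rw [Finset.sum_range_succ (fun s => ∑ t ∈ Finset.range (L + 1), f s t)]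
    simp only [Finset.sum_range_succ (fun t => f _ t)]
    rw [Finset.sum_add_distrib, ih]
    rw [Finset.sum_range_succ (fun s => f s L)]
    ring

namespace SpecKer

variable {V I : Type*} [Fintype V] [Fintype I] {M : Matrix V V ℝ} {μ : I → ℝ}
    {e : I → V → V → ℝ}

lemma vdd (h : SpecKer M μ e) (x y : V) (hxy : x ≠ y) (s r : ℕ) :
    (∑ z, if z ≠ x then vv M x y s z * dd M y r x z else 0)
      = ∑ z, v0 M x y s z * dd M y r x z - if r = 0 then vv M x y s x else 0 := by
  have h1 : (if r = 0 then vv M x y s x else 0) = ∑ z, if z = y then (if r = 0 then vv M x y s x else 0) else 0 := by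
    simp
  rw [h1, ← Finset.sum_sub_distrib]
  refine Finset.sum_congr rfl fun z _ => ?_
  by_cases hzx : z = x
  · subst hzx; simp [v0, hxy]
  by_cases hzy : z = y
  · subst hzy
    rcases r with _ | r
    · simp [v0, hzx, dd, ff, FF, hxy, h.vv_symm x z hxy]
    · simp [v0, hzx, dd, ff, FF]
  · simp [hzx, hzy, v0]

/-- truncated version of `JJ` -/
lemma JL_tendsto (h : SpecKer M μ e) (x y : V) (hxy : x ≠ y) :
    Tendsto (fun L => ((Fintype.card V : ℝ)⁻¹) ^ 2 * ∑ s ∈ Finset.range L, vv M x y s x *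
      ∑ r ∈ Finset.range (L - s), ∑ z, v0 M x y s z * dd M y r x z) atTop (nhds (JJ M x y)) := by
  refine Tendsto.const_mul _ ?_
  have hN := card_pos' y
  have e1 : ∀ L, ∑ s ∈ Finset.range L, vv M x y s x *
      ∑ r ∈ Finset.range (L - s), ∑ z, v0 M x y s z * dd M y r x z = ∑' s, vv M x y s x *
      ∑ r ∈ Finset.range (L - s), ∑ z, v0 M x y s z * dd M y r x z := by
    intro L
    rw [tsum_eq_sum]
    intro s hs
    have : L - s = 0 := by simp at hs; omega
    simp [this]
  simp only [e1]
  refine tendsto_tsum_of_dominated_convergence (bound := fun s => vv M x y s x * Fintype.card V)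
    ((h.bb_summable x y hxy).mul_right _) ?_ ?_
  · intro s
    refine Tendsto.const_mul _ ?_
    simp only [Finset.sum_comm (s := Finset.range _), ← Finset.mul_sum]
    refine tendsto_finsetSum _ fun z _ => Tendsto.const_mul _ ?_
    exact (h.summable_dd y x z).hasSum.tendsto_sum_nat.comp (tendsto_sub_atTop_nat s)
  · refine Eventually.of_forall fun L s => ?_
    rw [Real.norm_eq_abs, abs_mul, abs_of_nonneg (h.vv_nonneg x y s x)]
    refine mul_le_mul_of_nonneg_left ?_ (h.vv_nonneg x y s x)
    rw [Finset.sum_comm]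
    refine (Finset.abs_sum_le_sum_abs _ _).trans ?_
    have : ∀ z ∈ (Finset.univ : Finset V), |∑ r ∈ Finset.range (L - s), v0 M x y s z * dd M y r x z| ≤ 1 := by
      intro z _
      rw [← Finset.mul_sum, abs_mul, abs_of_nonneg (h.v0_nonneg x y s z)]
      have h1 : v0 M x y s z ≤ 1 := by
        unfold v0; split_ifs
        · norm_num
        · exact h.vv_le_one x y s z
      have h2 := (Finset.abs_sum_le_sum_abs (fun r => dd M y r x z) (Finset.range (L - s))).trans
        (h.sum_abs_dd_le y (L - s) x z)
      exact mul_le_one₀ h1 (abs_nonneg _) h2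
    refine (Finset.sum_le_sum this).trans ?_
    simp

end SpecKer

def sgL {V Ω : Type*} (X₁ X₂ : ℕ → Ω → V) (L : ℕ) (x : V) (ω : Ω) : ℝ :=
  ∑ s ∈ Finset.range L, ee X₁ X₂ x s ω

section prob
variable {V I : Type*} [Fintype V] [Fintype I] {Ω : Type*} [MeasurableSpace Ω] {G : SimpleGraph V} {P : Measure Ω}
    {X₁ X₂ : ℕ → Ω → V} {ξ : V → Ω → Bool} {μ : I → ℝ} {e : I → V → V → ℝ}

lemma int_sgL_mul_eq [IsProbabilityMeasure P] (h : IsPaintSetup G P X₁ X₂ ξ) (x y : V) (L : ℕ) :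
    ∫ ω, sgL X₁ X₂ L x ω * sgL X₁ X₂ L y ω ∂P =
     ∑ s ∈ Finset.range L, ∑ t ∈ Finset.range L, ∫ ω, ee X₁ X₂ x s ω * ee X₁ X₂ y t ω ∂P := by
  have hint : ∀ s t, Integrable (fun ω => ee X₁ X₂ x s ω * ee X₁ X₂ y t ω) P := by
    intro s t
    rcases le_total s t with hst | hst
    · obtain ⟨r, rfl⟩ := Nat.exists_eq_add_of_le hst
      exact (int_ee_mul h x y s r).1
    · obtain ⟨r, rfl⟩ := Nat.exists_eq_add_of_le hst
      simp only [mul_comm (ee X₁ X₂ x _ _)]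
      exact (int_ee_mul h y x t r).1
  simp only [sgL, Finset.sum_mul_sum]
  rw [integral_finsetSum _ fun s _ => integrable_finsetSum _ fun t _ => hint s t]
  exact Finset.sum_congr rfl fun s _ => integral_finsetSum _ fun t _ => hint s t

/-- off-diagonal covariance -/
lemma sgL_cov [IsProbabilityMeasure P] (hS : SpecKer (KM G) μ e) (h : IsPaintSetup G P X₁ X₂ ξ)
    (x y : V) (hxy : x ≠ y) : ∃ J : ℕ → ℝ,
    Tendsto J atTop (nhds (2 * (JJ (KM G) x y + JJ (KM G) y x))) ∧
    ∀ L, |∫ ω, sgL X₁ X₂ L x ω * sgL X₁ X₂ L y ω ∂P - J L| ≤ 3 * (Fintype.card V : ℝ)⁻¹ := by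
  set N : ℝ := (Fintype.card V : ℝ) with hNd
  have hN : 0 < N := SpecKer.card_pos' y
  set M := KM G with hM
  have hcov : ∀ x y s r, ∫ ω, ee X₁ X₂ x s ω * ee X₁ X₂ y (s + r) ω ∂P = 2 * (N⁻¹) ^ 2 * (vv M x y s x *
        ∑ z, if z ≠ x then vv M x y s z * dd M y r x z else 0) := fun x y s r => by
    rw [(int_ee_mul h x y s r).2]; exact hS.pair_formula x y s r
  have key : ∀ x y : V, x ≠ y → ∀ L, ∑ s ∈ Finset.range L, ∑ r ∈ Finset.range (L - s),
      ∫ ω, ee X₁ X₂ x s ω * ee X₁ X₂ y (s + r) ω ∂P =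
      2 * ((N⁻¹) ^ 2 * ∑ s ∈ Finset.range L, vv M x y s x *
      ∑ r ∈ Finset.range (L - s), ∑ z, v0 M x y s z * dd M y r x z)
      - 2 * (N⁻¹) ^ 2 * ∑ s ∈ Finset.range L, vv M x y s x ^ 2 := by
    intro x y hxy L
    rw [← mul_assoc, Finset.mul_sum, Finset.mul_sum, ← Finset.sum_sub_distrib]
    refine Finset.sum_congr rfl fun s hs => ?_
    have hs := Finset.mem_range.1 hs
    simp only [hcov, hS.vdd x y hxy]
    rw [← Finset.mul_sum, ← Finset.mul_sum, Finset.sum_sub_distrib, Finset.sum_ite_eq' (Finset.range (L - s)) 0,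
      if_pos (by simp; omega)]
    ring
  have key0 : ∀ s, ∫ ω, ee X₁ X₂ x s ω * ee X₁ X₂ y s ω ∂P = - (2 * (N⁻¹) ^ 2 * vv M x y s x ^ 2) := by
    intro s
    have h2 := hcov x y s 0
    rw [add_zero] at h2
    rw [h2, hS.vdd x y hxy]
    have : ∑ z, v0 M x y s z * dd M y 0 x z = 0 := by
      refine Finset.sum_eq_zero fun z _ => ?_
      by_cases hz : z = x ∨ z = y
      · simp [v0, hz]
      · have : z ≠ y := by tauto
        simp [dd, ff, FF, hxy, this]
    rw [this, if_pos rfl]; ring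
  have hsq : ∀ x y : V, x ≠ y → ∀ L, 0 ≤ (N⁻¹) ^ 2 * ∑ s ∈ Finset.range L, vv M x y s x ^ 2 ∧
      (N⁻¹) ^ 2 * ∑ s ∈ Finset.range L, vv M x y s x ^ 2 ≤ N⁻¹ / 2 := by
    intro x y hxy L
    refine ⟨by positivity, ?_⟩
    have h1 : ∑ s ∈ Finset.range L, vv M x y s x ^ 2 ≤ N / 2 := by
      rw [hNd, ← hS.bb_tsum x y hxy]
      refine le_trans (Finset.sum_le_sum fun s _ => ?_)
        ((hS.bb_summable x y hxy).sum_le_tsum (Finset.range L) fun s _ => hS.vv_nonneg x y s x)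
      have a := hS.vv_nonneg x y s x
      have b := hS.vv_le_one x y s x
      nlinarith
    calc (N⁻¹) ^ 2 * ∑ s ∈ Finset.range L, vv M x y s x ^ 2 ≤ (N⁻¹) ^ 2 * (N / 2) := by gcongr
      _ = N⁻¹ / 2 := by field_simp
  refine ⟨fun L => 2 * ((N⁻¹) ^ 2 * ∑ s ∈ Finset.range L, vv M x y s x *
      ∑ r ∈ Finset.range (L - s), ∑ z, v0 M x y s z * dd M y r x z +
      (N⁻¹) ^ 2 * ∑ s ∈ Finset.range L, vv M y x s y *
      ∑ r ∈ Finset.range (L - s), ∑ z, v0 M y x s z * dd M x r y z),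
      ((hS.JL_tendsto x y hxy).add (hS.JL_tendsto y x hxy.symm)).const_mul 2, fun L => ?_⟩
  rw [int_sgL_mul_eq h, sq_sum_split, key x y hxy]
  have k2 := key y x hxy.symm L
  simp only [mul_comm (ee X₁ X₂ y _ _)] at k2
  rw [k2]
  simp only [key0, Finset.sum_neg_distrib, ← Finset.mul_sum]
  obtain ⟨a1, a2⟩ := hsq x y hxy L
  obtain ⟨b1, b2⟩ := hsq y x hxy.symm L
  rw [abs_le]
  constructor <;> linarith

end prob

section path
variable {V : Type*} [Fintype V] {Ω : Type*}

lemma lt_hit (X : ℕ → Ω → V) (x : V) (ω : Ω) (s : ℕ) :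
    (s : ℕ∞) < hitTime X x ω ↔ ∀ i ≤ s, qm x i (X i ω) := by
  unfold qm hitTime
  constructor
  · intro h i hi hx
    have := lt_of_lt_of_le h (iInf₂_le i hx)
    exact absurd (Nat.cast_lt.1 this) (not_lt.2 hi)
  · intro h
    have : ((s + 1 : ℕ) : ℕ∞) ≤ ⨅ (s : ℕ) (_ : X s ω = x), (s : ℕ∞) := by
      refine le_iInf₂ fun i hi => ?_
      have : s + 1 ≤ i := by
        by_contra hc
        exact h i (by omega) hi
      exact_mod_cast this
    refine lt_of_lt_of_le ?_ this
    exact_mod_cast Nat.lt_succ_self s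

lemma eq_hit (X : ℕ → Ω → V) (x : V) (ω : Ω) (s : ℕ) :
    hitTime X x ω = s ↔ ∀ i ≤ s, qh x s i (X i ω) := by
  constructor
  · intro h i hi
    by_cases his : i < s
    · have : (i : ℕ∞) < hitTime X x ω := by rw [h]; exact_mod_cast his
      have := (lt_hit X x ω i).1 this i le_rfl
      simpa [qh, his, qm] using this
    · have : i = s := by omega
      subst this
      simp only [qh, lt_irrefl, if_false]
      by_contra hc
      have : (i : ℕ∞) < hitTime X x ω := by
        rw [lt_hit]
        intro j hj
        rcases hj.eq_or_lt with rfl | hj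
        · exact hc
        · have : (j : ℕ∞) < hitTime X x ω := by rw [h]; exact_mod_cast hj
          exact (lt_hit X x ω j).1 this j le_rfl
      rw [h] at this
      exact lt_irrefl _ this
  · intro h
    refine le_antisymm ?_ ?_
    · have := h s le_rfl
      simp [qh] at this
      exact iInf₂_le s this
    · refine le_iInf₂ fun i hi => ?_
      have : s ≤ i := by
        by_contra hc
        have h2 := h i (by omega)
        rw [qh, if_pos (by omega)] at h2
        exact h2 hi
      exact_mod_cast this

lemma ee_eq (X₁ X₂ : ℕ → Ω → V) (x : V) (s : ℕ) (ω : Ω) : ee X₁ X₂ x s ω =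
    (if hitTime X₁ x ω = s ∧ hitTime X₁ x ω < hitTime X₂ x ω then 1 else 0)
     - (if hitTime X₂ x ω = s ∧ hitTime X₂ x ω < hitTime X₁ x ω then 1 else 0) := by
  have a : ω ∈ WW X₁ X₂ s (qh x s) (qm x) ↔ hitTime X₁ x ω = s ∧ hitTime X₁ x ω < hitTime X₂ x ω := by
    simp only [WW, Set.mem_ofPred_eq, ← eq_hit, ← lt_hit]
    constructor
    · rintro ⟨h1, h2⟩; exact ⟨h1, h1 ▸ h2⟩
    · rintro ⟨h1, h2⟩; exact ⟨h1, h1 ▸ h2⟩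
  have b : ω ∈ WW X₁ X₂ s (qm x) (qh x s) ↔ hitTime X₂ x ω = s ∧ hitTime X₂ x ω < hitTime X₁ x ω := by
    simp only [WW, Set.mem_ofPred_eq, ← eq_hit, ← lt_hit]
    constructor
    · rintro ⟨h2, h1⟩; exact ⟨h1, h1 ▸ h2⟩
    · rintro ⟨h1, h2⟩; exact ⟨h1 ▸ h2, h1⟩
  simp only [ee, Set.indicator_apply, a, b, Pi.one_apply]

lemma sum_ite_enat (τ : ℕ∞) (p : Prop) (L : ℕ) :
    ∑ s ∈ Finset.range (L + 1), (if τ = (s : ℕ∞) ∧ p then (1:ℝ) else 0) = if τ ≤ L ∧ p then 1 else 0 := by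
  by_cases hp : p
  · simp only [hp, and_true]
    induction τ using ENat.recTopCoe with
    | top => simp
    | coe t =>
      simp only [Nat.cast_inj, Nat.cast_le]
      rw [Finset.sum_ite_eq]
      simp
  · simp [hp]

lemma sgL_eq (X₁ X₂ : ℕ → Ω → V) (x : V) (L : ℕ) (ω : Ω) : sgL X₁ X₂ (L + 1) x ω =
    (if hitTime X₁ x ω ≤ L ∧ hitTime X₁ x ω < hitTime X₂ x ω then 1 else 0)
     - (if hitTime X₂ x ω ≤ L ∧ hitTime X₂ x ω < hitTime X₁ x ω then 1 else 0) := by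
  simp only [sgL, ee_eq, Finset.sum_sub_distrib, sum_ite_enat]

/-- the sign of a vertex -/
def yy (X₁ X₂ : ℕ → Ω → V) (ξ : V → Ω → Bool) (x : V) (ω : Ω) : ℝ :=
  if hitTime X₁ x ω < hitTime X₂ x ω ∨ (hitTime X₁ x ω = hitTime X₂ x ω ∧ ξ x ω = true) then 1 else -1

def uu (X₁ X₂ : ℕ → Ω → V) (L : ℕ) (x : V) (ω : Ω) : ℝ :=
  ∑ s ∈ Finset.range (L + 1), (WW X₁ X₂ s (qh x s) (qh x s)).indicator 1 ω
    + (WW X₁ X₂ L (qm x) (qm x)).indicator 1 ω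

lemma uu_eq (X₁ X₂ : ℕ → Ω → V) (x : V) (L : ℕ) (ω : Ω) : uu X₁ X₂ L x ω =
    (if hitTime X₁ x ω ≤ L ∧ hitTime X₂ x ω = hitTime X₁ x ω then 1 else 0)
    + (if (L:ℕ∞) < hitTime X₁ x ω ∧ (L:ℕ∞) < hitTime X₂ x ω then 1 else 0) := by
  have a : ∀ s : ℕ, ω ∈ WW X₁ X₂ s (qh x s) (qh x s) ↔
      hitTime X₁ x ω = s ∧ hitTime X₂ x ω = hitTime X₁ x ω := by
    intro s
    simp only [WW, Set.mem_ofPred_eq, ← eq_hit]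
    constructor
    · rintro ⟨h1, h2⟩; exact ⟨h1, by rw [h1, h2]⟩
    · rintro ⟨h1, h2⟩; exact ⟨h1, by rw [h2, h1]⟩
  have b : ω ∈ WW X₁ X₂ L (qm x) (qm x) ↔ (L:ℕ∞) < hitTime X₁ x ω ∧ (L:ℕ∞) < hitTime X₂ x ω := by
    simp only [WW, Set.mem_ofPred_eq, ← lt_hit]
  simp only [uu, Set.indicator_apply, a, b, Pi.one_apply, sum_ite_enat]

lemma uu_nonneg (X₁ X₂ : ℕ → Ω → V) (x : V) (L : ℕ) (ω : Ω) : 0 ≤ uu X₁ X₂ L x ω := by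
  rw [uu_eq]; split_ifs <;> norm_num

lemma abs_yy (X₁ X₂ : ℕ → Ω → V) (ξ : V → Ω → Bool) (x : V) (ω : Ω) : |yy X₁ X₂ ξ x ω| ≤ 1 := by
  unfold yy; split_ifs <;> simp

lemma abs_sgL (X₁ X₂ : ℕ → Ω → V) (x : V) (L : ℕ) (ω : Ω) : |sgL X₁ X₂ (L + 1) x ω| ≤ 1 := by
  rw [sgL_eq]; split_ifs <;> simp

lemma yy_sub (X₁ X₂ : ℕ → Ω → V) (ξ : V → Ω → Bool) (x : V) (L : ℕ) (ω : Ω) :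
    |yy X₁ X₂ ξ x ω - sgL X₁ X₂ (L + 1) x ω| ≤ uu X₁ X₂ L x ω := by
  have hy := abs_yy X₁ X₂ ξ x ω
  have hu := uu_nonneg X₁ X₂ x L ω
  rw [sgL_eq]
  rw [uu_eq] at hu ⊢
  generalize ht1 : hitTime X₁ x ω = t1 at *
  generalize ht2 : hitTime X₂ x ω = t2 at *
  rcases lt_trichotomy t1 t2 with h | h | h
  · by_cases hL : t1 ≤ L
    · have h3 : ¬ t2 < t1 := not_lt.2 h.le
      have : yy X₁ X₂ ξ x ω = 1 := by simp [yy, ht1, ht2, h]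
      simp only [hL, h, h3, and_self, and_false, if_true, if_false, this] at hu ⊢
      simpa using hu
    · have h3 : ¬ t2 < t1 := not_lt.2 h.le
      have h4 : (L:ℕ∞) < t1 := not_le.1 hL
      have h5 := h4.trans h
      simp [h3, h4, h5, hL, h.ne', hy]
  · subst h
    by_cases hL : t1 ≤ L
    · simp [hL, not_lt.2 hL, hy]
    · have h4 : (L:ℕ∞) < t1 := not_le.1 hL
      simp [hL, h4, hy]
  · by_cases hL : t2 ≤ L
    · have h3 : ¬ t1 < t2 := not_lt.2 h.le
      have : yy X₁ X₂ ξ x ω = -1 := by simp [yy, ht1, ht2, h3, h.ne']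
      simp only [hL, h, h3, and_self, and_false, if_true, if_false, this] at hu ⊢
      simpa using hu
    · have h3 : ¬ t1 < t2 := not_lt.2 h.le
      have h4 : (L:ℕ∞) < t2 := not_le.1 hL
      have h5 := h4.trans h
      simp [h3, h4, h5, hL, h.ne, hy]

lemma painted_eq (X₁ X₂ : ℕ → Ω → V) (ξ : V → Ω → Bool) (ω : Ω) :
    (paintedCount X₁ X₂ ξ ω : ℝ) = 1 / 2 * ∑ x, yy X₁ X₂ ξ x ω + (Fintype.card V : ℝ) / 2 := by
  have h1 : (Fintype.card V : ℝ) / 2 = ∑ x : V, (1 / 2 : ℝ) := by simp; ring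
  rw [h1, Finset.mul_sum, ← Finset.sum_add_distrib, paintedCount, Nat.card_eq_fintype_card, Fintype.card_subtype]
  rw [Finset.card_filter, Nat.cast_sum]
  refine Finset.sum_congr rfl fun x _ => ?_
  unfold yy
  split_ifs <;> norm_num

end path

section varb
variable {V I : Type*} [Fintype V] [Fintype I] {Ω : Type*} [MeasurableSpace Ω] {G : SimpleGraph V} {P : Measure Ω}
    {X₁ X₂ : ℕ → Ω → V} {ξ : V → Ω → Bool} {μ : I → ℝ} {e : I → V → V → ℝ}

lemma yy_meas (h : IsPaintSetup G P X₁ X₂ ξ) (x : V) : Measurable (yy X₁ X₂ ξ x) := by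
  have h1 : MeasurableSet {ω | hitTime X₁ x ω < hitTime X₂ x ω} := by
    have : {ω | hitTime X₁ x ω < hitTime X₂ x ω} = ⋃ s : ℕ, WW X₁ X₂ s (qh x s) (qm x) := by
      ext ω
      simp only [Set.mem_ofPred_eq, Set.mem_iUnion, WW, ← eq_hit, ← lt_hit]
      constructor
      · intro hl
        obtain ⟨n, hn⟩ := ENat.ne_top_iff_exists.1 (ne_top_of_lt hl)
        exact ⟨n, hn.symm, hn ▸ hl⟩
      · rintro ⟨s, h1, h2⟩; rw [h1]; exact h2
    rw [this]; exact MeasurableSet.iUnion fun s => WW_meas h _ _ _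
  have h2 : MeasurableSet {ω | hitTime X₂ x ω < hitTime X₁ x ω} := by
    have : {ω | hitTime X₂ x ω < hitTime X₁ x ω} = ⋃ s : ℕ, WW X₁ X₂ s (qm x) (qh x s) := by
      ext ω
      simp only [Set.mem_ofPred_eq, Set.mem_iUnion, WW, ← eq_hit, ← lt_hit]
      constructor
      · intro hl
        obtain ⟨n, hn⟩ := ENat.ne_top_iff_exists.1 (ne_top_of_lt hl)
        exact ⟨n, hn ▸ hl, hn.symm⟩
      · rintro ⟨s, h1, h2⟩; rw [h2]; exact h1
    rw [this]; exact MeasurableSet.iUnion fun s => WW_meas h _ _ _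
  have h3 : MeasurableSet {ω | hitTime X₁ x ω = hitTime X₂ x ω} := by
    have : {ω | hitTime X₁ x ω = hitTime X₂ x ω} =
        {ω | hitTime X₁ x ω < hitTime X₂ x ω}ᶜ ∩ {ω | hitTime X₂ x ω < hitTime X₁ x ω}ᶜ := by
      ext ω
      simp only [Set.mem_ofPred_eq, Set.mem_inter_iff, Set.mem_compl_iff, not_lt]
      exact ⟨fun h => ⟨h.ge, h.le⟩, fun h => le_antisymm h.2 h.1⟩
    rw [this]; exact h1.compl.inter h2.compl
  exact Measurable.ite (h1.union (h3.inter (h.measξ x))) measurable_const measurable_const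

lemma int_uu [IsProbabilityMeasure P] (hS : SpecKer (KM G) μ e) (h : IsPaintSetup G P X₁ X₂ ξ) (x : V) (L : ℕ) :
    Integrable (uu X₁ X₂ L x) P ∧ ∫ ω, uu X₁ X₂ L x ω ∂P ≤ (Fintype.card V : ℝ)⁻¹ +
      ((Fintype.card V : ℝ)⁻¹ * ∑ w, FF (KM G) x L w) ^ 2 := by
  have i1 : ∀ s (Q Q' : ℕ → V → Prop), Integrable ((WW X₁ X₂ s Q Q').indicator (1 : Ω → ℝ)) P :=
    fun s Q Q' => (integrable_const (1:ℝ)).indicator (WW_meas h _ _ _)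
  have hN := SpecKer.card_pos' x
  set N : ℝ := (Fintype.card V : ℝ) with hNd
  have i2 : Integrable (fun ω => ∑ s ∈ Finset.range (L + 1),
    (WW X₁ X₂ s (qh x s) (qh x s)).indicator (1 : Ω → ℝ) ω) P := integrable_finsetSum _ fun s _ => i1 _ _ _
  refine ⟨i2.add (i1 _ _ _), ?_⟩
  unfold uu
  rw [integral_add i2 (i1 _ _ _), integral_finsetSum _ fun s _ => i1 _ _ _]
  simp only [integral_indicator_one (WW_meas h _ _ _)]
  simp only [WW, rect h]
  have e1 : ∀ s, pr (KM G) s (qh x s) = N⁻¹ * ∑ w, ff (KM G) x s w := fun s => by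
    simp only [pr, ← SpecKer.bq_ff]; rfl
  have e2 : pr (KM G) L (qm x) = N⁻¹ * ∑ w, FF (KM G) x L w := by
    simp only [pr, ← SpecKer.bq_FF]; rfl
  have a0 : ∀ s, 0 ≤ N⁻¹ * ∑ w, ff (KM G) x s w := fun s =>
    mul_nonneg (by positivity) (Finset.sum_nonneg fun w _ => hS.ff_nonneg x s w)
  have a1 : ∀ s, N⁻¹ * ∑ w, ff (KM G) x s w ≤ N⁻¹ := fun s =>
    mul_le_of_le_one_right (by positivity) (hS.sum_ff_w x s)
  have a2 : ∑ s ∈ Finset.range (L + 1), N⁻¹ * ∑ w, ff (KM G) x s w ≤ 1 := by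
    rw [← Finset.mul_sum, Finset.sum_comm]
    calc N⁻¹ * ∑ w, ∑ s ∈ Finset.range (L + 1), ff (KM G) x s w ≤ N⁻¹ * ∑ w : V, (1:ℝ) := by
          gcongr with w; exact hS.sum_ff_le x _ w
      _ = 1 := by simp [← hNd, hN.ne']
  simp only [e1, e2]
  rw [sq]
  gcongr
  calc ∑ s ∈ Finset.range (L + 1), (N⁻¹ * ∑ w, ff (KM G) x s w) * (N⁻¹ * ∑ w, ff (KM G) x s w)
      ≤ ∑ s ∈ Finset.range (L + 1), N⁻¹ * (N⁻¹ * ∑ w, ff (KM G) x s w) :=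
        Finset.sum_le_sum fun s _ => mul_le_mul_of_nonneg_right (a1 s) (a0 s)
    _ = N⁻¹ * ∑ s ∈ Finset.range (L + 1), (N⁻¹ * ∑ w, ff (KM G) x s w) := by rw [Finset.mul_sum]
    _ ≤ N⁻¹ := mul_le_of_le_one_right (by positivity) a2

lemma var_approx [IsProbabilityMeasure P] (h : IsPaintSetup G P X₁ X₂ ξ)
    (b : ℝ) (L : ℕ) (hui : ∀ x, Integrable (uu X₁ X₂ L x) P) (hub : ∑ x, ∫ ω, uu X₁ X₂ L x ω ∂P ≤ b) :
    |4 * variance (fun ω => (paintedCount X₁ X₂ ξ ω : ℝ)) P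
      - ∑ x, ∑ y, ∫ ω, sgL X₁ X₂ (L + 1) x ω * sgL X₁ X₂ (L + 1) y ω ∂P|
      ≤ 2 * (Fintype.card V : ℝ) * b + b ^ 2 := by
  set N : ℝ := (Fintype.card V : ℝ) with hNd
  set S : Ω → ℝ := fun ω => ∑ x, yy X₁ X₂ ξ x ω with hS
  set S' : Ω → ℝ := fun ω => ∑ x, sgL X₁ X₂ (L + 1) x ω with hS'
  set U : Ω → ℝ := fun ω => ∑ x, uu X₁ X₂ L x ω with hU
  have mS : Measurable S := Finset.measurable_sum _ fun x _ => yy_meas h x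
  have msg : ∀ x, Measurable (sgL X₁ X₂ (L + 1) x) := fun x => Finset.measurable_sum _ fun s _ => ee_meas h x s
  have mS' : Measurable S' := Finset.measurable_sum _ fun x _ => msg x
  have bS : ∀ ω, |S ω| ≤ N := fun ω => (Finset.abs_sum_le_sum_abs _ _).trans
    ((Finset.sum_le_sum fun x _ => abs_yy X₁ X₂ ξ x ω).trans (by simp [hNd]))
  have bS' : ∀ ω, |S' ω| ≤ N := fun ω => (Finset.abs_sum_le_sum_abs _ _).trans
    ((Finset.sum_le_sum fun x _ => abs_sgL X₁ X₂ x L ω).trans (by simp [hNd]))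
  have bSS : ∀ ω, |S ω - S' ω| ≤ U ω := fun ω => by
    simp only [hS, hS', hU, ← Finset.sum_sub_distrib]
    exact (Finset.abs_sum_le_sum_abs _ _).trans (Finset.sum_le_sum fun x _ => yy_sub X₁ X₂ ξ x L ω)
  have hN : 0 ≤ N := by positivity
  have iU : Integrable U P := integrable_finsetSum _ fun x _ => hui x
  have iUb : ∫ ω, U ω ∂P ≤ b := by
    rw [hU, integral_finsetSum _ fun x _ => hui x]; exact hub
  have bdd : ∀ f : Ω → ℝ, Measurable f → ∀ C, (∀ ω, |f ω| ≤ C) → Integrable f P := fun f hf C hC =>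
    Integrable.of_bound hf.aestronglyMeasurable C (Eventually.of_forall hC)
  have iS := bdd S mS N bS
  have iS' := bdd S' mS' N bS'
  have bsq : ∀ a : ℝ, |a| ≤ N → |a ^ 2| ≤ N ^ 2 := fun a ha => by
    rw [abs_pow]; gcongr
  have iS2 : Integrable (fun ω => S ω ^ 2) P := bdd _ (mS.pow_const 2) (N ^ 2) fun ω => bsq _ (bS ω)
  have iS2' : Integrable (fun ω => S' ω ^ 2) P := bdd _ (mS'.pow_const 2) (N ^ 2) fun ω => bsq _ (bS' ω)
  have LpS : MemLp S 2 P := MemLp.of_bound mS.aestronglyMeasurable N (Eventually.of_forall bS)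
  have hvar : 4 * variance (fun ω => (paintedCount X₁ X₂ ξ ω : ℝ)) P = ∫ ω, S ω ^ 2 ∂P - (∫ ω, S ω ∂P) ^ 2 := by
    have e1 : (fun ω => (paintedCount X₁ X₂ ξ ω : ℝ)) = fun ω => 1 / 2 * S ω + N / 2 := by
      funext ω; exact painted_eq X₁ X₂ ξ ω
    rw [e1, variance_add_const (mS.const_mul _).aestronglyMeasurable, variance_const_mul, variance_eq_sub LpS]
    simp only [Pi.pow_apply]
    ring
  have hsum : ∑ x, ∑ y, ∫ ω, sgL X₁ X₂ (L + 1) x ω * sgL X₁ X₂ (L + 1) y ω ∂P = ∫ ω, S' ω ^ 2 ∂P := by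
    have hi : ∀ x y, Integrable (fun ω => sgL X₁ X₂ (L + 1) x ω * sgL X₁ X₂ (L + 1) y ω) P := fun x y =>
      bdd _ ((msg x).mul (msg y)) 1 fun ω => by
        rw [abs_mul]; exact mul_le_one₀ (abs_sgL X₁ X₂ x L ω) (abs_nonneg _) (abs_sgL X₁ X₂ y L ω)
    simp only [hS', sq, Finset.sum_mul_sum]
    rw [integral_finsetSum _ fun x _ => integrable_finsetSum _ fun y _ => hi x y]
    exact Finset.sum_congr rfl fun x _ => (integral_finsetSum _ fun y _ => hi x y).symm
  have hE' : ∫ ω, S' ω ∂P = 0 := by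
    simp only [hS', sgL]
    rw [integral_finsetSum _ fun x _ => integrable_finsetSum _ fun s _ => (int_ee h x s).1]
    refine Finset.sum_eq_zero fun x _ => ?_
    rw [integral_finsetSum _ fun s _ => (int_ee h x s).1]
    exact Finset.sum_eq_zero fun s _ => (int_ee h x s).2
  have hE : |∫ ω, S ω ∂P| ≤ b := by
    have : ∫ ω, S ω ∂P = ∫ ω, (S ω - S' ω) ∂P := by rw [integral_sub iS iS', hE', sub_zero]
    rw [this]
    refine (abs_integral_le_integral_abs).trans (le_trans ?_ iUb)
    exact integral_mono (iS.sub iS').abs iU bSS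
  have hE2 : |∫ ω, S ω ^ 2 ∂P - ∫ ω, S' ω ^ 2 ∂P| ≤ 2 * N * b := by
    rw [← integral_sub iS2 iS2']
    refine (abs_integral_le_integral_abs).trans ?_
    calc ∫ ω, |S ω ^ 2 - S' ω ^ 2| ∂P ≤ ∫ ω, 2 * N * U ω ∂P := by
          refine integral_mono (iS2.sub iS2').abs (iU.const_mul _) fun ω => ?_
          have : S ω ^ 2 - S' ω ^ 2 = (S ω + S' ω) * (S ω - S' ω) := by ring
          simp only [this, abs_mul]
          have h1 := abs_add_le (S ω) (S' ω)
          have h2 := bS ω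
          have h3 := bS' ω
          exact mul_le_mul (by linarith) (bSS ω) (abs_nonneg _) (by positivity)
      _ = 2 * N * ∫ ω, U ω ∂P := integral_const_mul _ _
      _ ≤ 2 * N * b := by gcongr
  rw [hvar, hsum]
  have h3 : (∫ ω, S ω ∂P) ^ 2 ≤ b ^ 2 := by
    rw [← sq_abs]; gcongr
  have h4 := sq_nonneg (∫ ω, S ω ∂P)
  rw [abs_le] at hE2 ⊢
  constructor <;> linarith [hE2.1, hE2.2, sq_nonneg b]

theorem var_bound [IsProbabilityMeasure P] (hS : SpecKer (KM G) μ e) (h : IsPaintSetup G P X₁ X₂ ξ) :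
    |4 * variance (fun ω => (paintedCount X₁ X₂ ξ ω : ℝ)) P
      - 4 * ∑ y, ∑ x ∈ Finset.univ.erase y, JJ (KM G) x y| ≤ 6 * (Fintype.card V : ℝ) + 1 := by
  set N : ℝ := (Fintype.card V : ℝ) with hNd
  choose J hJ1 hJ2 using fun (x y : V) (hxy : x ≠ y) => sgL_cov hS h x y hxy
  set b : ℕ → ℝ := fun L => N * N⁻¹ + ∑ x, (N⁻¹ * ∑ w, FF (KM G) x L w) ^ 2 with hb
  have hbt : Tendsto b atTop (nhds (N * N⁻¹ + ∑ x : V, (N⁻¹ * ∑ w : V, (0:ℝ)) ^ 2)) := by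
    refine tendsto_const_nhds.add (tendsto_finsetSum _ fun x _ => Tendsto.pow ?_ 2)
    exact (tendsto_finsetSum _ fun w _ => hS.FF_tendsto x w).const_mul _
  have hN1 : N * N⁻¹ + ∑ x : V, (N⁻¹ * ∑ w : V, (0:ℝ)) ^ 2 ≤ 1 := by
    simp; exact mul_inv_le_one
  have hN0 : 0 ≤ N * N⁻¹ + ∑ x : V, (N⁻¹ * ∑ w : V, (0:ℝ)) ^ 2 := by positivity
  have hub : ∀ L, ∑ x, ∫ ω, uu X₁ X₂ L x ω ∂P ≤ b L := fun L => by
    refine (Finset.sum_le_sum fun x _ => (int_uu hS h x L).2).trans ?_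
    rw [Finset.sum_add_distrib]
    simp [hb, hNd]
  set JL : ℕ → ℝ := fun L => ∑ y, ∑ x, if hxy : x ≠ y then J x y hxy (L + 1) else 0 with hJL
  have hlim : Tendsto JL atTop (nhds (4 * ∑ y, ∑ x ∈ Finset.univ.erase y, JJ (KM G) x y)) := by
    have e : 4 * ∑ y, ∑ x ∈ Finset.univ.erase y, JJ (KM G) x y =
        ∑ y, ∑ x, if x ≠ y then 2 * (JJ (KM G) x y + JJ (KM G) y x) else 0 := by
      have e1 : ∀ y, ∑ x ∈ Finset.univ.erase y, JJ (KM G) x y = ∑ x, if x ≠ y then JJ (KM G) x y else 0 := by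
        intro y
        rw [← Finset.sum_filter]
        congr 1; ext x; simp
      have e2 : ∑ y, ∑ x, (if x ≠ y then JJ (KM G) y x else 0) = ∑ y, ∑ x, if x ≠ y then JJ (KM G) x y else 0 := by
        rw [Finset.sum_comm]
        simp only [ne_comm]
      have e3 : ∀ x y, (if x ≠ y then 2 * (JJ (KM G) x y + JJ (KM G) y x) else 0) =
          2 * (if x ≠ y then JJ (KM G) x y else 0) + 2 * (if x ≠ y then JJ (KM G) y x else 0) := by
        intro x y; split_ifs <;> ring
      simp only [e1, e3, Finset.sum_add_distrib, ← Finset.mul_sum, e2]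
      ring
    rw [e]
    refine tendsto_finsetSum _ fun y _ => tendsto_finsetSum _ fun x _ => ?_
    by_cases hxy : x ≠ y
    · rw [if_pos hxy]
      simp only [dif_pos hxy]
      exact (hJ1 x y hxy).comp (tendsto_add_atTop_nat 1)
    · simp [hxy]
  have hbound : ∀ L, |4 * variance (fun ω => (paintedCount X₁ X₂ ξ ω : ℝ)) P - JL L|
      ≤ 2 * N * b L + b L ^ 2 + 4 * N := by
    intro L
    have h1 := var_approx h (b L) L (fun x => (int_uu hS h x L).1) (hub L)
    have h2 : |∑ x, ∑ y, ∫ ω, sgL X₁ X₂ (L + 1) x ω * sgL X₁ X₂ (L + 1) y ω ∂P - JL L| ≤ 4 * N := by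
      rw [Finset.sum_comm, hJL, ← Finset.sum_sub_distrib]
      have h3 : ∀ y ∈ (Finset.univ : Finset V), |∑ x, ∫ ω, sgL X₁ X₂ (L + 1) x ω * sgL X₁ X₂ (L + 1) y ω ∂P
         - ∑ x, (if hxy : x ≠ y then J x y hxy (L + 1) else 0)| ≤ 4 := by
        intro y _
        rw [← Finset.sum_sub_distrib]
        refine (Finset.abs_sum_le_sum_abs _ _).trans ?_
        have h4 : ∀ x ∈ (Finset.univ : Finset V), |∫ ω, sgL X₁ X₂ (L + 1) x ω * sgL X₁ X₂ (L + 1) y ω ∂P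
         - (if hxy : x ≠ y then J x y hxy (L + 1) else 0)| ≤ 3 * N⁻¹ + if x = y then 1 else 0 := by
          intro x _
          by_cases hxy : x = y
          · simp only [hxy, ne_eq, not_true_eq_false, dif_neg, not_false_eq_true, sub_zero, if_true]
            have : |∫ ω, sgL X₁ X₂ (L + 1) y ω * sgL X₁ X₂ (L + 1) y ω ∂P| ≤ 1 := by
              have := norm_integral_le_of_norm_le_const (μ := P) (C := 1)
                (f := fun ω => sgL X₁ X₂ (L + 1) y ω * sgL X₁ X₂ (L + 1) y ω) (Eventually.of_forall fun ω => by
                  rw [Real.norm_eq_abs, abs_mul]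
                  exact mul_le_one₀ (abs_sgL X₁ X₂ y L ω) (abs_nonneg _) (abs_sgL X₁ X₂ y L ω))
              simpa using this
            have : 0 ≤ 3 * N⁻¹ := by positivity
            linarith
          · simp only [ne_eq, hxy, not_false_eq_true, dif_pos, if_false, add_zero]
            exact hJ2 x y hxy (L + 1)
        refine (Finset.sum_le_sum h4).trans ?_
        have hN : 0 < N := SpecKer.card_pos' y
        rw [Finset.sum_add_distrib]
        simp [← hNd]
        field_simp
        norm_num
      refine (Finset.abs_sum_le_sum_abs _ _).trans ((Finset.sum_le_sum h3).trans ?_)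
      simp [← hNd, mul_comm]
    rw [abs_le] at *
    constructor <;> linarith [h1.1, h1.2, h2.1, h2.2]
  have l1 := (hlim.const_sub (4 * variance (fun ω => (paintedCount X₁ X₂ ξ ω : ℝ)) P)).abs
  have l2 := ((hbt.const_mul (2 * N)).add (hbt.pow 2)).add_const (4 * N)
  have := le_of_tendsto_of_tendsto' l1 l2 hbound
  refine this.trans ?_
  have : 0 ≤ N := by positivity
  nlinarith

end varb

section torusS
variable {n : ℕ} [NeZero n]

abbrev TV (n : ℕ) : Type := Fin 3 → ZMod n

def chi (k x : TV n) : ℂ := ∏ i, (ZMod.stdAddChar (N := n) (k i * x i) : ℂ)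

def lam (k : TV n) : ℝ := 1 / 2 + 1 / 6 * ∑ i, (ZMod.stdAddChar (N := n) (k i) : ℂ).re

def OO (a : TV n → ℝ) (x y : TV n) : ℂ := ((Fintype.card (TV n) : ℂ))⁻¹ * ∑ k, (a k : ℂ) * chi k (x - y)

lemma chi_comm (k x : TV n) : chi k x = chi x k := by
  simp only [chi, mul_comm]

lemma chi_add (k x y : TV n) : chi k (x + y) = chi k x * chi k y := by
  simp only [chi, Pi.add_apply, mul_add, AddChar.map_add_eq_mul, Finset.prod_mul_distrib]

lemma chi_add_left (k l x : TV n) : chi (k + l) x = chi k x * chi l x := by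
  rw [chi_comm, chi_add, chi_comm, chi_comm x l]

lemma chi_neg (k x : TV n) : chi k (-x) = (starRingEnd ℂ) (chi k x) := by
  simp only [chi, Pi.neg_apply, mul_neg, AddChar.map_neg_eq_conj, map_prod]

lemma chi_neg_left (k x : TV n) : chi (-k) x = (starRingEnd ℂ) (chi k x) := by
  rw [chi_comm, chi_neg, chi_comm]

lemma chi_zero (k : TV n) : chi k 0 = 1 := by simp [chi]

lemma chi_single (k : TV n) (i : Fin 3) : chi k (Pi.single i 1) = (ZMod.stdAddChar (N := n) (k i) : ℂ) := by
  unfold chi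
  rw [Finset.prod_eq_single i]
  · simp
  · intro j _ hj; simp [Pi.single_eq_of_ne hj]
  · simp

lemma norm_chi (k x : TV n) : ‖chi k x‖ = 1 := by
  simp [chi]

lemma sum_chi (k : TV n) : ∑ x, chi k x = if k = 0 then (Fintype.card (TV n) : ℂ) else 0 := by
  have h1 : ∑ x, chi k x = ∏ i, ∑ a : ZMod n, (ZMod.stdAddChar (N := n) (k i * a) : ℂ) := by
    rw [Finset.prod_univ_sum, Fintype.piFinset_univ]; rfl
  have h2 : ∀ i, ∑ a : ZMod n, (ZMod.stdAddChar (N := n) (k i * a) : ℂ) = if k i = 0 then (n : ℂ) else 0 := by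
    intro i
    have := AddChar.sum_mulShift (k i) (ZMod.isPrimitive_stdAddChar n)
    simp only [mul_comm (k i)]
    rw [this]
    split_ifs <;> simp [ZMod.card]
  rw [h1]
  simp only [h2]
  by_cases hk : k = 0
  · subst hk
    simp [ZMod.card]
  · rw [if_neg hk]
    obtain ⟨i, hi⟩ := Function.ne_iff.1 hk
    exact Finset.prod_eq_zero (Finset.mem_univ i) (by rw [if_neg]; simpa using hi)

lemma cardC_ne : (Fintype.card (TV n) : ℂ) ≠ 0 := by
  exact_mod_cast Fintype.card_ne_zero

lemma OO_conv (a c : TV n → ℝ) (x y : TV n) :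
    ∑ b, OO a x b * OO c b y = OO (fun k => a k * c k) x y := by
  have hN := cardC_ne (n := n)
  set N : ℂ := (Fintype.card (TV n) : ℂ) with hNd
  have h1 : ∀ b, OO a x b * OO c b y = N⁻¹ * N⁻¹ * ∑ k, ∑ l, (a k : ℂ) * c l * (chi k x * chi (-l) y) * chi (l - k) b := by
    intro b
    unfold OO
    rw [mul_mul_mul_comm, Finset.sum_mul_sum]
    congr 1
    refine Finset.sum_congr rfl fun k _ => Finset.sum_congr rfl fun l _ => ?_
    rw [sub_eq_add_neg, sub_eq_add_neg, sub_eq_add_neg, chi_add, chi_add, chi_add_left, chi_neg, chi_neg,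
      chi_neg_left, chi_neg_left]
    ring
  simp only [h1]
  rw [← Finset.mul_sum, Finset.sum_comm]
  simp only [Finset.sum_comm (s := Finset.univ) (t := Finset.univ) (f := fun b l => _ * chi (l - _) b)]
  simp only [← Finset.mul_sum, sum_chi, sub_eq_zero, mul_ite, mul_zero, Finset.sum_ite_eq', Finset.mem_univ, if_true]
  unfold OO
  rw [← hNd, ← Finset.sum_mul, mul_comm _ N, ← mul_assoc, mul_assoc N⁻¹, inv_mul_cancel₀ hN, mul_one]
  congr 1
  refine Finset.sum_congr rfl fun k _ => ?_
  rw [sub_eq_add_neg, chi_add, chi_neg, chi_neg_left]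
  push_cast
  ring

lemma OO_real (a : TV n → ℝ) (ha : ∀ k, a (-k) = a k) (x y : TV n) :
    OO a x y = (((Fintype.card (TV n) : ℝ)⁻¹ * ∑ k, a k * (chi k (x - y)).re : ℝ) : ℂ) := by
  have h1 : ∑ k, (a k : ℂ) * chi k (x - y) = ∑ k, (a k : ℂ) * (starRingEnd ℂ) (chi k (x - y)) := by
    rw [← Equiv.sum_comp (Equiv.neg (TV n))]
    simp [ha, chi_neg_left]
  have h2 : ∑ k, (a k : ℂ) * chi k (x - y) = ∑ k, (a k : ℂ) * ((chi k (x - y)).re : ℂ) := by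
    have : 2 * ∑ k, (a k : ℂ) * chi k (x - y) = 2 * ∑ k, (a k : ℂ) * ((chi k (x - y)).re : ℂ) := by
      rw [two_mul]
      nth_rewrite 2 [h1]
      rw [← Finset.sum_add_distrib, Finset.mul_sum]
      refine Finset.sum_congr rfl fun k _ => ?_
      rw [← mul_add, Complex.add_conj]; push_cast; ring
    exact mul_left_cancel₀ two_ne_zero this
  rw [OO, h2]; push_cast; rfl

lemma OO_sum (a : TV n → ℝ) (x : TV n) : ∑ y, OO a x y = a 0 := by
  have hN := cardC_ne (n := n)
  unfold OO
  rw [← Finset.mul_sum, Finset.sum_comm]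
  have : ∀ k : TV n, ∑ y, (a k : ℂ) * chi k (x - y) = if k = 0 then (a 0 : ℂ) * (Fintype.card (TV n) : ℂ) else 0 := by
    intro k
    have h0 : ∑ y, chi k (x - y) = ∑ z, chi k z := Equiv.sum_comp (Equiv.subLeft x) (chi k)
    rw [← Finset.mul_sum, h0, sum_chi]
    split_ifs with hk
    · rw [hk]
    · simp
  simp only [this, Finset.sum_ite_eq', Finset.mem_univ, if_true]
  rw [mul_comm, mul_assoc, mul_inv_cancel₀ hN, mul_one]

lemma OO_one (x y : TV n) : OO (fun _ => 1) x y = if x = y then 1 else 0 := by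
  unfold OO
  simp only [Complex.ofReal_one, one_mul, chi_comm _ (x - y), sum_chi, sub_eq_zero]
  split_ifs
  · rw [inv_mul_cancel₀ cardC_ne]
  · simp

lemma lam_neg (k : TV n) : lam (-k) = lam k := by
  simp [lam, AddChar.map_neg_eq_conj]

lemma lam_eq (k : TV n) : (lam k : ℂ) = 1 / 2 + 1 / 12 * ∑ i, (chi k (Pi.single i 1) + chi k (-Pi.single i 1)) := by
  unfold lam
  simp only [chi_neg, Complex.add_conj, chi_single]
  push_cast
  rw [← Finset.mul_sum]; ring

lemma OO_lam (x y : TV n) : OO lam x y = 1 / 2 * (if x = y then 1 else 0) +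
    1 / 12 * ∑ i : Fin 3, ((if y - x = Pi.single i 1 then 1 else 0) + (if x - y = Pi.single i 1 then 1 else 0)) := by
  have key : ∀ z : TV n, (Fintype.card (TV n) : ℂ)⁻¹ * ∑ k, chi k z * chi k (x - y) = if x - y + z = 0 then 1 else 0 := by
    intro z
    have := OO_one (x - y + z) 0
    unfold OO at this
    simp only [Complex.ofReal_one, one_mul, sub_zero, chi_add] at this
    rw [← this]; simp only [mul_comm]
  have k0 := OO_one x y
  unfold OO at *
  simp only [Complex.ofReal_one, one_mul] at k0
  simp only [lam_eq]
  rw [← k0]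
  have e1 : ∀ i : Fin 3, (if y - x = Pi.single i 1 then (1:ℂ) else 0) =
      (Fintype.card (TV n) : ℂ)⁻¹ * ∑ k, chi k (Pi.single i 1) * chi k (x - y) := by
    intro i; rw [key]; congr 1
    rw [eq_iff_iff, ← sub_eq_zero, ← neg_eq_zero]
    constructor <;> intro h <;> rw [← h] <;> abel
  have e2 : ∀ i : Fin 3, (if x - y = Pi.single i 1 then (1:ℂ) else 0) =
      (Fintype.card (TV n) : ℂ)⁻¹ * ∑ k, chi k (-Pi.single i 1) * chi k (x - y) := by
    intro i; rw [key]; congr 1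
    rw [eq_iff_iff, ← sub_eq_zero]
    constructor <;> intro h <;> rw [← h] <;> abel
  simp only [e1, e2, ← mul_add, ← Finset.mul_sum, ← Finset.sum_add_distrib]
  rw [Finset.sum_comm]
  simp only [add_mul, Finset.sum_add_distrib, Finset.mul_sum, Finset.sum_mul, mul_add]
  congr 1
  · refine Finset.sum_congr rfl fun k _ => by ring
  · congr 1 <;> refine Finset.sum_congr rfl fun k _ => Finset.sum_congr rfl fun i _ => by ring


lemma adj_ind (hn : 3 ≤ n) (x y : TV n) : (if (torus 3 n).Adj x y then (1:ℝ) else 0) =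
    ∑ i : Fin 3, ((if y - x = Pi.single i 1 then 1 else 0) + (if x - y = Pi.single i 1 then 1 else 0)) := by
  have : Fact (1 < n) := ⟨by omega⟩
  have h10 : (1 : ZMod n) ≠ 0 := one_ne_zero
  have h20 : (1 : ZMod n) ≠ -1 := by
    intro h
    have h2 : ((2 : ℕ) : ZMod n) = 0 := by
      push_cast; rw [← sub_eq_zero] at h; rw [← h]; ring
    rw [ZMod.natCast_eq_zero_iff] at h2
    exact absurd (Nat.le_of_dvd (by norm_num) h2) (by omega)
  have inj : ∀ i j : Fin 3, (Pi.single i 1 : TV n) = Pi.single j 1 ↔ i = j := by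
    intro i j
    constructor
    · intro h
      by_contra hij
      have := congrFun h i
      rw [Pi.single_eq_same, Pi.single_eq_of_ne hij] at this
      exact h10 this
    · rintro rfl; rfl
  have ninj : ∀ i j : Fin 3, (Pi.single i 1 : TV n) ≠ -Pi.single j 1 := by
    intro i j h
    have := congrFun h i
    rw [Pi.single_eq_same, Pi.neg_apply] at this
    by_cases hij : i = j
    · subst hij; rw [Pi.single_eq_same] at this; exact h20 this
    · rw [Pi.single_eq_of_ne hij] at this; simp at this
  have nz : ∀ i : Fin 3, (Pi.single i 1 : TV n) ≠ 0 := by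
    intro i h
    have := congrFun h i
    rw [Pi.single_eq_same] at this; exact h10 this
  by_cases h : (torus 3 n).Adj x y
  · rw [if_pos h]
    obtain ⟨hne, i, hi | hi⟩ := h
    · have hi2 : x - y = -Pi.single i 1 := by rw [← hi]; abel
      simp only [hi, hi2, inj, fun j => (ninj j i).symm, if_false, add_zero]
      simp
    · have hi2 : y - x = -Pi.single i 1 := by rw [← hi]; abel
      simp only [hi, hi2, inj, fun j => (ninj j i).symm, if_false, zero_add]
      simp
  · rw [if_neg h]
    symm
    refine Finset.sum_eq_zero fun i _ => ?_
    have h1 : y - x ≠ Pi.single i 1 := fun hh => h ⟨by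
      rintro rfl; rw [sub_self] at hh; exact nz i hh.symm, i, Or.inl hh⟩
    have h2 : x - y ≠ Pi.single i 1 := fun hh => h ⟨by
      rintro rfl; rw [sub_self] at hh; exact nz i hh.symm, i, Or.inr hh⟩
    simp [h1, h2]

lemma deg_torus (hn : 3 ≤ n) (x : TV n) : deg (torus 3 n) x = 6 := by
  have : (deg (torus 3 n) x : ℝ) = 6 := by
    unfold deg
    rw [Finset.card_filter]
    push_cast
    simp only [adj_ind hn]
    rw [Finset.sum_comm]
    have a1 : ∀ i : Fin 3, ∑ y : TV n, (if y - x = Pi.single i 1 then (1:ℝ) else 0) = 1 := by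
      intro i
      simp only [sub_eq_iff_eq_add, Finset.sum_ite_eq', Finset.mem_univ, if_true]
    have a2 : ∀ i : Fin 3, ∑ y : TV n, (if x - y = Pi.single i 1 then (1:ℝ) else 0) = 1 := by
      intro i
      have : ∀ y, x - y = Pi.single i 1 ↔ y = x - Pi.single i 1 := fun y => by
        rw [sub_eq_iff_eq_add, eq_sub_iff_add_eq, add_comm y, eq_comm]
      simp only [this, Finset.sum_ite_eq', Finset.mem_univ, if_true]
    simp only [Finset.sum_add_distrib, a1, a2]
    simp; norm_num
  exact_mod_cast this

lemma KM_torus (hn : 3 ≤ n) (x y : TV n) : KM (torus 3 n) x y = 1 / 2 * (if x = y then 1 else 0) +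
    1 / 12 * (if (torus 3 n).Adj x y then (1:ℝ) else 0) := by
  simp only [KM, Matrix.of_apply, K, deg_torus hn]
  by_cases h : x = y
  · subst h; simp
  · simp only [h, if_false]
    split_ifs <;> norm_num

lemma KM_OO (hn : 3 ≤ n) (x y : TV n) : ((KM (torus 3 n) x y : ℝ) : ℂ) = OO lam x y := by
  rw [KM_torus hn, adj_ind hn, OO_lam]
  push_cast
  simp only [apply_ite (Complex.ofReal), Complex.ofReal_one, Complex.ofReal_zero]

lemma KM_pow (hn : 3 ≤ n) (t : ℕ) : ∀ x y : TV n,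
    (((KM (torus 3 n) ^ t) x y : ℝ) : ℂ) = OO (fun k => lam k ^ t) x y := by
  induction t with
  | zero =>
    intro x y
    simp only [pow_zero, OO_one, Matrix.one_apply]
    split_ifs <;> simp
  | succ t ih =>
    intro x y
    rw [pow_succ, Matrix.mul_apply]
    push_cast
    simp only [ih, KM_OO hn, OO_conv, pow_succ]

lemma lam_cos (k : TV n) : lam k = 1 / 2 + 1 / 6 * ∑ i, Real.cos (2 * Real.pi * (k i).valMinAbs / n) := by
  unfold lam
  congr 2
  refine Finset.sum_congr rfl fun i _ => ?_
  have := ZMod.stdAddChar_coe (N := n) (k i).valMinAbs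
  rw [ZMod.coe_valMinAbs] at this
  rw [this]
  have e : 2 * (Real.pi : ℂ) * Complex.I * ((k i).valMinAbs : ℂ) / (n : ℂ) =
     ((2 * Real.pi * (k i).valMinAbs / n : ℝ) : ℂ) * Complex.I := by push_cast; ring
  rw [e, Complex.exp_ofReal_mul_I_re]

/-- squared euclidean norm of the representative -/
def sqn (k : TV n) : ℝ := ∑ i, ((k i).valMinAbs : ℝ) ^ 2

lemma sqn_pos (k : TV n) (hk : k ≠ 0) : 1 ≤ sqn k := by
  obtain ⟨i, hi⟩ := Function.ne_iff.1 hk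
  have h1 : (k i).valMinAbs ≠ 0 := by rwa [Ne, ZMod.valMinAbs_eq_zero]
  have h2 : (1:ℤ) ≤ (k i).valMinAbs ^ 2 := by
    have := sq_pos_of_ne_zero h1 
    omega
  have h3 : (1:ℝ) ≤ ((k i).valMinAbs : ℝ) ^ 2 := by exact_mod_cast h2
  refine h3.trans ?_
  exact Finset.single_le_sum (f := fun i => ((k i).valMinAbs : ℝ) ^ 2) (fun j _ => sq_nonneg _) (Finset.mem_univ i)

lemma vma_le (a : ZMod n) : |(a.valMinAbs : ℝ)| ≤ n / 2 := by
  have h := ZMod.valMinAbs_mem_Ioc a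
  rw [abs_le]
  have h1 : -(n:ℝ) < (a.valMinAbs : ℝ) * 2 := by exact_mod_cast h.1
  have h2 : (a.valMinAbs : ℝ) * 2 ≤ n := by exact_mod_cast h.2
  constructor <;> linarith

lemma one_sub_lam (k : TV n) : 4 / 3 * sqn k / (n:ℝ) ^ 2 ≤ 1 - lam k := by
  have hn : (0:ℝ) < n := by exact_mod_cast Nat.pos_of_ne_zero (NeZero.ne n)
  rw [lam_cos]
  have h1 : ∀ i, Real.cos (2 * Real.pi * (k i).valMinAbs / n) ≤ 1 - 8 * ((k i).valMinAbs : ℝ) ^ 2 / (n:ℝ) ^ 2 := by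
    intro i
    have hx : |2 * Real.pi * (k i).valMinAbs / n| ≤ Real.pi := by
      rw [abs_div, abs_mul, abs_of_pos Real.two_pi_pos, abs_of_pos hn, div_le_iff₀ hn]
      have := vma_le (k i)
      nlinarith [Real.pi_pos]
    refine (Real.cos_le_one_sub_mul_cos_sq hx).trans (le_of_eq ?_)
    have := Real.pi_pos
    field_simp
    ring
  have h2 := Finset.sum_le_sum (s := Finset.univ) fun i _ => h1 i
  rw [Finset.sum_sub_distrib, ← Finset.sum_div, ← Finset.mul_sum] at h2
  simp only [Finset.sum_const, Finset.card_univ, Fintype.card_fin] at h2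
  have : 4 / 3 * sqn k / (n:ℝ) ^ 2 = 1 / 6 * (8 * ∑ i, ((k i).valMinAbs : ℝ) ^ 2 / (n:ℝ) ^ 2) := by
    unfold sqn; rw [← Finset.sum_div]; ring
  rw [this, ← Finset.sum_div, ← mul_div_assoc]
  norm_num at h2 ⊢
  linarith

lemma lam_nonneg (k : TV n) : 0 ≤ lam k := by
  rw [lam_cos]
  have h2 := Finset.sum_le_sum (s := (Finset.univ : Finset (Fin 3))) fun i _ =>
    Real.neg_one_le_cos (2 * Real.pi * (k i).valMinAbs / n)
  simp at h2
  linarith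

lemma lam_lt (k : TV n) (hk : k ≠ 0) : lam k < 1 := by
  have hn : (0:ℝ) < n := by exact_mod_cast Nat.pos_of_ne_zero (NeZero.ne n)
  have := one_sub_lam k
  have h2 := sqn_pos k hk
  have h3 : 0 < 4 / 3 * sqn k / (n:ℝ) ^ 2 := by positivity
  linarith

lemma lam_zero : lam (0 : TV n) = 1 := by
  rw [lam_cos]; simp; norm_num

abbrev TI (n : ℕ) : Type := {k : TV n // k ≠ 0}

lemma sum_TI (f : TV n → ℝ) : ∑ k : TI n, f k = ∑ k, if k = 0 then 0 else f k := by
  have : (Finset.univ.filter fun k : TV n => k ≠ 0).sum f = ∑ k : TI n, f k :=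
    Finset.sum_subtype _ (by simp) f
  rw [← this, Finset.sum_filter]
  refine Finset.sum_congr rfl fun k _ => ?_
  by_cases hk : k = 0 <;> simp [hk]

def tmu (k : TI n) : ℝ := lam k.1
def te (k : TI n) (x y : TV n) : ℝ := (chi k.1 (x - y)).re

lemma op_OO (p : ℝ → ℝ) (x y : TV n) :
    ((op tmu te p x y : ℝ) : ℂ) = OO (fun k : TV n => if k = 0 then 0 else p (lam k)) x y := by
  rw [OO_real _ (fun k => by simp [lam_neg])]
  congr 1
  unfold op tmu te
  rw [sum_TI (fun k => p (lam k) * (chi k (x - y)).re)]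
  congr 1
  refine Finset.sum_congr rfl fun k _ => ?_
  split_ifs <;> simp

theorem torus_spec (hn : 3 ≤ n) : SpecKer (KM (torus 3 n)) (tmu (n := n)) (te (n := n)) where
  symm x y := by
    rw [KM_torus hn, KM_torus hn, (torus 3 n).adj_comm x y]
    simp only [eq_comm]
  nonneg x y := by
    rw [KM_torus hn]; split_ifs <;> norm_num
  row x := by
    have : ((∑ y, KM (torus 3 n) x y : ℝ) : ℂ) = ((1 : ℝ) : ℂ) := by
      push_cast
      simp only [KM_OO hn, OO_sum, lam_zero]
      simp
    exact_mod_cast this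
  mu0 k := lam_nonneg k.1
  mu1 k := lam_lt k.1 k.2
  e_le k x y := (Complex.abs_re_le_norm _).trans (norm_chi _ _).le
  e_diag k x := by simp [te, chi_zero]
  e_symm k x y := by
    unfold te
    rw [← neg_sub y x, chi_neg, Complex.conj_re]
  pow t x y := by
    have h1 := KM_pow hn t x y
    have h2 := op_OO (fun u => u ^ t) x y
    have h3 : OO (fun k : TV n => lam k ^ t) x y = (Fintype.card (TV n) : ℂ)⁻¹ +
        OO (fun k : TV n => if k = 0 then 0 else lam k ^ t) x y := by
      unfold OO
      rw [← mul_one_add]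
      congr 1
      have : (1:ℂ) = ∑ k : TV n, if k = 0 then 1 else 0 := by simp
      rw [this, ← Finset.sum_add_distrib]
      refine Finset.sum_congr rfl fun k _ => ?_
      by_cases hk : k = 0
      · subst hk; simp [lam_zero, chi_comm 0, chi_zero]
      · simp [hk]
    rw [h3, ← h2] at h1
    have h4 : (((KM (torus 3 n) ^ t) x y : ℝ) : ℂ) = (((Fintype.card (TV n) : ℝ)⁻¹ +
        op tmu te (fun u => u ^ t) x y : ℝ) : ℂ) := by
      rw [h1, Complex.ofReal_add, Complex.ofReal_inv, Complex.ofReal_natCast]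
    convert Complex.ofReal_injective h4
  conv p q x y := by
    have : ((∑ b, op tmu te p x b * op tmu te q b y : ℝ) : ℂ) = ((op tmu te (fun u => p u * q u) x y : ℝ) : ℂ) := by
      push_cast
      simp only [op_OO, OO_conv]
      congr 1
      funext k
      split_ifs <;> simp
    exact_mod_cast this
  sum0 p x := by
    have : ((∑ y, op tmu te p x y : ℝ) : ℂ) = ((0 : ℝ) : ℂ) := by
      push_cast
      simp only [op_OO, OO_sum]
      simp
    exact_mod_cast this

end torusS

section shell

lemma shell_card (i : Fin 3) (a : ℤ) (R : ℕ) :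
    (((Fintype.piFinset (fun _ : Fin 3 => Finset.Icc (-(R:ℤ)) R)).filter
      (fun k => k i = a ∧ ∀ j, |k j| ≤ |a|)).card : ℝ) ≤ (2 * |(a:ℝ)| + 1) ^ 2 := by
  have h1 : ((Fintype.piFinset (fun _ : Fin 3 => Finset.Icc (-(R:ℤ)) R)).filter
      (fun k => k i = a ∧ ∀ j, |k j| ≤ |a|)) ⊆
      Fintype.piFinset (fun j : Fin 3 => if j = i then {a} else Finset.Icc (-|a|) |a|) := by
    intro k hk
    rw [Finset.mem_filter] at hk
    rw [Fintype.mem_piFinset]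
    intro j
    by_cases hj : j = i
    · subst hj; simp [hk.2.1]
    · simp only [hj, if_false, Finset.mem_Icc]
      exact abs_le.1 (hk.2.2 j)
  have h2 := Finset.card_le_card h1
  rw [Fintype.card_piFinset] at h2
  have h3 : (∏ j : Fin 3, ((if j = i then ({a} : Finset ℤ) else Finset.Icc (-|a|) |a|).card)) =
      (|a| + 1 - -|a|).toNat ^ 2 := by
    rw [Fin.prod_univ_three]
    fin_cases i <;> simp [pow_two]
  rw [h3] at h2
  have h4 : (((|a| + 1 - -|a|).toNat : ℤ) : ℝ) = 2 * |(a:ℝ)| + 1 := by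
    rw [Int.toNat_of_nonneg (by have := abs_nonneg a; omega)]
    push_cast; ring
  calc _ ≤ (((|a| + 1 - -|a|).toNat ^ 2 : ℕ) : ℝ) := by exact_mod_cast h2
    _ = _ := by rw [← h4]; push_cast; rfl

lemma shell_one (i : Fin 3) (R : ℕ) :
    ∑ k ∈ Fintype.piFinset (fun _ : Fin 3 => Finset.Icc (-(R:ℤ)) R),
      (if k i ≠ 0 ∧ ∀ j, |k j| ≤ |k i| then (((k i : ℤ) : ℝ) ^ 2)⁻¹ else 0) ≤ 18 * R := by
  rw [← Finset.sum_fiberwise_of_maps_to (t := Finset.Icc (-(R:ℤ)) R) (g := fun k => k i)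
    (fun k hk => Fintype.mem_piFinset.1 hk i)]
  have h : ∀ a ∈ Finset.Icc (-(R:ℤ)) R,
      ∑ k ∈ (Fintype.piFinset (fun _ : Fin 3 => Finset.Icc (-(R:ℤ)) R)).filter (fun k => k i = a),
        (if k i ≠ 0 ∧ ∀ j, |k j| ≤ |k i| then (((k i : ℤ) : ℝ) ^ 2)⁻¹ else 0) ≤
      if a = 0 then 0 else 9 := by
    intro a _
    by_cases ha : a = 0
    · rw [if_pos ha]
      refine (Finset.sum_eq_zero fun k hk => ?_).le
      rw [Finset.mem_filter] at hk
      rw [if_neg]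
      rintro ⟨h0, _⟩
      exact h0 (hk.2.trans ha)
    · rw [if_neg ha]
      have e : ∑ k ∈ (Fintype.piFinset (fun _ : Fin 3 => Finset.Icc (-(R:ℤ)) R)).filter (fun k => k i = a),
        (if k i ≠ 0 ∧ ∀ j, |k j| ≤ |k i| then (((k i : ℤ) : ℝ) ^ 2)⁻¹ else 0) =
        ∑ k ∈ (Fintype.piFinset (fun _ : Fin 3 => Finset.Icc (-(R:ℤ)) R)).filter
          (fun k => k i = a ∧ ∀ j, |k j| ≤ |a|), ((a : ℝ) ^ 2)⁻¹ := by
        rw [← Finset.filter_filter, Finset.sum_filter (s := Finset.filter _ _)]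
        refine Finset.sum_congr rfl fun k hk => ?_
        rw [Finset.mem_filter] at hk
        rw [hk.2]
        simp [ha]
      rw [e, Finset.sum_const, nsmul_eq_mul]
      have ha1 : (1:ℝ) ≤ |(a:ℝ)| := by
        rw [← Int.cast_abs]; exact_mod_cast Int.one_le_abs ha
      have h2 : (0:ℝ) < (a:ℝ) ^ 2 := by rw [← sq_abs]; positivity
      rw [← div_eq_mul_inv, div_le_iff₀ h2]
      refine (shell_card i a R).trans ?_
      rw [← sq_abs (a:ℝ)]
      nlinarith
  refine (Finset.sum_le_sum h).trans ?_
  have : (0:ℤ) ∈ Finset.Icc (-(R:ℤ)) R := by simp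
  rw [← Finset.sum_erase_add _ _ this]
  rw [Finset.sum_congr rfl (fun a ha => if_neg (Finset.ne_of_mem_erase ha))]
  rw [Finset.sum_const, Finset.card_erase_of_mem this, Int.card_Icc, nsmul_eq_mul, if_pos rfl]
  have : ((R:ℤ) + 1 - -R).toNat - 1 = 2 * R := by omega
  rw [this]; push_cast; linarith

lemma shell_sum (R : ℕ) :
    ∑ k ∈ Fintype.piFinset (fun _ : Fin 3 => Finset.Icc (-(R:ℤ)) R),
      (if k ≠ 0 then (∑ i, ((k i : ℤ) : ℝ) ^ 2)⁻¹ else 0) ≤ 54 * R := by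
  have h : ∀ k : Fin 3 → ℤ, (if k ≠ 0 then (∑ i, ((k i : ℤ) : ℝ) ^ 2)⁻¹ else 0) ≤
      ∑ i, (if k i ≠ 0 ∧ ∀ j, |k j| ≤ |k i| then (((k i : ℤ) : ℝ) ^ 2)⁻¹ else 0) := by
    intro k
    split_ifs with hk
    · obtain ⟨i, hi⟩ := Finite.exists_max fun i => |k i|
      have h0 : k i ≠ 0 := by
        intro h0
        apply hk
        funext j
        have := hi j
        rw [h0] at this
        simpa using this
      have : (∑ i, ((k i : ℤ) : ℝ) ^ 2)⁻¹ ≤ (if k i ≠ 0 ∧ ∀ j, |k j| ≤ |k i| then (((k i : ℤ) : ℝ) ^ 2)⁻¹ else 0) := by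
        rw [if_pos ⟨h0, hi⟩]
        apply inv_anti₀
        · have : ((k i : ℤ) : ℝ) ≠ 0 := by exact_mod_cast h0
          positivity
        · exact Finset.single_le_sum (f := fun i => ((k i : ℤ) : ℝ) ^ 2) (fun j _ => sq_nonneg _) (Finset.mem_univ i)
      refine this.trans ?_
      refine Finset.single_le_sum (f := fun i => (if k i ≠ 0 ∧ ∀ j, |k j| ≤ |k i| then (((k i : ℤ) : ℝ) ^ 2)⁻¹ else 0)) (fun j _ => ?_) (Finset.mem_univ i)
      split_ifs <;> positivity
    · refine Finset.sum_nonneg fun j _ => ?_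
      split_ifs <;> positivity
  refine (Finset.sum_le_sum fun k _ => h k).trans ?_
  rw [Finset.sum_comm]
  refine (Finset.sum_le_sum fun i _ => shell_one i R).trans ?_
  simp
  linarith

variable {n : ℕ} [NeZero n]

def tz (k : TV n) : Fin 3 → ℤ := fun i => (k i).valMinAbs

lemma tz_inj : Function.Injective (tz (n := n)) := by
  intro a b h
  funext i
  exact ZMod.injective_valMinAbs (congrFun h i)

lemma tz_zero (k : TV n) : tz k = 0 ↔ k = 0 := by
  constructor
  · intro h; apply tz_inj; rw [h]; funext i; simp [tz]
  · rintro rfl; funext i; simp [tz]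

/-- `1/(1-λ)` -/
def ss (k : TV n) : ℝ := (1 - lam k)⁻¹

lemma npos : (0:ℝ) < n := by exact_mod_cast Nat.pos_of_ne_zero (NeZero.ne n)

lemma ss_le (k : TV n) (hk : k ≠ 0) : ss k ≤ 3 / 4 * (n:ℝ) ^ 2 * (sqn k)⁻¹ := by
  have h1 := one_sub_lam k
  have h2 := sqn_pos k hk
  have hn := npos (n := n)
  have : 3 / 4 * (n:ℝ) ^ 2 * (sqn k)⁻¹ = (4 / 3 * sqn k / (n:ℝ) ^ 2)⁻¹ := by
    field_simp
  rw [this]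
  exact inv_anti₀ (by positivity) h1

lemma ss_le' (k : TV n) (hk : k ≠ 0) : ss k ≤ (n:ℝ) ^ 2 := by
  refine (ss_le k hk).trans ?_
  have h2 := inv_le_one_of_one_le₀ (sqn_pos k hk)
  have hn := npos (n := n)
  have : 0 < (n:ℝ)^2 := by positivity
  nlinarith

lemma ss_ge (k : TV n) (hk : k ≠ 0) : 1 ≤ ss k := by
  apply (one_le_inv₀ (by linarith [lam_lt k hk])).2
  linarith [lam_nonneg k]

/-- tail function -/
def ptail (K u : ℝ) : ℝ := if K < (1 - u)⁻¹ then (1 - u)⁻¹ else 0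

lemma card_TV : (Fintype.card (TV n) : ℝ) = (n:ℝ) ^ 3 := by
  simp [ZMod.card]

lemma mom_TI (p : ℝ → ℝ) : mom (TV n) (tmu (n := n)) p = ((n:ℝ) ^ 3)⁻¹ * ∑ k : TV n, if k = 0 then 0 else p (lam k) := by
  unfold mom
  rw [card_TV, ← sum_TI (fun k => p (lam k))]
  rfl

lemma tail_bound (K : ℝ) (hK : 1 ≤ K) : mom (TV n) (tmu (n := n)) (ptail K) ≤ 41 / Real.sqrt K := by
  have hn := npos (n := n)
  have hK0 : 0 < Real.sqrt K := Real.sqrt_pos.2 (by linarith)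
  set R : ℕ := ⌊(n:ℝ) / Real.sqrt K⌋₊ with hR
  have hR1 : (R:ℝ) ≤ n / Real.sqrt K := Nat.floor_le (by positivity)
  rw [mom_TI]
  have key : ∑ k : TV n, (if k = 0 then 0 else ptail K (lam k)) ≤
      3 / 4 * (n:ℝ) ^ 2 * ∑ z ∈ Fintype.piFinset (fun _ : Fin 3 => Finset.Icc (-(R:ℤ)) R),
      (if z ≠ 0 then (∑ i, ((z i : ℤ) : ℝ) ^ 2)⁻¹ else 0) := by
    have e1 : ∀ k : TV n, (if k = 0 then 0 else ptail K (lam k)) ≤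
        if tz k ∈ Fintype.piFinset (fun _ : Fin 3 => Finset.Icc (-(R:ℤ)) R) then
          3 / 4 * (n:ℝ) ^ 2 * (if tz k ≠ 0 then (∑ i, ((tz k i : ℤ) : ℝ) ^ 2)⁻¹ else 0) else 0 := by
      intro k
      by_cases hk : k = 0
      · rw [if_pos hk]; split_ifs <;> positivity
      · rw [if_neg hk]
        have hz : tz k ≠ 0 := by rwa [Ne, tz_zero]
        rw [if_pos hz]
        unfold ptail
        by_cases hs : K < (1 - lam k)⁻¹
        · rw [if_pos hs]
          have h1 := ss_le k hk
          have h2 : sqn k ≤ (n / Real.sqrt K) ^ 2 := by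
            have h3 := sqn_pos k hk
            have h4 : K < 3 / 4 * (n:ℝ) ^ 2 * (sqn k)⁻¹ := lt_of_lt_of_le hs h1
            rw [div_pow, Real.sq_sqrt (by linarith), le_div_iff₀ (by linarith)]
            rw [← div_eq_mul_inv, lt_div_iff₀ (by linarith)] at h4
            nlinarith [sq_nonneg (n:ℝ)]
          rw [if_pos]
          · exact h1
          · rw [Fintype.mem_piFinset]
            intro i
            rw [Finset.mem_Icc, ← abs_le]
            have h5 : ((tz k i : ℤ) : ℝ) ^ 2 ≤ (n / Real.sqrt K) ^ 2 :=
              (Finset.single_le_sum (f := fun i => ((k i).valMinAbs : ℝ) ^ 2) (fun j _ => sq_nonneg _) (Finset.mem_univ i)).trans h2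
            have h6 := abs_le_of_sq_le_sq h5 (by positivity)
            have h7 : ((tz k i).natAbs : ℝ) ≤ n / Real.sqrt K := by
              rw [Nat.cast_natAbs, Int.cast_abs]; exact h6
            have h8 := Nat.le_floor h7
            rw [Int.abs_eq_natAbs]
            exact_mod_cast h8
        · rw [if_neg hs]
          split_ifs <;> positivity
    refine (Finset.sum_le_sum fun k _ => e1 k).trans ?_
    rw [← Finset.sum_filter, Finset.mul_sum]
    rw [← Finset.sum_image (f := fun z => 3 / 4 * (n:ℝ) ^ 2 * (if z ≠ 0 then (∑ i, ((z i : ℤ) : ℝ) ^ 2)⁻¹ else 0))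
      (g := tz (n := n)) (tz_inj.injOn)]
    apply Finset.sum_le_sum_of_subset_of_nonneg
    · intro z hz
      obtain ⟨k, hk, rfl⟩ := Finset.mem_image.1 hz
      exact (Finset.mem_filter.1 hk).2
    · intro z _ _
      split_ifs <;> positivity
  have h9 := shell_sum R
  have h10 : ∑ k : TV n, (if k = 0 then 0 else ptail K (lam k)) ≤ 41 * (n:ℝ) ^ 3 / Real.sqrt K := by
    refine key.trans ((mul_le_mul_of_nonneg_left (h9.trans (mul_le_mul_of_nonneg_left hR1 (by norm_num))) (by positivity)).trans ?_)
    rw [show 3 / 4 * (n:ℝ)^2 * (54 * (n / Real.sqrt K)) = 40.5 * (n:ℝ) ^ 3 / Real.sqrt K by ring]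
    gcongr
    norm_num
  rw [inv_mul_le_iff₀ (by positivity)]
  refine h10.trans (le_of_eq (by ring))

lemma tail_tri (K u : ℝ) : (1 - u)⁻¹ ≤ max K 0 + ptail K u := by
  unfold ptail
  split_ifs with h
  · linarith [le_max_right K 0]
  · linarith [le_max_left K 0]

lemma mom_one_le : mom (TV n) (tmu (n := n)) (fun _ => 1) ≤ 1 := by
  rw [mom_TI]
  have hn := npos (n := n)
  rw [inv_mul_le_iff₀ (by positivity), mul_one, ← card_TV]
  have : ∑ k : TV n, (if k = 0 then (0:ℝ) else 1) ≤ ∑ k : TV n, 1 := Finset.sum_le_sum fun k _ => by split_ifs <;> norm_num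
  refine this.trans (by simp)

lemma mom_add {V I : Type*} [Fintype V] [Fintype I] (μ : I → ℝ) (p q : ℝ → ℝ) : mom V μ (fun u => p u + q u) = mom V μ p + mom V μ q := by
  simp [mom, Finset.sum_add_distrib, mul_add]

lemma mom_smul {V I : Type*} [Fintype V] [Fintype I] (μ : I → ℝ) (c : ℝ) (p : ℝ → ℝ) : mom V μ (fun u => c * p u) = c * mom V μ p := by
  simp only [mom, ← Finset.mul_sum]; ring

lemma A1_le : Am (TV n) (tmu (n := n)) 1 ≤ 42 := by
  have h1 : Am (TV n) (tmu (n := n)) 1 ≤ mom (TV n) (tmu (n := n)) (fun u => 1 * 1 + ptail 1 u) := by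
    apply SpecKer.mom_mono
    intro i
    have := tail_tri 1 (tmu i)
    simpa using this
  rw [mom_add, mom_smul] at h1
  have h2 := tail_bound (n := n) 1 le_rfl
  have h3 := mom_one_le (n := n)
  simp only [Real.sqrt_one, div_one] at h2
  linarith

lemma A1_ge : 1 - ((n:ℝ) ^ 3)⁻¹ ≤ Am (TV n) (tmu (n := n)) 1 := by
  unfold Am
  rw [mom_TI]
  have hn := npos (n := n)
  have h : ∑ k : TV n, ((1:ℝ) - if k = 0 then 1 else 0) ≤ ∑ k : TV n, if k = 0 then 0 else ((1 - lam k)⁻¹) ^ 1 := by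
    apply Finset.sum_le_sum
    intro k _
    by_cases hk : k = 0
    · simp [hk]
    · have := ss_ge k hk
      simpa [hk, ss] using this
  rw [Finset.sum_sub_distrib] at h
  simp only [Finset.sum_ite_eq', Finset.mem_univ, if_true, Finset.sum_const, nsmul_eq_mul, mul_one, Finset.card_univ, card_TV] at h
  have h2 := mul_le_mul_of_nonneg_left h (by positivity : (0:ℝ) ≤ ((n:ℝ)^3)⁻¹)
  refine le_trans (le_of_eq ?_) h2
  field_simp

lemma A3_le : Am (TV n) (tmu (n := n)) 3 ≤ (n:ℝ) ^ 2 * Am (TV n) (tmu (n := n)) 2 := by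
  unfold Am
  rw [← mom_smul]
  apply SpecKer.mom_mono
  intro i
  have h1 := ss_le' i.1 i.2
  have : 0 ≤ ss i.1 := by linarith [ss_ge i.1 i.2]
  change ss i.1 ^ 3 ≤ (n:ℝ) ^ 2 * ss i.1 ^ 2
  nlinarith [sq_nonneg (ss i.1)]

end shell

section lattice

lemma summ4 : Summable fun z : Fin 3 → ℤ => ((∑ i, ((z i : ℤ) : ℝ) ^ 2)⁻¹) ^ 2 := by
  have h := ZLattice.summable_norm_rpow (Submodule.span ℤ (Set.range (Pi.basisFun ℝ (Fin 3)))) (-4)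
    (by rw [ZLattice.rank ℝ]; simp; norm_num)
  have hm : ∀ z : Fin 3 → ℤ, (fun i => (z i:ℝ)) ∈ Submodule.span ℤ (Set.range (Pi.basisFun ℝ (Fin 3))) := by
    intro z
    rw [Module.Basis.mem_span_iff_repr_mem]
    intro i; simp
  have h1 := h.comp_injective (i := fun z : Fin 3 → ℤ => ⟨_, hm z⟩) (by
    intro a b hab
    funext i
    have := congrFun (congrArg Subtype.val hab) i
    simpa using this)
  refine Summable.of_nonneg_of_le (fun z => by positivity) (fun z => ?_) h1
  change _ ≤ ‖(fun i => (z i:ℝ))‖ ^ (-4:ℝ)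
  by_cases hz : z = 0
  · subst hz
    simp
  · have hz' : (fun i => (z i:ℝ)) ≠ 0 := by
      intro h0; apply hz; funext i; have := congrFun h0 i; simpa using this
    have hpos : 0 < ‖(fun i => (z i:ℝ))‖ := norm_pos_iff.2 hz'
    rw [Real.rpow_neg hpos.le, inv_pow]
    apply inv_anti₀
    · positivity
    · have : ‖(fun i => (z i:ℝ))‖ ^ 2 ≤ ∑ i, ((z i : ℤ) : ℝ) ^ 2 := by
        have hS : 0 ≤ ∑ i, ((z i : ℤ) : ℝ) ^ 2 := Finset.sum_nonneg fun i _ => sq_nonneg _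
        rw [← Real.le_sqrt (by positivity) hS]
        rw [pi_norm_le_iff_of_nonneg (Real.sqrt_nonneg _)]
        intro i
        rw [Real.norm_eq_abs]
        apply Real.abs_le_sqrt
        exact Finset.single_le_sum (f := fun i => ((z i : ℤ) : ℝ) ^ 2) (fun j _ => sq_nonneg _) (Finset.mem_univ i)
      calc ‖(fun i => (z i:ℝ))‖ ^ (4:ℝ) = (‖(fun i => (z i:ℝ))‖ ^ 2) ^ 2 := by
            rw [show (4:ℝ) = ((4:ℕ):ℝ) by norm_num, Real.rpow_natCast]; ring
        _ ≤ _ := by gcongr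

/-- symbol -/
def Lz (x : Fin 3 → ℝ) : ℝ := 1 / 2 + 1 / 6 * ∑ i, Real.cos (2 * Real.pi * x i)

lemma Lz_cont : Continuous Lz := by unfold Lz; fun_prop

lemma lam_Lz {n : ℕ} [NeZero n] (k : TV n) : lam k = Lz (fun i => (tz k i : ℝ) / n) := by
  rw [lam_cos]; unfold Lz tz; simp only [mul_div_assoc]

def fz (n : ℕ) (z : Fin 3 → ℤ) : ℝ :=
  if (∀ i, z i * 2 ∈ Set.Ioc (-(n:ℤ)) n) ∧ z ≠ 0 then
    (((n:ℝ) ^ 2 * (1 - Lz (fun i => (z i : ℝ) / n)))⁻¹) ^ 2 else 0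

lemma tz_range {n : ℕ} [NeZero n] (z : Fin 3 → ℤ) : z ∈ Set.range (tz (n := n)) ↔ ∀ i, z i * 2 ∈ Set.Ioc (-(n:ℤ)) n := by
  constructor
  · rintro ⟨k, rfl⟩ i
    exact ZMod.valMinAbs_mem_Ioc _
  · intro h
    refine ⟨fun i => (z i : ZMod n), ?_⟩
    funext i
    exact (ZMod.valMinAbs_spec _ _).2 ⟨rfl, h i⟩

lemma A2_tsum {n : ℕ} [NeZero n] : Am (TV n) (tmu (n := n)) 2 / n = ∑' z, fz n z := by
  have hn := npos (n := n)
  rw [← (tz_inj (n := n)).tsum_eq]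
  · rw [tsum_fintype]
    unfold Am
    rw [mom_TI, div_eq_inv_mul, ← mul_assoc, Finset.mul_sum]
    refine Finset.sum_congr rfl fun k _ => ?_
    unfold fz
    by_cases hk : k = 0
    · subst hk
      simp [(tz_zero (0 : TV n)).2 rfl]
    · rw [if_neg hk, if_pos ⟨(tz_range _).1 ⟨k, rfl⟩, by rwa [Ne, tz_zero]⟩, ← lam_Lz]
      rw [mul_inv, mul_pow]
      congr 1
      field_simp
  · intro z hz
    rw [tz_range]
    by_contra h
    apply hz
    unfold fz
    rw [if_neg]
    exact fun h' => h h'.1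

lemma fz_bound (n : ℕ) [NeZero n] (z : Fin 3 → ℤ) : ‖fz n z‖ ≤ ((∑ i, ((z i : ℤ) : ℝ) ^ 2)⁻¹) ^ 2 := by
  have hn := npos (n := n)
  unfold fz
  split_ifs with h
  · obtain ⟨k, rfl⟩ := (tz_range z).2 h.1
    have hk : k ≠ 0 := by rw [Ne, ← tz_zero]; exact h.2
    rw [Real.norm_of_nonneg (by positivity), ← lam_Lz, mul_inv]
    have h1 := ss_le k hk
    have h2 := ss_ge k hk
    have h3 : (0:ℝ) ≤ ((n:ℝ)^2)⁻¹ := by positivity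
    have h4 := sqn_pos k hk
    change (((n:ℝ)^2)⁻¹ * ss k) ^ 2 ≤ ((sqn k)⁻¹) ^ 2
    have h5 : ((n:ℝ)^2)⁻¹ * ss k ≤ (sqn k)⁻¹ := by
      rw [inv_mul_le_iff₀ (by positivity)]
      refine h1.trans ?_
      have : 0 ≤ (n:ℝ)^2 * (sqn k)⁻¹ := by positivity
      nlinarith
    have h6 : 0 ≤ ((n:ℝ)^2)⁻¹ * ss k := by
      have : 0 ≤ ss k := by linarith
      positivity
    gcongr
  · simp; positivity

lemma cos_lim (c : ℝ) : Tendsto (fun n : ℕ => (((n + 1 : ℕ) : ℝ)) ^ 2 * (1 - Real.cos (c / ((n + 1 : ℕ) : ℝ)))) atTop (nhds (c ^ 2 / 2)) := by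
  have h0 : Tendsto (fun n : ℕ => c / 2 / ((n + 1 : ℕ) : ℝ)) atTop (nhds 0) :=
    (tendsto_const_div_atTop_nhds_zero_nat (c / 2)).comp (tendsto_add_atTop_nat 1)
  have h1 : Tendsto (fun n : ℕ => Real.sinc (c / 2 / ((n + 1 : ℕ) : ℝ))) atTop (nhds 1) := by
    have := (Real.continuous_sinc.tendsto 0).comp h0
    rwa [Real.sinc_zero] at this
  have h2 := (h1.pow 2).const_mul (c ^ 2 / 2)
  rw [one_pow, mul_one] at h2
  refine h2.congr fun n => ?_
  have hm : ((n + 1 : ℕ) : ℝ) ≠ 0 := by positivity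
  set m : ℝ := ((n + 1 : ℕ) : ℝ)
  have e : Real.cos (c / m) = 1 - 2 * Real.sin (c / 2 / m) ^ 2 := by
    rw [show c / m = 2 * (c / 2 / m) by ring, Real.cos_two_mul, ← Real.sin_sq_add_cos_sq (c / 2 / m)]
    ring
  rw [e]
  by_cases hc : c = 0
  · subst hc; simp
  · rw [Real.sinc_of_ne_zero (by positivity)]
    field_simp
    ring

/-- limiting second moment -/
def gz (z : Fin 3 → ℤ) : ℝ := if z ≠ 0 then ((Real.pi ^ 2 / 3 * ∑ i, ((z i : ℤ) : ℝ) ^ 2)⁻¹) ^ 2 else 0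

lemma sqz_pos (z : Fin 3 → ℤ) (hz : z ≠ 0) : 0 < ∑ i, ((z i : ℤ) : ℝ) ^ 2 := by
  obtain ⟨i, hi⟩ := Function.ne_iff.1 hz
  refine lt_of_lt_of_le ?_ (Finset.single_le_sum (f := fun i => ((z i : ℤ) : ℝ) ^ 2) (fun j _ => sq_nonneg _) (Finset.mem_univ i))
  have : ((z i : ℤ) : ℝ) ≠ 0 := by exact_mod_cast hi
  positivity

lemma fz_lim (z : Fin 3 → ℤ) : Tendsto (fun n : ℕ => fz (n + 1) z) atTop (nhds (gz z)) := by
  unfold fz gz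
  by_cases hz : z = 0
  · simp [hz]
  · rw [if_pos hz]
    have h1 : Tendsto (fun n : ℕ => (((n + 1 : ℕ) : ℝ) ^ 2 * (1 - Lz (fun i => (z i : ℝ) / ((n + 1 : ℕ) : ℝ))))) atTop
        (nhds (Real.pi ^ 2 / 3 * ∑ i, ((z i : ℤ) : ℝ) ^ 2)) := by
      have h2 := (tendsto_finsetSum (Finset.univ : Finset (Fin 3)) fun i _ => cos_lim (2 * Real.pi * z i)).const_mul (1 / 6)
      have e : 1 / 6 * ∑ i, (2 * Real.pi * (z i : ℝ)) ^ 2 / 2 = Real.pi ^ 2 / 3 * ∑ i, ((z i : ℤ) : ℝ) ^ 2 := by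
        rw [Finset.mul_sum, Finset.mul_sum]
        refine Finset.sum_congr rfl fun i _ => by ring
      rw [e] at h2
      refine h2.congr fun n => ?_
      rw [← Finset.mul_sum, Finset.sum_sub_distrib]
      unfold Lz
      simp only [mul_div_assoc]
      simp
      ring
    have hpos : Real.pi ^ 2 / 3 * ∑ i, ((z i : ℤ) : ℝ) ^ 2 ≠ 0 := by
      have := sqz_pos z hz
      have := Real.pi_pos
      positivity
    refine ((h1.inv₀ hpos).pow 2).congr' ?_
    filter_upwards [eventually_gt_atTop (∑ i, 2 * (z i).natAbs)] with n hn
    rw [if_pos]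
    refine ⟨fun i => ?_, hz⟩
    have h3 : 2 * (z i).natAbs ≤ ∑ i, 2 * (z i).natAbs := Finset.single_le_sum (f := fun i => 2 * (z i).natAbs) (fun j _ => Nat.zero_le _) (Finset.mem_univ i)
    constructor <;> push_cast <;> omega

lemma A2_lim : Tendsto (fun n : ℕ => Am (TV (n + 1)) (tmu (n := n + 1)) 2 / ((n + 1 : ℕ) : ℝ)) atTop (nhds (∑' z, gz z)) := by
  simp only [A2_tsum]
  exact tendsto_tsum_of_dominated_convergence summ4 fz_lim (Eventually.of_forall fun n z => fz_bound (n + 1) z)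

lemma gz_nonneg (z : Fin 3 → ℤ) : 0 ≤ gz z := by unfold gz; split_ifs <;> positivity

lemma a2_pos : 0 < ∑' z, gz z := by
  have hs : Summable gz := by
    refine Summable.of_nonneg_of_le gz_nonneg (fun z => ?_) summ4
    exact le_of_tendsto (fz_lim z).norm (Eventually.of_forall fun n => fz_bound (n + 1) z) |>.trans' (le_abs_self _)
  refine hs.tsum_pos gz_nonneg (fun _ => 1) ?_
  unfold gz
  have : (fun _ => 1 : Fin 3 → ℤ) ≠ 0 := by
    intro h; have := congrFun h 0; simp at this
  rw [if_pos this]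
  have := sqz_pos _ this
  have := Real.pi_pos
  positivity

open scoped Pointwise in
/-- Riemann sums -/
lemma riemann (F : (Fin 3 → ℝ) → ℝ) (hF : Continuous F) : ∃ l, Tendsto (fun n : ℕ =>
    (((n + 1 : ℕ) : ℝ) ^ 3)⁻¹ * ∑ k : TV (n + 1), F (fun i => (tz k i : ℝ) / ((n + 1 : ℕ) : ℝ))) atTop (nhds l) := by
  set s : Set (Fin 3 → ℝ) := Set.pi Set.univ fun _ => Set.Ioc (-(1/2):ℝ) (1/2) with hs
  have h := tendsto_tsum_div_pow_atTop_integral s F hF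
    (Bornology.IsBounded.pi fun _ => Metric.isBounded_Ioc _ _)
    (MeasurableSet.univ_pi fun _ => measurableSet_Ioc)
    ((convex_pi fun _ _ => convex_Ioc _ _).addHaar_frontier volume)
  refine ⟨_, (h.comp (tendsto_add_atTop_nat 1)).congr fun n => ?_⟩
  simp only [Function.comp]
  have hn := npos (n := n + 1)
  set m : ℕ := n + 1 with hm
  rw [Fintype.card_fin, div_eq_inv_mul]
  congr 1
  have hmem : ∀ k : TV m, (fun i => (tz k i : ℝ) / (m : ℝ)) ∈ s ∩ (m:ℝ)⁻¹ • (Submodule.span ℤ (Set.range (Pi.basisFun ℝ (Fin 3))) : Set (Fin 3 → ℝ)) := by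
    intro k
    constructor
    · rw [hs, Set.mem_univ_pi]
      intro i
      have h1 := (tz_range (n := m) (tz k)).1 ⟨k, rfl⟩ i
      have h2 : -(m:ℝ) < (tz k i : ℝ) * 2 := by exact_mod_cast h1.1
      have h3 : (tz k i : ℝ) * 2 ≤ m := by exact_mod_cast h1.2
      constructor
      · rw [lt_div_iff₀ hn]; linarith
      · rw [div_le_iff₀ hn]; linarith
    · refine ⟨fun i => (tz k i : ℝ), ?_, ?_⟩
      · rw [SetLike.mem_coe, Module.Basis.mem_span_iff_repr_mem]
        intro i; simp
      · funext i; simp [div_eq_inv_mul]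
  have hbij : Function.Bijective (fun k : TV m => (⟨_, hmem k⟩ : ↑(s ∩ (m:ℝ)⁻¹ • (Submodule.span ℤ (Set.range (Pi.basisFun ℝ (Fin 3))) : Set (Fin 3 → ℝ))))) := by
    constructor
    · intro a b hab
      apply tz_inj
      funext i
      have := congrFun (congrArg Subtype.val hab) i
      simp only at this
      rw [div_left_inj' hn.ne'] at this
      exact_mod_cast this
    · rintro ⟨x, hx1, y, hy, rfl⟩
      rw [SetLike.mem_coe, Module.Basis.mem_span_iff_repr_mem] at hy
      choose z hz using hy
      simp only [Pi.basisFun_repr, algebraMap_int_eq, eq_intCast] at hz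
      obtain ⟨k, hk⟩ := (tz_range (n := m) z).2 (by
        intro i
        have h1 := (Set.mem_univ_pi.1 hx1) i
        simp only [Pi.smul_apply, smul_eq_mul, ← hz] at h1
        have h2 := h1.1
        have h3 := h1.2
        rw [← div_eq_inv_mul, lt_div_iff₀ hn] at h2
        rw [← div_eq_inv_mul, div_le_iff₀ hn] at h3
        constructor
        · have : (-(m:ℝ)) < (z i : ℝ) * 2 := by linarith
          exact_mod_cast this
        · have : (z i : ℝ) * 2 ≤ m := by linarith
          exact_mod_cast this)
      refine ⟨k, Subtype.ext ?_⟩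
      funext i
      simp only [hk, Pi.smul_apply, smul_eq_mul, ← hz, div_eq_inv_mul]
  rw [← tsum_fintype (L := SummationFilter.unconditional _)]
  exact ((Equiv.ofBijective _ hbij).tsum_eq (fun x => F x.1)).symm

end lattice

section lims

lemma exists_lim_of_approx (a : ℕ → ℝ) (h : ∀ ε > 0, ∃ b : ℕ → ℝ, (∃ l, Tendsto b atTop (nhds l)) ∧
    ∀ᶠ n in atTop, |a n - b n| ≤ ε) : ∃ l, Tendsto a atTop (nhds l) := by
  apply cauchySeq_tendsto_of_complete
  rw [Metric.cauchySeq_iff]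
  intro ε hε
  obtain ⟨b, ⟨l, hl⟩, hb⟩ := h (ε / 4) (by positivity)
  obtain ⟨N1, h1⟩ := Metric.cauchySeq_iff.1 hl.cauchySeq (ε / 4) (by positivity)
  obtain ⟨N2, h2⟩ := eventually_atTop.1 hb
  refine ⟨max N1 N2, fun m hm n hn => ?_⟩
  have e1 := h1 m ((le_max_left _ _).trans hm) n ((le_max_left _ _).trans hn)
  have e2 := h2 m ((le_max_right _ _).trans hm)
  have e3 := h2 n ((le_max_right _ _).trans hn)
  rw [Real.dist_eq] at e1 ⊢
  rw [abs_lt] at e1 ⊢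
  rw [abs_le] at e2 e3
  constructor <;> linarith

def FK (K : ℝ) (x : Fin 3 → ℝ) : ℝ := (max (1 - Lz x) K⁻¹)⁻¹

lemma FK_cont (K : ℝ) (hK : 0 < K) : Continuous (FK K) := by
  unfold FK
  have h1 := Lz_cont
  refine Continuous.inv₀ (by fun_prop) fun x => ?_
  have : 0 < max (1 - Lz x) K⁻¹ := lt_max_of_lt_right (by positivity)
  exact this.ne'

lemma FK_zero {n : ℕ} [NeZero n] (K : ℝ) (hK : 0 < K) : FK K (fun i => (tz (0 : TV n) i : ℝ) / n) = K := by
  unfold FK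
  rw [← lam_Lz, lam_zero, sub_self, max_eq_right (by positivity), inv_inv]

lemma FK_le {n : ℕ} [NeZero n] (K : ℝ) (hK : 0 < K) (k : TV n) (hk : k ≠ 0) :
    |ss k - FK K (fun i => (tz k i : ℝ) / n)| ≤ ptail K (lam k) := by
  unfold FK ptail
  rw [← lam_Lz]
  have h1 : 0 < 1 - lam k := by linarith [lam_lt k hk]
  change |ss k - _| ≤ if K < ss k then ss k else 0
  have e : (1 - lam k) = (ss k)⁻¹ := by simp [ss]
  have hs : 0 < ss k := by unfold ss; positivity
  rw [e]
  split_ifs with h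
  · rw [max_eq_right (inv_anti₀ hK h.le), inv_inv, abs_of_nonneg (by linarith)]
    linarith
  · rw [max_eq_left (inv_anti₀ hs (not_lt.1 h)), inv_inv]; simp

lemma A1_approx {n : ℕ} [NeZero n] (K : ℝ) (hK : 1 ≤ K) :
    |Am (TV n) (tmu (n := n)) 1 - ((n:ℝ) ^ 3)⁻¹ * ∑ k : TV n, FK K (fun i => (tz k i : ℝ) / n)| ≤
      41 / Real.sqrt K + K * ((n:ℝ) ^ 3)⁻¹ := by
  have hn := npos (n := n)
  have hK0 : 0 < K := by linarith
  have ht := tail_bound (n := n) K hK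
  rw [mom_TI] at ht
  unfold Am
  rw [mom_TI, ← mul_sub, ← Finset.sum_sub_distrib, abs_mul, abs_of_pos (by positivity : 0 < ((n:ℝ)^3)⁻¹)]
  have h1 : |∑ k : TV n, ((if k = 0 then 0 else ((1 - lam k)⁻¹) ^ 1) - FK K (fun i => (tz k i : ℝ) / n))| ≤
      ∑ k : TV n, (if k = 0 then 0 else ptail K (lam k)) + K := by
    refine (Finset.abs_sum_le_sum_abs _ _).trans ?_
    have : ∑ k : TV n, (if k = 0 then 0 else ptail K (lam k)) + K =
        ∑ k : TV n, ((if k = 0 then 0 else ptail K (lam k)) + if k = 0 then K else 0) := by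
      rw [Finset.sum_add_distrib]
      congr 1
      simp
    rw [this]
    refine Finset.sum_le_sum fun k _ => ?_
    by_cases hk : k = 0
    · subst hk
      rw [FK_zero K hK0]; simp [abs_of_pos hK0]
    · simp only [hk, if_false, add_zero, pow_one]
      exact FK_le K hK0 k hk
  refine (mul_le_mul_of_nonneg_left h1 (by positivity)).trans ?_
  rw [mul_add]
  linarith

lemma inv3_lim : Tendsto (fun n : ℕ => (((n + 1 : ℕ) : ℝ) ^ 3)⁻¹) atTop (nhds 0) := by
  have : Tendsto (fun n : ℕ => (((n : ℕ) : ℝ) ^ 3)⁻¹) atTop (nhds 0) :=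
    tendsto_inv_atTop_zero.comp ((tendsto_pow_atTop (by norm_num)).comp tendsto_natCast_atTop_atTop)
  exact this.comp (tendsto_add_atTop_nat 1)

lemma A1_lim : ∃ g : ℝ, 0 < g ∧ Tendsto (fun n : ℕ => Am (TV (n + 1)) (tmu (n := n + 1)) 1) atTop (nhds g) := by
  obtain ⟨g, hg⟩ : ∃ g, Tendsto (fun n : ℕ => Am (TV (n + 1)) (tmu (n := n + 1)) 1) atTop (nhds g) := by
    apply exists_lim_of_approx
    intro ε hε
    set K : ℝ := max 1 ((82 / ε) ^ 2) with hK
    have hK1 : 1 ≤ K := le_max_left _ _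
    have hsK : 82 / ε ≤ Real.sqrt K := by
      apply Real.le_sqrt_of_sq_le; exact le_max_right _ _
    have h41 : 41 / Real.sqrt K ≤ ε / 2 := by
      rw [div_le_iff₀ (Real.sqrt_pos.2 (by linarith))]
      rw [div_le_iff₀ hε] at hsK
      linarith
    refine ⟨_, riemann (FK K) (FK_cont K (by linarith)), ?_⟩
    have h2 := (inv3_lim.const_mul K)
    rw [mul_zero] at h2
    filter_upwards [h2.eventually_le_const (by linarith : (0:ℝ) < ε / 2)] with n hn
    have h3 := A1_approx (n := n + 1) K hK1
    linarith
  refine ⟨g, lt_of_lt_of_le one_pos ?_, hg⟩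
  have h1 := inv3_lim.const_sub 1
  rw [sub_zero] at h1
  exact le_of_tendsto_of_tendsto' h1 hg fun n => A1_ge (n := n + 1)

lemma geom_le (x : ℝ) (h0 : 0 ≤ x) (h1 : x < 1) (L : ℕ) : ∑ r ∈ Finset.range L, x ^ r ≤ (1 - x)⁻¹ := by
  rw [← tsum_geometric_of_lt_one h0 h1]
  exact (summable_geometric_of_lt_one h0 h1).sum_le_tsum _ fun _ _ => by positivity

lemma Phi_bound {n : ℕ} [NeZero n] (K : ℝ) (hK : 1 ≤ K) (L : ℕ) :
    ∑ r ∈ Finset.range L, Gt (TV n) (tmu (n := n)) r ^ 2 ≤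
      K * Am (TV n) (tmu (n := n)) 1 ^ 2 + Am (TV n) (tmu (n := n)) 2 * (41 / Real.sqrt K) := by
  have hA2 : 0 ≤ Am (TV n) (tmu (n := n)) 2 := by
    unfold Am
    exact SpecKer.mom_nonneg _ fun i => by positivity
  have h0 : ∑ r ∈ Finset.range L, Gt (TV n) (tmu (n := n)) r ^ 2 ≤
      K * Am (TV n) (tmu (n := n)) 1 ^ 2 + Am (TV n) (tmu (n := n)) 2 * mom (TV n) (tmu (n := n)) (ptail K) := by
    unfold Gt Am mom
    set c : ℝ := (Fintype.card (TV n) : ℝ)⁻¹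
    have e1 : ∑ r ∈ Finset.range L, (c * ∑ i : TI n, tmu i ^ r * (1 - tmu i)⁻¹) ^ 2 =
        c ^ 2 * ∑ i : TI n, ∑ j : TI n, (1 - tmu i)⁻¹ * (1 - tmu j)⁻¹ * ∑ r ∈ Finset.range L, (tmu i * tmu j) ^ r := by
      simp only [mul_pow, pow_two (∑ i : TI n, _), Finset.sum_mul_sum]
      rw [← Finset.mul_sum, Finset.sum_comm]
      congr 1
      refine Finset.sum_congr rfl fun i _ => ?_
      rw [Finset.sum_comm]
      refine Finset.sum_congr rfl fun j _ => ?_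
      rw [Finset.mul_sum]
      refine Finset.sum_congr rfl fun r _ => by ring
    have e2 : K * (c * ∑ i : TI n, ((1 - tmu i)⁻¹) ^ 1) ^ 2 + (c * ∑ i : TI n, ((1 - tmu i)⁻¹) ^ 2) * (c * ∑ i : TI n, ptail K (tmu i)) =
        c ^ 2 * ∑ i : TI n, ∑ j : TI n, (K * ((1 - tmu i)⁻¹ * (1 - tmu j)⁻¹) + ((1 - tmu i)⁻¹) ^ 2 * ptail K (tmu j)) := by
      simp only [Finset.sum_add_distrib, ← Finset.mul_sum, ← Finset.sum_mul, pow_one]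
      ring
    rw [e1, e2]
    refine mul_le_mul_of_nonneg_left (Finset.sum_le_sum fun i _ => Finset.sum_le_sum fun j _ => ?_) (by positivity)
    have hi : 1 ≤ (1 - tmu i)⁻¹ := ss_ge i.1 i.2
    have hj : 1 ≤ (1 - tmu j)⁻¹ := ss_ge j.1 j.2
    have hi0 : 0 ≤ tmu i := lam_nonneg i.1
    have hj0 : 0 ≤ tmu j := lam_nonneg j.1
    have hi1 : tmu i < 1 := lam_lt i.1 i.2
    have hj1 : tmu j < 1 := lam_lt j.1 j.2
    have hg := geom_le (tmu i * tmu j) (by positivity) (by nlinarith) L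
    have hgi : (1 - tmu i * tmu j)⁻¹ ≤ (1 - tmu i)⁻¹ := inv_anti₀ (by linarith) (by nlinarith)
    have hgj : (1 - tmu i * tmu j)⁻¹ ≤ (1 - tmu j)⁻¹ := inv_anti₀ (by linarith) (by nlinarith)
    set a := (1 - tmu i)⁻¹
    set b := (1 - tmu j)⁻¹ with hb
    have hab : 0 ≤ a * b := by positivity
    unfold ptail
    rw [← hb]
    split_ifs with h
    · have : a * b * ∑ r ∈ Finset.range L, (tmu i * tmu j) ^ r ≤ a * b * a :=
        mul_le_mul_of_nonneg_left (hg.trans hgi) hab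
      nlinarith
    · have : a * b * ∑ r ∈ Finset.range L, (tmu i * tmu j) ^ r ≤ a * b * K :=
        mul_le_mul_of_nonneg_left (hg.trans (hgj.trans (not_lt.1 h))) hab
      nlinarith
  refine h0.trans ?_
  have := mul_le_mul_of_nonneg_left (tail_bound (n := n) K hK) hA2
  linarith

end lims

section final

def Err (a b d φ i : ℝ) : ℝ :=
  6 * i + i ^ 4 + 4 * (a ^ 2 * i + 2 * a * d + b * i ^ 3 + b * √b * i + 4 * b ^ 2 * i ^ 2 +
    a * √(b * (8 * (d + φ)))) / a ^ 2

lemma real_comb (m A1 A2 A3 Φ Vr S : ℝ) (hm : 0 < m) (hA1 : 0 < A1) (hA2 : 0 ≤ A2)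
    (hV : |4 * Vr - 4 * S| ≤ 6 * m ^ 3 + 1)
    (hS : |A1 ^ 2 * ((m ^ 3) ^ 2 * S) - m ^ 3 * (m ^ 3 / 4 * ((m ^ 3 - 2) * A2))| ≤
      m ^ 3 * (A1 ^ 2 * (m ^ 3) ^ 2 + 2 * m ^ 3 * A1 * A3 + 2 * A2 * (m ^ 3 / 2 + m ^ 3 / 2 * √(m ^ 3 * A2) + 2 * m ^ 3 * A2)
        + A1 * m ^ 3 * √A2 * √(m ^ 3 * (8 * (A3 + m ^ 3 * Φ))))) :
    |4 * (Vr / m ^ 4) - (1 - 2 * (m⁻¹) ^ 3) * (A2 / m) / A1 ^ 2| ≤ Err A1 (A2 / m) (A3 / m ^ 4) (Φ / m) m⁻¹ := by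
  obtain ⟨b, rfl⟩ : ∃ b, A2 = m * b := ⟨A2 / m, by field_simp⟩
  obtain ⟨d, rfl⟩ : ∃ d, A3 = m ^ 4 * d := ⟨A3 / m ^ 4, by field_simp⟩
  obtain ⟨φ, rfl⟩ : ∃ φ, Φ = m * φ := ⟨Φ / m, by field_simp⟩
  have hb : 0 ≤ b := nonneg_of_mul_nonneg_right hA2 hm
  rw [mul_div_cancel_left₀ _ hm.ne', mul_div_cancel_left₀ _ hm.ne', mul_div_cancel_left₀ _ (by positivity)]
  have e1 : √(m ^ 3 * (m * b)) = m ^ 2 * √b := by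
    rw [show m ^ 3 * (m * b) = (m ^ 2) ^ 2 * b by ring, Real.sqrt_mul (by positivity), Real.sqrt_sq (by positivity)]
  have e2 : √(m * b) * √(m ^ 3 * (8 * (m ^ 4 * d + m ^ 3 * (m * φ)))) = m ^ 4 * √(b * (8 * (d + φ))) := by
    rw [← Real.sqrt_mul hA2, show m * b * (m ^ 3 * (8 * (m ^ 4 * d + m ^ 3 * (m * φ)))) = (m ^ 4) ^ 2 * (b * (8 * (d + φ))) by ring,
      Real.sqrt_mul (by positivity), Real.sqrt_sq (by positivity)]
  rw [mul_assoc (A1 * m ^ 3), e1, e2] at hS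
  set q := √(b * (8 * (d + φ)))
  set w := √b
  have f1 : |4 * (Vr / m ^ 4) - 4 * (S / m ^ 4)| ≤ 6 * m⁻¹ + (m⁻¹) ^ 4 := by
    have : 4 * (Vr / m ^ 4) - 4 * (S / m ^ 4) = (4 * Vr - 4 * S) / m ^ 4 := by ring
    rw [this, abs_div, abs_of_pos (by positivity : 0 < m ^ 4), div_le_iff₀ (by positivity)]
    refine hV.trans (le_of_eq ?_)
    field_simp
  have f2 : |4 * (S / m ^ 4) - (1 - 2 * (m⁻¹) ^ 3) * b / A1 ^ 2| ≤
      4 * (A1 ^ 2 * m⁻¹ + 2 * A1 * d + b * (m⁻¹) ^ 3 + b * w * m⁻¹ + 4 * b ^ 2 * (m⁻¹) ^ 2 + A1 * q) / A1 ^ 2 := by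
    have : 4 * (S / m ^ 4) - (1 - 2 * (m⁻¹) ^ 3) * b / A1 ^ 2 =
        (A1 ^ 2 * ((m ^ 3) ^ 2 * S) - m ^ 3 * (m ^ 3 / 4 * ((m ^ 3 - 2) * (m * b)))) * (4 / (A1 ^ 2 * m ^ 10)) := by
      field_simp
    rw [this, abs_mul, abs_of_pos (by positivity : 0 < 4 / (A1 ^ 2 * m ^ 10))]
    refine (mul_le_mul_of_nonneg_right hS (by positivity)).trans (le_of_eq ?_)
    field_simp
    ring
  unfold Err
  calc _ ≤ |4 * (Vr / m ^ 4) - 4 * (S / m ^ 4)| + |4 * (S / m ^ 4) - (1 - 2 * (m⁻¹) ^ 3) * b / A1 ^ 2| := abs_sub_le _ _ _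
    _ ≤ _ := add_le_add f1 f2

lemma Err_lim {a b d φ i : ℕ → ℝ} {g β : ℝ} (hg : 0 < g) (ha : Tendsto a atTop (nhds g)) (hb : Tendsto b atTop (nhds β))
    (hd : Tendsto d atTop (nhds 0)) (hφ : Tendsto φ atTop (nhds 0)) (hi : Tendsto i atTop (nhds 0)) :
    Tendsto (fun n => Err (a n) (b n) (d n) (φ n) (i n)) atTop (nhds 0) := by
  have hc : Tendsto (fun n => Err (a n) (b n) (d n) (φ n) (i n)) atTop (nhds (Err g β 0 0 0)) := by
    unfold Err
    have h1 : Tendsto (fun n => √(b n * (8 * (d n + φ n)))) atTop (nhds (√(β * (8 * (0 + 0))))) :=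
      (Real.continuous_sqrt.tendsto _).comp (hb.mul ((hd.add hφ).const_mul 8))
    have h2 : Tendsto (fun n => √(b n)) atTop (nhds (√β)) := (Real.continuous_sqrt.tendsto _).comp hb
    exact ((hi.const_mul 6).add (hi.pow 4)).add
      (((((((((ha.pow 2).mul hi).add ((ha.const_mul 2).mul hd)).add (hb.mul (hi.pow 3))).add ((hb.mul h2).mul hi)).add
        (((hb.pow 2).const_mul 4).mul (hi.pow 2))).add (ha.mul h1)).const_mul 4).div (ha.pow 2) (by positivity))
  have : Err g β 0 0 0 = 0 := by simp [Err]
  rwa [this] at hc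

lemma abs_sum_aux {n : ℕ} [NeZero n] (f : TV n → ℝ) (a t E : ℝ)
    (h : ∀ y, |a ^ 2 * (((n:ℝ) ^ 3) ^ 2 * f y) - t| ≤ E) :
    |a ^ 2 * (((n:ℝ) ^ 3) ^ 2 * ∑ y, f y) - (n:ℝ) ^ 3 * t| ≤ (n:ℝ) ^ 3 * E := by
  have e : a ^ 2 * (((n:ℝ) ^ 3) ^ 2 * ∑ y, f y) - (n:ℝ) ^ 3 * t =
      ∑ y : TV n, (a ^ 2 * (((n:ℝ) ^ 3) ^ 2 * f y) - t) := by
    rw [Finset.sum_sub_distrib, Finset.sum_const, Finset.card_univ, nsmul_eq_mul, card_TV, Finset.mul_sum, Finset.mul_sum]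
  rw [e]
  refine (Finset.abs_sum_le_sum_abs _ _).trans ((Finset.sum_le_sum fun y _ => h y).trans ?_)
  rw [Finset.sum_const, Finset.card_univ, nsmul_eq_mul, card_TV]

lemma main_bound {n : ℕ} [NeZero n] (hn : 3 ≤ n) {Ω : Type} [MeasurableSpace Ω] {P : Measure Ω} [IsProbabilityMeasure P]
    {X₁ X₂ : ℕ → Ω → (Fin 3 → ZMod n)} {ξ : (Fin 3 → ZMod n) → Ω → Bool}
    (h : IsPaintSetup (torus 3 n) P X₁ X₂ ξ) (A1 A2 A3 : ℝ) (h1 : A1 = Am (TV n) (tmu (n := n)) 1)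
    (h2 : A2 = Am (TV n) (tmu (n := n)) 2) (h3 : A3 = Am (TV n) (tmu (n := n)) 3) :
    |4 * (variance (fun ω => (paintedCount X₁ X₂ ξ ω : ℝ)) P / (n:ℝ) ^ 4) -
      (1 - 2 * ((n:ℝ)⁻¹) ^ 3) * (A2 / n) / A1 ^ 2| ≤
      Err A1 (A2 / n) (A3 / (n:ℝ) ^ 4) ((√n * A1 ^ 2 + A2 * (41 / √(√n))) / n) (n:ℝ)⁻¹ := by
  have hS := torus_spec hn
  have hn0 := npos (n := n)
  have hn3 : (3:ℝ) ≤ n := by exact_mod_cast hn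
  have hA1 : 0 < A1 := by
    rw [h1]
    refine lt_of_lt_of_le ?_ A1_ge
    have : ((n:ℝ) ^ 3)⁻¹ < 1 := inv_lt_one_of_one_lt₀ (one_lt_pow₀ (by linarith) (by norm_num))
    linarith
  have hV := var_bound hS h
  have hK : 1 ≤ √(n:ℝ) := Real.one_le_sqrt.2 (by linarith)
  have hP := fun y => hS.sum_pair_bound y _ (Phi_bound (n := n) (√(n:ℝ)) hK)
  rw [card_TV, ← h1, ← h2, ← h3] at hP
  rw [card_TV] at hV
  refine real_comb (n:ℝ) A1 A2 A3 _ _ _ hn0 hA1 (h2 ▸ hS.Am_nonneg 2) hV ?_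
  exact abs_sum_aux _ _ _ _ fun y => by convert hP y

theorem main_lim
    (Ω : ℕ → Type) [∀ n, MeasurableSpace (Ω n)]
    (P : ∀ n, Measure (Ω n)) (hP : ∀ n, IsProbabilityMeasure (P n))
    (X₁ X₂ : ∀ n, ℕ → Ω n → (Fin 3 → ZMod (n + 1)))
    (ξ : ∀ n, (Fin 3 → ZMod (n + 1)) → Ω n → Bool)
    (hsetup : ∀ n, IsPaintSetup (torus 3 (n + 1)) (P n) (X₁ n) (X₂ n) (ξ n)) :
    ∃ α : ℝ, 0 < α ∧
      Tendsto (fun n =>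
          variance (fun ω => (paintedCount (X₁ n) (X₂ n) (ξ n) ω : ℝ)) (P n)
            / ((n + 1 : ℝ)) ^ 4)
        atTop (nhds (α / 4)) := by
  obtain ⟨g, hg, ha⟩ := A1_lim
  have hb := A2_lim
  set β := ∑' z, gz z with hβ
  have hβ0 : 0 < β := a2_pos
  set a : ℕ → ℝ := fun n => Am (TV (n + 1)) (tmu (n := n + 1)) 1 with had
  set A2 : ℕ → ℝ := fun n => Am (TV (n + 1)) (tmu (n := n + 1)) 2 with hA2d
  set A3 : ℕ → ℝ := fun n => Am (TV (n + 1)) (tmu (n := n + 1)) 3 with hA3d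
  have hm : Tendsto (fun n : ℕ => ((n + 1 : ℕ) : ℝ)) atTop atTop :=
    tendsto_natCast_atTop_atTop.comp (tendsto_add_atTop_nat 1)
  have hi : Tendsto (fun n : ℕ => (((n + 1 : ℕ) : ℝ))⁻¹) atTop (nhds 0) := tendsto_inv_atTop_zero.comp hm
  have hd : Tendsto (fun n => A3 n / (((n + 1 : ℕ) : ℝ)) ^ 4) atTop (nhds 0) := by
    have h1 := hb.mul hi
    rw [mul_zero] at h1
    refine tendsto_of_tendsto_of_tendsto_of_le_of_le tendsto_const_nhds h1 (fun n => ?_) (fun n => ?_)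
    · have : 0 ≤ A3 n := by
        rw [hA3d]; unfold Am
        refine SpecKer.mom_nonneg _ fun i => ?_
        have h5 := ss_ge i.1 i.2
        have h6 : 0 ≤ ss i.1 := by linarith
        exact _root_.pow_nonneg h6 3
      positivity
    · have h2 := A3_le (n := n + 1)
      have hp := npos (n := n + 1)
      simp only
      rw [div_le_iff₀ (by positivity)]
      refine h2.trans (le_of_eq ?_)
      field_simp
  have hsq : Tendsto (fun n : ℕ => (√(((n + 1 : ℕ) : ℝ)))⁻¹) atTop (nhds 0) :=
    tendsto_inv_atTop_zero.comp (Real.tendsto_sqrt_atTop.comp hm)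
  have hssq : Tendsto (fun n : ℕ => (√(√(((n + 1 : ℕ) : ℝ))))⁻¹) atTop (nhds 0) :=
    tendsto_inv_atTop_zero.comp (Real.tendsto_sqrt_atTop.comp (Real.tendsto_sqrt_atTop.comp hm))
  have hφ : Tendsto (fun n => (√((n + 1 : ℕ) : ℝ) * a n ^ 2 + A2 n * (41 / √(√((n + 1 : ℕ) : ℝ)))) / ((n + 1 : ℕ) : ℝ)) atTop (nhds 0) := by
    have h1 := (hsq.mul (ha.pow 2)).add ((hb.mul hssq).const_mul 41)
    rw [zero_mul, mul_zero, mul_zero, add_zero] at h1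
    refine h1.congr fun n => ?_
    have hp := npos (n := n + 1)
    have hs : (√((n + 1 : ℕ) : ℝ))⁻¹ = √((n + 1 : ℕ) : ℝ) / ((n + 1 : ℕ) : ℝ) := by
      have := Real.sqrt_pos.2 hp
      have h5 := Real.mul_self_sqrt hp.le
      rw [inv_eq_one_div, div_eq_div_iff this.ne' hp.ne']
      linarith
    rw [hs]
    ring
  have hE := Err_lim hg ha hb hd hφ hi
  have hL : Tendsto (fun n : ℕ => (1 - 2 * ((((n + 1 : ℕ) : ℝ))⁻¹) ^ 3) * (A2 n / ((n + 1 : ℕ) : ℝ)) / a n ^ 2) atTop (nhds (β / g ^ 2)) := by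
    have h1 := ((((hi.pow 3).const_mul 2).const_sub 1).mul hb).div (ha.pow 2) (by positivity)
    simp only [zero_pow (three_ne_zero), mul_zero, sub_zero, one_mul] at h1
    exact h1
  refine ⟨β / g ^ 2, by positivity, ?_⟩
  have hD : Tendsto (fun n : ℕ => 4 * (variance (fun ω => (paintedCount (X₁ n) (X₂ n) (ξ n) ω : ℝ)) (P n) / (((n + 1 : ℕ) : ℝ)) ^ 4) -
      (1 - 2 * ((((n + 1 : ℕ) : ℝ))⁻¹) ^ 3) * (A2 n / ((n + 1 : ℕ) : ℝ)) / a n ^ 2) atTop (nhds 0) := by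
    rw [tendsto_zero_iff_abs_tendsto_zero]
    refine tendsto_of_tendsto_of_tendsto_of_le_of_le' tendsto_const_nhds hE (Eventually.of_forall fun n => abs_nonneg _) ?_
    filter_upwards [eventually_ge_atTop 2] with n hn
    have := hP n
    exact main_bound (n := n + 1) (by omega) (hsetup n) _ _ _ rfl rfl rfl
  have h4 := (hD.add hL).div_const 4
  rw [zero_add] at h4
  refine h4.congr fun n => ?_
  push_cast
  ring

end final

/-- For `d = 3`, on the torus `ℤ_n³` there is a constant
`0 < α₃ < ∞` with `Var(|𝒜_i|)/n⁴ → α₃/4`. -/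
theorem painting_variance_tori_dim_three
    (Ω : ℕ → Type) [∀ n, MeasurableSpace (Ω n)]
    (P : ∀ n, Measure (Ω n)) (hP : ∀ n, IsProbabilityMeasure (P n))
    (X₁ X₂ : ∀ n, ℕ → Ω n → (Fin 3 → ZMod (n + 1)))
    (ξ : ∀ n, (Fin 3 → ZMod (n + 1)) → Ω n → Bool)
    (hsetup : ∀ n, IsPaintSetup (torus 3 (n + 1)) (P n) (X₁ n) (X₂ n) (ξ n)) :
    ∃ α : ℝ, 0 < α ∧
      Tendsto (fun n =>
          variance (fun ω => (paintedCount (X₁ n) (X₂ n) (ξ n) ω : ℝ)) (P n)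
            / ((n + 1 : ℝ)) ^ 4)
        atTop (nhds (α / 4)) := by
  exact main_lim Ω P hP X₁ X₂ ξ hsetup

end RWPaint
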